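/- (Papanikolas) Let q = p^e be a prime power, K = 𝔽_q(θ), C the completion of an algebraic closure of 𝔽_q((1/θ)), K^alg the algebraic closure of K in C, and let e_Car(z) = ∑_{i≥0} z^{q^i} / D_i (with [i] = θ^{q^i} − θ and D_i = [i][i−1]^q ⋯ [1]^{q^{i−1}}) be the Carlitz exponential. Let ℓ_1, …, ℓ_m ∈ C be such that e_Car(ℓ_i) ∈ K^alg for i = 1, …, m. If ℓ_1, …, ℓ_m are linearly independent over K, then they are algebraically independent over K. -/

import Mathlib

/-- The Carlitz factorials `D_i = [i]·[i−1]^q ⋯ [1]^{q^{i−1}}`, where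
`[i] = θ^{q^i} − θ`, computed in a field `C` which is an algebra over
`K = 𝔽_q(θ) = RatFunc Fq` (with `θ = RatFunc.X`); they satisfy `D_0 = 1` and
`D_{i+1} = [i+1]·D_i^q`. -/
noncomputable def carlitzD (Fq : Type*) [Field Fq] [Fintype Fq]
    (C : Type*) [Field C] [Algebra (RatFunc Fq) C] : ℕ → C
  | 0 => 1
  | i + 1 =>
      ((algebraMap (RatFunc Fq) C RatFunc.X) ^ (Fintype.card Fq) ^ (i + 1) -
          algebraMap (RatFunc Fq) C RatFunc.X) *
        (carlitzD Fq C i) ^ (Fintype.card Fq)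

/-- The Carlitz exponential `e_Car(z) = ∑_{i≥0} z^{q^i}/D_i`. -/
noncomputable def carlitzExp (Fq : Type*) [Field Fq] [Fintype Fq]
    (C : Type*) [NormedField C] [Algebra (RatFunc Fq) C] (z : C) : C :=
  ∑' i : ℕ, z ^ (Fintype.card Fq) ^ i / carlitzD Fq C i

namespace Carlitz

set_option linter.unusedSectionVars false

open PowerSeries Finset

section Analysis

variable {C : Type*} [NormedField C]

theorem nsub_le_max [IsUltrametricDist C] (a b : C) : ‖a - b‖ ≤ max ‖a‖ ‖b‖ := by
  rw [sub_eq_add_neg, ← norm_neg b]; exact IsUltrametricDist.norm_add_le_max _ _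

/-- `‖f_k‖ R^k ≤ B` for all `k`. -/
def Bd (B R : ℝ) (f : PowerSeries C) : Prop := ∀ k, ‖coeff k f‖ * R ^ k ≤ B

theorem Bd.mono {B B' R : ℝ} {f : PowerSeries C} (h : Bd B R f) (hB : B ≤ B') : Bd B' R f :=
  fun k => (h k).trans hB

theorem Bd.nonneg {B R : ℝ} {f : PowerSeries C} (h : Bd B R f) : 0 ≤ B := by
  have := h 0
  simp only [pow_zero, mul_one] at this
  exact (norm_nonneg _).trans this

theorem Bd.antitone {B R R' : ℝ} {f : PowerSeries C} (h : Bd B R f) (h0 : 0 ≤ R') (hR : R' ≤ R) :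
    Bd B R' f := fun k =>
  (mul_le_mul_of_nonneg_left (pow_le_pow_left₀ h0 hR k) (norm_nonneg _)).trans (h k)

theorem Bd.zero {B R : ℝ} (hB : 0 ≤ B) : Bd B R (0 : PowerSeries C) := fun k => by simpa using hB

theorem Bd.neg {B R : ℝ} {f : PowerSeries C} (h : Bd B R f) : Bd B R (-f) := fun k => by
  simpa using h k

theorem Bd.add [IsUltrametricDist C] {B R : ℝ} {f g : PowerSeries C} (hR : 0 ≤ R) (hf : Bd B R f)
    (hg : Bd B R g) : Bd B R (f + g) := fun k => by
  rw [map_add]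
  have h := IsUltrametricDist.norm_add_le_max (coeff k f) (coeff k g)
  have hk : 0 ≤ R ^ k := pow_nonneg hR k
  calc ‖coeff k f + coeff k g‖ * R ^ k ≤ max ‖coeff k f‖ ‖coeff k g‖ * R ^ k :=
        mul_le_mul_of_nonneg_right h hk
    _ = max (‖coeff k f‖ * R ^ k) (‖coeff k g‖ * R ^ k) := max_mul_of_nonneg _ _ hk
    _ ≤ B := max_le (hf k) (hg k)

theorem Bd.sum [IsUltrametricDist C] {B R : ℝ} (hR : 0 ≤ R) (hB : 0 ≤ B) {ι : Type*} (s : Finset ι)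
    {f : ι → PowerSeries C} (hf : ∀ i ∈ s, Bd B R (f i)) : Bd B R (∑ i ∈ s, f i) := by
  classical
  induction s using Finset.induction_on with
  | empty => simpa using Bd.zero hB
  | insert a s ha ih =>
    rw [Finset.sum_insert ha]
    exact (hf a (mem_insert_self _ _)).add hR (ih fun i hi => hf i (mem_insert_of_mem hi))

theorem Bd.mul [IsUltrametricDist C] {B B' R : ℝ} {f g : PowerSeries C} (hR : 0 ≤ R)
    (hf : Bd B R f) (hg : Bd B' R g) : Bd (B * B') R (f * g) := fun k => by
  rw [coeff_mul]
  by_cases h0 : R ^ k = 0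
  · rw [h0, mul_zero]; exact mul_nonneg hf.nonneg hg.nonneg
  have hk : 0 < R ^ k := lt_of_le_of_ne (pow_nonneg hR k) (Ne.symm h0)
  rw [← le_div_iff₀ hk]
  refine IsUltrametricDist.norm_sum_le_of_forall_le_of_nonneg
    (div_nonneg (mul_nonneg hf.nonneg hg.nonneg) hk.le) fun x hx => ?_
  rw [le_div_iff₀ hk, norm_mul]
  rw [HasAntidiagonal.mem_antidiagonal] at hx
  calc ‖coeff x.1 f‖ * ‖coeff x.2 g‖ * R ^ k
      = (‖coeff x.1 f‖ * R ^ x.1) * (‖coeff x.2 g‖ * R ^ x.2) := by rw [← hx, pow_add]; ring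
    _ ≤ B * B' := mul_le_mul (hf _) (hg _) (mul_nonneg (norm_nonneg _) (pow_nonneg hR _)) hf.nonneg

theorem Bd.one {R : ℝ} : Bd 1 R (1 : PowerSeries C) := fun k => by
  rw [coeff_one]; split_ifs with h <;> simp [h]

theorem Bd.pow [IsUltrametricDist C] {B R : ℝ} {f : PowerSeries C} (hR : 0 ≤ R)
    (hf : Bd B R f) (n : ℕ) : Bd (B ^ n) R (f ^ n) := by
  induction n with
  | zero => simpa using Bd.one
  | succ n ih => rw [pow_succ, pow_succ]; exact ih.mul hR hf

theorem Bd.prod [IsUltrametricDist C] {R : ℝ} (hR : 0 ≤ R) {ι : Type*} (s : Finset ι)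
    {B : ι → ℝ} {f : ι → PowerSeries C} (hf : ∀ i ∈ s, Bd (B i) R (f i)) :
    Bd (∏ i ∈ s, B i) R (∏ i ∈ s, f i) := by
  classical
  induction s using Finset.induction_on with
  | empty => simpa using Bd.one
  | insert a s ha ih =>
    rw [Finset.prod_insert ha, Finset.prod_insert ha]
    exact (hf a (mem_insert_self _ _)).mul hR (ih fun i hi => hf i (mem_insert_of_mem hi))

theorem Bd.map {B R : ℝ} {f : PowerSeries C} {φ : C →+* C} {n : ℕ}
    (hφ : ∀ x, φ x = x ^ n) (hR : 0 ≤ R) (hf : Bd B R f) :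
    Bd (B ^ n) (R ^ n) (PowerSeries.map φ f) := fun k => by
  rw [coeff_map, hφ, norm_pow, ← pow_mul, mul_comm n k, pow_mul, ← mul_pow]
  exact pow_le_pow_left₀ (mul_nonneg (norm_nonneg _) (pow_nonneg hR _)) (hf k) _

theorem Bd.poly {b R : ℝ} (hR : 1 ≤ R) (hb : 0 ≤ b) (p : Polynomial C) {n : ℕ}
    (hn : p.natDegree ≤ n) (hp : ∀ k, ‖p.coeff k‖ ≤ b) : Bd (b * R ^ n) R (p : PowerSeries C) := by
  intro k
  rw [Polynomial.coeff_coe]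
  by_cases hk : k ≤ n
  · exact mul_le_mul (hp k) (pow_le_pow_right₀ hR hk) (by positivity) hb
  · rw [Polynomial.coeff_eq_zero_of_natDegree_lt (by omega)]
    simp; positivity

theorem Bd.exists_poly {R : ℝ} (hR : 1 ≤ R) (p : Polynomial C) :
    ∃ B, Bd B R (p : PowerSeries C) := by
  refine ⟨_, Bd.poly (b := ∑ k ∈ range (p.natDegree + 1), ‖p.coeff k‖) hR
    (sum_nonneg fun _ _ => norm_nonneg _) p le_rfl fun k => ?_⟩
  by_cases hk : k ≤ p.natDegree
  · exact single_le_sum (f := fun k => ‖p.coeff k‖) (fun _ _ => norm_nonneg _)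
      (mem_range.2 (by omega))
  · rw [Polynomial.coeff_eq_zero_of_natDegree_lt (by omega), norm_zero]
    exact sum_nonneg fun _ _ => norm_nonneg _

/-- absolute summability at `z` -/
def Sm (z : C) (f : PowerSeries C) : Prop := Summable fun k => ‖coeff k f * z ^ k‖

/-- evaluation at `z` -/
noncomputable def ev (z : C) (f : PowerSeries C) : C := ∑' k, coeff k f * z ^ k

theorem Bd.sm {B R : ℝ} {f : PowerSeries C} {z : C} (hf : Bd B R f) (hz : ‖z‖ < R) : Sm z f := by
  have hR : 0 < R := (norm_nonneg z).trans_lt hz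
  refine Summable.of_nonneg_of_le (fun k => norm_nonneg _) (fun k => ?_)
    ((summable_geometric_of_lt_one (r := ‖z‖ / R) (by positivity)
      ((div_lt_one hR).2 hz)).mul_left B)
  rw [norm_mul, norm_pow, div_pow, ← mul_div_assoc, le_div_iff₀ (pow_pos hR k)]
  nlinarith [mul_le_mul_of_nonneg_right (hf k) (pow_nonneg (norm_nonneg z) k)]

theorem Sm.poly (z : C) (p : Polynomial C) : Sm z (p : PowerSeries C) := by
  refine summable_of_ne_finset_zero (s := range (p.natDegree + 1)) fun k hk => ?_
  rw [mem_range, not_lt] at hk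
  rw [Polynomial.coeff_coe, Polynomial.coeff_eq_zero_of_natDegree_lt (by omega)]
  simp

theorem Sm.add {z : C} {f g : PowerSeries C} (hf : Sm z f) (hg : Sm z g) : Sm z (f + g) := by
  refine Summable.of_nonneg_of_le (fun k => norm_nonneg _) (fun k => ?_) (Summable.add hf hg)
  rw [map_add, add_mul]
  exact norm_add_le _ _

theorem Sm.zero {z : C} : Sm z 0 := by simpa using Sm.poly z 0

theorem Sm.sum {z : C} {ι : Type*} (s : Finset ι) {f : ι → PowerSeries C}
    (hf : ∀ i ∈ s, Sm z (f i)) : Sm z (∑ i ∈ s, f i) := by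
  classical
  induction s using Finset.induction_on with
  | empty => simpa using Sm.zero
  | insert a s ha ih =>
    rw [Finset.sum_insert ha]
    exact (hf a (mem_insert_self _ _)).add (ih fun i hi => hf i (mem_insert_of_mem hi))

theorem coeff_mul_pow (z : C) (f g : PowerSeries C) (k : ℕ) :
    coeff k (f * g) * z ^ k =
      ∑ x ∈ antidiagonal k, (coeff x.1 f * z ^ x.1) * (coeff x.2 g * z ^ x.2) := by
  rw [coeff_mul, sum_mul]
  refine sum_congr rfl fun x hx => ?_
  rw [HasAntidiagonal.mem_antidiagonal] at hx
  rw [← hx, pow_add]; ring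

theorem Sm.mul {z : C} {f g : PowerSeries C} (hf : Sm z f) (hg : Sm z g) : Sm z (f * g) := by
  have := summable_norm_sum_mul_antidiagonal_of_summable_norm hf hg
  simpa only [Sm, coeff_mul_pow] using this

variable [CompleteSpace C]

theorem ev_mul {z : C} {f g : PowerSeries C} (hf : Sm z f) (hg : Sm z g) :
    ev z (f * g) = ev z f * ev z g := by
  unfold ev
  rw [tsum_mul_tsum_eq_tsum_sum_antidiagonal_of_summable_norm hf hg]
  simp only [coeff_mul_pow]

theorem ev_add {z : C} {f g : PowerSeries C} (hf : Sm z f) (hg : Sm z g) :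
    ev z (f + g) = ev z f + ev z g := by
  unfold ev
  rw [← Summable.tsum_add hf.of_norm hg.of_norm]
  simp only [map_add, add_mul]

theorem ev_zero {z : C} : ev z (0 : PowerSeries C) = 0 := by simp [ev]

theorem ev_poly (z : C) (p : Polynomial C) : ev z (p : PowerSeries C) = p.eval z := by
  unfold ev
  rw [tsum_eq_sum (s := range (p.natDegree + 1)), Polynomial.eval_eq_sum_range]
  · simp
  · intro k hk
    rw [mem_range, not_lt] at hk
    rw [Polynomial.coeff_coe, Polynomial.coeff_eq_zero_of_natDegree_lt (by omega)]
    simp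

theorem ev_sum {z : C} {ι : Type*} (s : Finset ι) {f : ι → PowerSeries C}
    (hf : ∀ i ∈ s, Sm z (f i)) : ev z (∑ i ∈ s, f i) = ∑ i ∈ s, ev z (f i) := by
  classical
  induction s using Finset.induction_on with
  | empty => simpa using ev_zero
  | insert a s ha ih =>
    rw [Finset.sum_insert ha, Finset.sum_insert ha, ev_add (hf a (mem_insert_self _ _))
      (Sm.sum s fun i hi => hf i (mem_insert_of_mem hi)),
      ih fun i hi => hf i (mem_insert_of_mem hi)]

theorem ev_one {z : C} : ev z (1 : PowerSeries C) = 1 := by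
  simpa using ev_poly z 1

theorem Sm.one {z : C} : Sm z (1 : PowerSeries C) := by
  simpa using Sm.poly z 1


theorem Sm.pow {z : C} {f : PowerSeries C} (hf : Sm z f) (n : ℕ) : Sm z (f ^ n) := by
  induction n with
  | zero => simpa using Sm.poly z 1
  | succ n ih => rw [pow_succ]; exact ih.mul hf

theorem ev_pow {z : C} {f : PowerSeries C} (hf : Sm z f) (n : ℕ) : ev z (f ^ n) = ev z f ^ n := by
  induction n with
  | zero => simpa using ev_one
  | succ n ih => rw [pow_succ, ev_mul (hf.pow n) hf, ih, pow_succ]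

theorem ev_prod {z : C} {ι : Type*} (s : Finset ι) {f : ι → PowerSeries C}
    (hf : ∀ i ∈ s, Sm z (f i)) : Sm z (∏ i ∈ s, f i) ∧ ev z (∏ i ∈ s, f i) = ∏ i ∈ s, ev z (f i) := by
  classical
  induction s using Finset.induction_on with
  | empty => simpa using ⟨Sm.one, ev_one⟩
  | insert a s ha ih =>
    obtain ⟨h1, h2⟩ := ih fun i hi => hf i (mem_insert_of_mem hi)
    rw [Finset.prod_insert ha, Finset.prod_insert ha, ev_mul (hf a (mem_insert_self _ _)) h1, h2]
    exact ⟨(hf a (mem_insert_self _ _)).mul h1, rfl⟩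

theorem ev_map {z : C} {f : PowerSeries C} (hf : Sm z f) (φ : C →+* C) {n : ℕ}
    (hφ : ∀ x, φ x = x ^ n) : ev (φ z) (PowerSeries.map φ f) = φ (ev z f) := by
  have hc : Continuous φ := by
    have : (φ : C → C) = fun x => x ^ n := funext hφ
    rw [this]; exact continuous_pow n
  unfold ev
  rw [Summable.map_tsum hf.of_norm φ hc]
  simp

/-- Dividing out one zero. -/
theorem exists_div [IsUltrametricDist C] {B R : ℝ} {f : PowerSeries C} {z : C}
    (hf : Bd B R f) (hz : ‖z‖ < R) (h0 : ev z f = 0) :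
    ∃ g : PowerSeries C, Bd (B / R) R g ∧ f = ((Polynomial.X - Polynomial.C z : Polynomial C)) * g := by
  have hR : 0 < R := (norm_nonneg z).trans_lt hz
  have hB := hf.nonneg
  have hs : Summable fun k => coeff k f * z ^ k := (hf.sm hz).of_norm
  have hterm : ∀ k i, ‖coeff (k + 1 + i) f * z ^ i‖ ≤ B / R / R ^ k * (‖z‖ / R) ^ i := by
    intro k i
    have := hf (k + 1 + i)
    rw [norm_mul, norm_pow, div_pow, div_div, div_mul_div_comm, le_div_iff₀ (by positivity)]
    calc ‖coeff (k + 1 + i) f‖ * ‖z‖ ^ i * (R * R ^ k * R ^ i)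
        = (‖coeff (k + 1 + i) f‖ * R ^ (k + 1 + i)) * ‖z‖ ^ i := by ring
      _ ≤ B * ‖z‖ ^ i := mul_le_mul_of_nonneg_right this (by positivity)
  have hr : ‖z‖ / R < 1 := (div_lt_one hR).2 hz
  have hsum : ∀ k, Summable fun i => coeff (k + 1 + i) f * z ^ i := fun k =>
    Summable.of_norm (Summable.of_nonneg_of_le (fun i => norm_nonneg _) (hterm k)
      ((summable_geometric_of_lt_one (by positivity) hr).mul_left _))
  have hrec : ∀ k, (∑' i, coeff (k + i) f * z ^ i) =
      coeff k f + z * ∑' i, coeff (k + 1 + i) f * z ^ i := by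
    intro k
    have h1 : Summable fun i => coeff (k + i) f * z ^ i := by
      rcases k with _ | k
      · simpa using hs
      · exact hsum k
    rw [h1.tsum_eq_zero_add, ← tsum_mul_left]
    simp only [add_zero, pow_zero, mul_one]
    congr 1
    refine tsum_congr fun i => ?_
    rw [pow_succ, show k + (i + 1) = k + 1 + i by ring]; ring
  refine ⟨PowerSeries.mk fun k => ∑' i, coeff (k + 1 + i) f * z ^ i, fun k => ?_, ?_⟩
  · rw [coeff_mk, ← le_div_iff₀ (pow_pos hR k)]
    refine IsUltrametricDist.norm_tsum_le_of_forall_le_of_nonneg (by positivity) fun i =>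
      (hterm k i).trans ?_
    exact mul_le_of_le_one_right (by positivity) (pow_le_one₀ (by positivity) hr.le)
  · ext k
    simp only [Polynomial.coe_sub, Polynomial.coe_X, Polynomial.coe_C, sub_mul, map_sub]
    rcases k with _ | k
    · have := hrec 0
      simp only [zero_add] at this
      have h0' : (∑' i, coeff i f * z ^ i) = 0 := h0
      rw [h0'] at this
      rw [coeff_C_mul, coeff_mk]
      simp only [coeff_zero_X_mul, zero_add, zero_sub]
      linear_combination -this
    · have := hrec (k + 1)
      rw [coeff_C_mul, coeff_succ_X_mul, coeff_mk, coeff_mk]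
      linear_combination -this

/-- Schwarz lemma. -/
theorem schwarz [IsUltrametricDist C] {R : ℝ} (hR : 1 ≤ R) (z : ℕ → C)
    (hinj : Function.Injective z) (n : ℕ) :
    ∀ {B : ℝ} {f : PowerSeries C}, Bd B R f → (∀ i < n, ‖z i‖ < R ∧ ev (z i) f = 0) →
      ∀ k, ‖coeff k f‖ ≤ B / R ^ n * ∏ i ∈ range n, max 1 ‖z i‖ := by
  induction n with
  | zero =>
    intro B f hf _ k
    have := hf k
    simp only [pow_zero, div_one, range_zero, prod_empty, mul_one]
    exact (le_mul_of_one_le_right (norm_nonneg _) (one_le_pow₀ hR)).trans this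
  | succ n ih =>
    intro B f hf hz k
    obtain ⟨g, hg, rfl⟩ := exists_div hf (hz n (by omega)).1 (hz n (by omega)).2
    have hg' := ih hg fun i hi => by
      refine ⟨(hz i (by omega)).1, ?_⟩
      have h1 := (hz i (by omega)).2
      rw [ev_mul (Sm.poly _ _) (hg.sm (hz i (by omega)).1), ev_poly] at h1
      rcases mul_eq_zero.1 h1 with h | h
      · simp only [Polynomial.eval_sub, Polynomial.eval_X, Polynomial.eval_C, sub_eq_zero] at h
        have := hinj h; omega
      · exact h
    have hval : B / R / R ^ n = B / R ^ (n + 1) := by rw [div_div, pow_succ']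
    rw [hval] at hg'
    rw [prod_range_succ, ← mul_assoc]
    set K := B / R ^ (n + 1) * ∏ i ∈ range n, max 1 ‖z i‖ with hK
    have hK0 : 0 ≤ K := (norm_nonneg _).trans (hg' 0)
    have hm1 : (1:ℝ) ≤ max 1 ‖z n‖ := le_max_left _ _
    simp only [Polynomial.coe_sub, Polynomial.coe_X, Polynomial.coe_C, sub_mul, map_sub]
    rw [coeff_C_mul]
    refine (nsub_le_max _ _).trans (max_le ?_ ?_)
    · rcases k with _ | k
      · rw [coeff_zero_X_mul, norm_zero]; positivity
      · rw [coeff_succ_X_mul]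
        exact (hg' k).trans (le_mul_of_one_le_right hK0 hm1)
    · rw [norm_mul, mul_comm]
      exact mul_le_mul (hg' k) (le_max_right _ _) (norm_nonneg _) hK0

end Analysis

end Carlitz

namespace Carlitz

set_option linter.unusedSectionVars false

open PowerSeries Finset

/-- A filtration of (an order in) a finite extension of `𝔽_q(θ)` by heights. -/
structure Filt (C : Type*) [NormedField C] (q : ℕ) where
  G : ℕ → AddSubgroup C
  mono : Monotone G
  mul : ∀ {a b x y}, x ∈ G a → y ∈ G b → x * y ∈ G (a + b)
  D : ℕ
  hD : 1 ≤ D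
  c0 : ℕ
  card : ∀ h, Nat.card (G h) = q ^ (D * (h - c0))
  c1 : ℕ
  norm_le : ∀ {h x}, x ∈ G h → ‖x‖ ≤ (q : ℝ) ^ (c1 * h)
  c2 : ℕ
  le_norm : ∀ {h x}, x ∈ G h → x ≠ 0 → 1 ≤ ‖x‖ * (q : ℝ) ^ (c2 * h)

section

variable {C : Type*} [NormedField C] {q : ℕ}

namespace Filt

variable (F : Filt C q)

theorem pow_mem {x : C} {h : ℕ} (hx : x ∈ F.G h) {n : ℕ} (hn : 1 ≤ n) : x ^ n ∈ F.G (n * h) := by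
  induction n, hn using Nat.le_induction with
  | base => simpa using hx
  | succ n hn ih =>
    rw [pow_succ, add_mul, one_mul]; exact F.mul ih hx

theorem pow_mem' {x : C} {h : ℕ} (h1 : 1 ∈ F.G h) (hx : x ∈ F.G h) (n : ℕ) :
    x ^ n ∈ F.G (h * (n + 1)) := by
  rcases n with _ | n
  · simpa using h1
  · exact F.mono (by nlinarith) (F.pow_mem hx (n := n + 1) (by omega))

theorem siegel (hq : 2 ≤ q) {I J : Type*} [Fintype I] [Fintype J] (a : I → J → C) (h : I → ℕ)
    (ha : ∀ i j, a i j ∈ F.G (h i)) (H : ℕ)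
    (hc : ∑ i, h i + Fintype.card I * H < Fintype.card J * H) :
    ∃ x : J → C, x ≠ 0 ∧ (∀ j, x j ∈ F.G (F.c0 + H)) ∧ ∀ i, ∑ j, a i j * x j = 0 := by
  classical
  have hfin : ∀ n, Finite (F.G n) := fun n => Nat.finite_of_card_ne_zero (by
    rw [F.card]; positivity)
  have hft : ∀ n, Fintype (F.G n) := fun n => Fintype.ofFinite _
  let f : (J → F.G (F.c0 + H)) → (∀ i, F.G (h i + (F.c0 + H))) := fun x i =>
    ⟨∑ j, a i j * (x j : C), AddSubgroup.sum_mem _ fun j _ => F.mul (ha i j) (x j).2⟩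
  have hcard : Fintype.card (∀ i, F.G (h i + (F.c0 + H))) < Fintype.card (J → F.G (F.c0 + H)) := by
    rw [Fintype.card_pi, Fintype.card_fun]
    simp only [← Nat.card_eq_fintype_card, F.card]
    rw [Finset.prod_pow_eq_pow_sum, ← pow_mul]
    refine Nat.pow_lt_pow_right (by omega) ?_
    rw [← Finset.mul_sum, mul_assoc]
    refine Nat.mul_lt_mul_of_pos_left ?_ F.hD
    calc ∑ i, (h i + (F.c0 + H) - F.c0) = ∑ i, (h i + H) := sum_congr rfl fun i _ => by omega
      _ = ∑ i, h i + Fintype.card I * H := by simp [sum_add_distrib]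
      _ < Fintype.card J * H := hc
      _ = _ := by rw [Nat.add_sub_cancel_left, Nat.card_eq_fintype_card, mul_comm]
  obtain ⟨x, y, hne, hxy⟩ := Fintype.exists_ne_map_eq_of_card_lt f hcard
  refine ⟨fun j => x j - y j, fun h0 => hne ?_, fun j => AddSubgroup.sub_mem _ (x j).2 (y j).2,
    fun i => ?_⟩
  · funext j
    have := congrFun h0 j
    exact Subtype.ext (sub_eq_zero.1 this)
  · have := congrArg Subtype.val (congrFun hxy i)
    simp only [f] at this
    simp only [mul_sub, sum_sub_distrib, this, sub_self]

/-- all coefficients of height at most `h` -/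
def P (h : ℕ) (p : Polynomial C) : Prop := ∀ k, p.coeff k ∈ F.G h

variable {F}

theorem P.mono' {h h' : ℕ} {p : Polynomial C} (hp : F.P h p) (hh : h ≤ h') : F.P h' p :=
  fun k => F.mono hh (hp k)

theorem P.mul' {h h' : ℕ} {p p' : Polynomial C} (hp : F.P h p) (hp' : F.P h' p') :
    F.P (h + h') (p * p') := fun k => by
  rw [Polynomial.coeff_mul]
  exact AddSubgroup.sum_mem _ fun x _ => F.mul (hp _) (hp' _)

theorem P.sum' {ι : Type*} (s : Finset ι) {h : ℕ} {p : ι → Polynomial C}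
    (hp : ∀ i ∈ s, F.P h (p i)) : F.P h (∑ i ∈ s, p i) := fun k => by
  rw [Polynomial.finset_sum_coeff]
  exact AddSubgroup.sum_mem _ fun i hi => hp i hi k

theorem P.map' {h n : ℕ} {p : Polynomial C} (hp : F.P h p) (φ : C →+* C) (hφ : ∀ x, φ x = x ^ n)
    (hn : 1 ≤ n) : F.P (n * h) (p.map φ) := fun k => by
  rw [Polynomial.coeff_map, hφ]
  exact F.pow_mem (hp k) hn

theorem P.eval' {h h' e : ℕ} {p : Polynomial C} (hp : F.P h p) (he : p.natDegree ≤ e) {z : C}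
    (hz : ∀ k ≤ e, z ^ k ∈ F.G h') : p.eval z ∈ F.G (h + h') := by
  rw [Polynomial.eval_eq_sum_range]
  exact AddSubgroup.sum_mem _ fun k hk => F.mul (hp k) (hz k (by simp at hk; omega))

end Filt

/-- Liouville type bound. -/
theorem liouville [IsUltrametricDist C] (F : Filt C q) (hq : 2 ≤ q) {r h : ℕ} (b : Fin r → C)
    (hb : ∀ i, b i ∈ F.G h) (hb0 : b ≠ 0) {l : C} (hl : l ≠ 0) (hl1 : ‖l‖ ≤ 1)
    (hsum : ∑ i, b i * l ^ q ^ (i : ℕ) = 0) : 1 ≤ ‖l‖ * (q : ℝ) ^ ((F.c1 + F.c2) * h) := by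
  classical
  have hq0 : (0 : ℝ) < q := by positivity
  obtain ⟨i1, hi1⟩ := Function.ne_iff.1 hb0
  have hne : (univ.filter fun i => b i ≠ 0).Nonempty := ⟨i1, by simpa using hi1⟩
  set i0 := (univ.filter fun i => b i ≠ 0).min' hne with hi0
  have hbi0 : b i0 ≠ 0 := by
    have := Finset.min'_mem _ hne
    simpa using (mem_filter.1 this).2
  have hlt : ∀ i, b i ≠ 0 → i ≠ i0 → i0 < i := fun i hi hne' =>
    lt_of_le_of_ne (Finset.min'_le _ _ (by simpa using hi)) (Ne.symm hne')
  have hln : 0 < ‖l‖ := norm_pos_iff.2 hl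
  rw [← Finset.add_sum_erase _ _ (mem_univ i0)] at hsum
  have hbound : ‖∑ i ∈ univ.erase i0, b i * l ^ q ^ (i : ℕ)‖ ≤
      (q : ℝ) ^ (F.c1 * h) * ‖l‖ ^ (q ^ ((i0 : ℕ) + 1)) := by
    refine IsUltrametricDist.norm_sum_le_of_forall_le_of_nonneg (by positivity) fun i hi => ?_
    by_cases hbi : b i = 0
    · rw [hbi]; simp; positivity
    · have h1 := hlt i hbi (ne_of_mem_erase hi)
      rw [norm_mul, norm_pow]
      refine mul_le_mul (F.norm_le (hb i)) ?_ (by positivity) (by positivity)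
      exact pow_le_pow_of_le_one hln.le hl1 (Nat.pow_le_pow_right (by omega) h1)
  have heq : ‖b i0‖ * ‖l‖ ^ q ^ (i0 : ℕ) ≤ (q : ℝ) ^ (F.c1 * h) * ‖l‖ ^ (q ^ ((i0 : ℕ) + 1)) := by
    rw [← norm_pow, ← norm_mul, eq_neg_of_add_eq_zero_left hsum, norm_neg]; exact hbound
  have h2 : q ^ (i0 : ℕ) + 1 ≤ q ^ ((i0 : ℕ) + 1) := by
    rw [pow_succ]; nlinarith [Nat.one_le_pow (i0 : ℕ) q (by omega)]
  have h3 : ‖b i0‖ * ‖l‖ ^ q ^ (i0 : ℕ) ≤ (q : ℝ) ^ (F.c1 * h) * ‖l‖ * ‖l‖ ^ q ^ (i0 : ℕ) := by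
    refine heq.trans ?_
    rw [mul_assoc, ← pow_succ']
    exact mul_le_mul_of_nonneg_left (pow_le_pow_of_le_one hln.le hl1 h2) (by positivity)
  have h4 := le_of_mul_le_mul_right h3 (by positivity)
  calc (1 : ℝ) ≤ ‖b i0‖ * (q : ℝ) ^ (F.c2 * h) := F.le_norm (hb i0) hbi0
    _ ≤ (q : ℝ) ^ (F.c1 * h) * ‖l‖ * (q : ℝ) ^ (F.c2 * h) :=
        mul_le_mul_of_nonneg_right h4 (by positivity)
    _ = _ := by rw [add_mul, pow_add]; ring

theorem pow_apply_q {φ : C →+* C} (hφ : ∀ x, φ x = x ^ q) (n : ℕ) (x : C) :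
    (φ ^ n) x = x ^ q ^ n := by
  induction n generalizing x with
  | zero => simp
  | succ n ih => rw [pow_succ, RingHom.mul_def, RingHom.comp_apply, ih, hφ, ← pow_mul, pow_succ']

theorem map_map_succ (φ : C →+* C) (n : ℕ) (f : PowerSeries C) :
    PowerSeries.map (φ ^ n) (PowerSeries.map φ f) = PowerSeries.map (φ ^ (n + 1)) f := by
  rw [pow_succ, RingHom.mul_def, PowerSeries.map_comp]; rfl

theorem map_map_succ' (φ : C →+* C) (n : ℕ) (f : PowerSeries C) :
    PowerSeries.map φ (PowerSeries.map (φ ^ n) f) = PowerSeries.map (φ ^ (n + 1)) f := by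
  rw [pow_succ', RingHom.mul_def, PowerSeries.map_comp]; rfl

theorem map_coe_poly (φ : C →+* C) (p : Polynomial C) :
    PowerSeries.map φ (p : PowerSeries C) = (p.map φ : Polynomial C) := by
  ext k; simp

end

end Carlitz

namespace Carlitz

set_option linter.unusedSectionVars false

open PowerSeries Finset

/-- Data for the linear independence criterion. -/
structure LData (C : Type*) [NormedField C] (q : ℕ) (F : Filt C q) (M : Type*) [Fintype M] where
  hq : 2 ≤ q
  φ : C →+* C
  hφ : ∀ x, φ x = x ^ q
  hsurj : Function.Surjective φ
  θ : C
  hθ : ‖θ‖ = q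
  ψ : M → PowerSeries C
  b : ℕ
  hψ : ∀ μ, Bd ((q : ℝ) ^ b) ((q : ℝ) ^ 2) (ψ μ)
  Φ : M → M → Polynomial C
  Ψ : M → M → Polynomial C
  u : Polynomial C
  hΦ : ∀ μ, PowerSeries.map φ (ψ μ) = ∑ κ, (Φ μ κ : PowerSeries C) * ψ κ
  hΨ : ∀ μ, ∑ κ, (Ψ μ κ : PowerSeries C) * PowerSeries.map φ (ψ κ) = (u : PowerSeries C) * ψ μ
  hu : ∀ ν i, ν ≤ i → (u.map (φ ^ i)).eval (θ ^ q ^ ν) ≠ 0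
  hind : ∀ g : M → Polynomial C, ∑ μ, (g μ : PowerSeries C) * ψ μ = 0 → ∀ μ, g μ = 0
  c : ℕ
  e : ℕ
  hΦc : ∀ μ κ, F.P c (Φ μ κ)
  hΦe : ∀ μ κ, (Φ μ κ).natDegree ≤ e
  hΨc : ∀ μ κ, F.P c (Ψ μ κ)
  hΨe : ∀ μ κ, (Ψ μ κ).natDegree ≤ e
  h1c : (1 : C) ∈ F.G c
  hθc : θ ∈ F.G c
  ρ : M → C
  hρc : ∀ μ, ρ μ ∈ F.G c
  hρ0 : ρ ≠ 0
  hρ : ∑ μ, ρ μ * ev θ (ψ μ) = 0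

namespace LData

variable {C : Type*} [NormedField C] [CompleteSpace C] [IsUltrametricDist C] {q : ℕ}
  {F : Filt C q} {M : Type*} [Fintype M] (S : LData C q F M)

theorem norm_z (ν : ℕ) : ‖S.θ ^ q ^ ν‖ = (q : ℝ) ^ q ^ ν := by rw [norm_pow, S.hθ]

theorem q1 (S : LData C q F M) : (1 : ℝ) < q := by have := S.hq; exact_mod_cast this

theorem z_lt {ν i : ℕ} (h : ν ≤ i) : ‖S.θ ^ q ^ ν‖ < ((q : ℝ) ^ 2) ^ q ^ i := by
  rw [S.norm_z, ← pow_mul]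
  refine pow_lt_pow_right₀ S.q1 ?_
  have h1 : q ^ ν ≤ q ^ i := Nat.pow_le_pow_right (by have := S.hq; omega) h
  have h2 : 0 < q ^ i := Nat.pow_pos (by have := S.hq; omega)
  omega

theorem bd_map (i : ℕ) (μ : M) :
    Bd (((q : ℝ) ^ S.b) ^ q ^ i) (((q : ℝ) ^ 2) ^ q ^ i) (PowerSeries.map (S.φ ^ i) (S.ψ μ)) :=
  (S.hψ μ).map (pow_apply_q S.hφ i) (by positivity)

theorem sm_map {ν i : ℕ} (h : ν ≤ i) (μ : M) :
    Sm (S.θ ^ q ^ ν) (PowerSeries.map (S.φ ^ i) (S.ψ μ)) :=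
  (S.bd_map i μ).sm (S.z_lt h)

theorem pow_z_mem {ν i k e : ℕ} (h : ν ≤ i) (hk : k ≤ e) :
    (S.θ ^ q ^ ν) ^ k ∈ F.G (S.c * (q ^ i * (e + 1))) := by
  rw [← pow_mul]
  refine F.mono ?_ (F.pow_mem' S.h1c S.hθc _)
  have h1 : q ^ ν ≤ q ^ i := Nat.pow_le_pow_right (by have := S.hq; omega) h
  have h2 : 0 < q ^ i := Nat.pow_pos (by have := S.hq; omega)
  refine Nat.mul_le_mul_left _ ?_
  have : q ^ ν * k ≤ q ^ i * e := Nat.mul_le_mul h1 hk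
  nlinarith

theorem psiphi (μ κ : M) [DecidableEq M] : ∑ x, S.Ψ μ x * S.Φ x κ = if μ = κ then S.u else 0 := by
  have h := S.hΨ μ
  simp only [S.hΦ, mul_sum] at h
  rw [sum_comm] at h
  have h2 := S.hind (fun κ => (∑ x, S.Ψ μ x * S.Φ x κ) - if μ = κ then S.u else 0) (by
    have : ∀ κ, (((∑ x, S.Ψ μ x * S.Φ x κ) - if μ = κ then S.u else 0 : Polynomial C) :
        PowerSeries C) * S.ψ κ = ∑ x, (S.Ψ μ x : PowerSeries C) * ((S.Φ x κ : PowerSeries C) * S.ψ κ)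
          - if μ = κ then (S.u : PowerSeries C) * S.ψ μ else 0 := by
      intro κ
      rw [Polynomial.coe_sub, sub_mul]
      congr 1
      · rw [← Polynomial.coeToPowerSeries.ringHom_apply, map_sum, sum_mul]
        simp [mul_assoc]
      · split_ifs with h
        · rw [h]
        · simp
    simp only [this, sum_sub_distrib, h]
    simp) κ
  exact sub_eq_zero.1 h2

theorem hΨ_map (i : ℕ) (μ : M) :
    ∑ κ, (((S.Ψ μ κ).map (S.φ ^ i) : Polynomial C) : PowerSeries C) *
      PowerSeries.map (S.φ ^ (i + 1)) (S.ψ κ) =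
    ((S.u.map (S.φ ^ i) : Polynomial C) : PowerSeries C) * PowerSeries.map (S.φ ^ i) (S.ψ μ) := by
  have := congrArg (PowerSeries.map (S.φ ^ i)) (S.hΨ μ)
  simpa only [map_sum, map_mul, map_map_succ, map_coe_poly] using this

theorem hΦ_map (i : ℕ) (μ : M) :
    PowerSeries.map (S.φ ^ (i + 1)) (S.ψ μ) =
    ∑ κ, (((S.Φ μ κ).map (S.φ ^ i) : Polynomial C) : PowerSeries C) *
      PowerSeries.map (S.φ ^ i) (S.ψ κ) := by
  have := congrArg (PowerSeries.map (S.φ ^ i)) (S.hΦ μ)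
  simpa only [map_sum, map_mul, map_map_succ, map_coe_poly] using this

theorem rows (ν i : ℕ) (h : ν ≤ i) : ∃ row : M → C, row ≠ 0 ∧
    (∀ μ, row μ ∈ F.G (S.c * (S.e + 2) * q ^ i)) ∧
    ∑ μ, row μ * ev (S.θ ^ q ^ ν) (PowerSeries.map (S.φ ^ i) (S.ψ μ)) = 0 := by
  classical
  have hq := S.hq
  induction i, h using Nat.le_induction with
  | base =>
    refine ⟨fun μ => (S.φ ^ ν) (S.ρ μ), fun h0 => S.hρ0 ?_, fun μ => ?_, ?_⟩
    · funext μ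
      have : (S.φ ^ ν) (S.ρ μ) = 0 := congrFun h0 μ
      exact (_root_.map_eq_zero _).1 this
    · beta_reduce
      rw [pow_apply_q S.hφ]
      refine F.mono ?_ (F.pow_mem (S.hρc μ) (Nat.one_le_pow _ _ (by omega)))
      nlinarith [Nat.zero_le (S.c * (S.e + 1) * q ^ ν)]
    · have h1 : ∀ μ, ev (S.θ ^ q ^ ν) (PowerSeries.map (S.φ ^ ν) (S.ψ μ)) =
          (S.φ ^ ν) (ev S.θ (S.ψ μ)) := fun μ => by
        rw [← pow_apply_q S.hφ]
        refine ev_map ?_ _ (pow_apply_q S.hφ ν)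
        exact (S.hψ μ).sm (by simpa using S.z_lt (le_refl 0))
      simp only [h1, ← map_mul, ← map_sum, S.hρ, map_zero]
  | succ i hi ih =>
    obtain ⟨row, h0, hmem, hsum⟩ := ih
    set z := S.θ ^ q ^ ν with hz
    refine ⟨fun κ => ∑ μ, row μ * ((S.Ψ μ κ).map (S.φ ^ i)).eval z, fun h' => h0 ?_, fun κ => ?_, ?_⟩
    · funext κ
      have h1 : ∑ x, (∑ μ, row μ * ((S.Ψ μ x).map (S.φ ^ i)).eval z) *
          ((S.Φ x κ).map (S.φ ^ i)).eval z = row κ * (S.u.map (S.φ ^ i)).eval z := by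
        simp only [sum_mul]
        rw [sum_comm]
        have : ∀ μ, ∑ x, row μ * ((S.Ψ μ x).map (S.φ ^ i)).eval z * ((S.Φ x κ).map (S.φ ^ i)).eval z
            = row μ * ((if μ = κ then S.u else 0 : Polynomial C).map (S.φ ^ i)).eval z := by
          intro μ
          rw [← S.psiphi, Polynomial.map_sum, Polynomial.eval_finsetSum, mul_sum]
          simp [mul_assoc]
        rw [sum_congr rfl fun μ _ => this μ, Finset.sum_eq_single κ]
        · simp
        · intro μ _ hμ; simp [hμ]
        · simp
      have h2 : ∀ x, ∑ μ, row μ * ((S.Ψ μ x).map (S.φ ^ i)).eval z = 0 := fun x => congrFun h' x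
      simp only [h2, zero_mul, sum_const_zero] at h1
      exact (mul_eq_zero.1 h1.symm).resolve_right (S.hu ν i hi)
    · refine AddSubgroup.sum_mem _ fun μ _ => ?_
      refine F.mono ?_ (F.mul (hmem μ) (Filt.P.eval' (F := F) (e := S.e)
        ((S.hΨc μ κ).map' (S.φ ^ i) (pow_apply_q S.hφ i) (Nat.one_le_pow _ _ (by omega)))
        (Polynomial.natDegree_map_le.trans (S.hΨe μ κ)) (fun k hk => S.pow_z_mem hi hk)))
      rw [pow_succ]
      nlinarith [Nat.mul_le_mul_left (S.c * (S.e + 2) * q ^ i) hq]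
    · simp only [sum_mul]
      rw [sum_comm]
      have : ∀ μ, ∑ x, row μ * ((S.Ψ μ x).map (S.φ ^ i)).eval z *
          ev z (PowerSeries.map (S.φ ^ (i + 1)) (S.ψ x)) =
          (S.u.map (S.φ ^ i)).eval z * (row μ * ev z (PowerSeries.map (S.φ ^ i) (S.ψ μ))) := by
        intro μ
        have h3 := congrArg (ev z) (S.hΨ_map i μ)
        rw [ev_sum _ fun x _ => (Sm.poly _ _).mul (S.sm_map (by omega) x),
          ev_mul (Sm.poly _ _) (S.sm_map hi μ), ev_poly] at h3
        rw [mul_left_comm, ← h3, mul_sum]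
        refine sum_congr rfl fun x _ => ?_
        rw [ev_mul (Sm.poly _ _) (S.sm_map (by omega) x), ev_poly, mul_assoc]
      rw [sum_congr rfl fun μ _ => this μ, ← mul_sum, hsum, mul_zero]

end LData

end Carlitz

namespace Carlitz

set_option linter.unusedSectionVars false

open PowerSeries Finset

section mkP

variable {C : Type*} [NormedField C]

/-- polynomial with given coefficients -/
noncomputable def mkP {n : ℕ} (x : Fin n → C) : Polynomial C :=
  ∑ j : Fin n, Polynomial.monomial (j : ℕ) (x j)

theorem mkP_coeff_lt {n : ℕ} (x : Fin n → C) {k : ℕ} (hk : k < n) :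
    (mkP x).coeff k = x ⟨k, hk⟩ := by
  rw [mkP, Polynomial.finsetSum_coeff, Finset.sum_eq_single ⟨k, hk⟩]
  · simp
  · intro j _ hj
    rw [Polynomial.coeff_monomial, if_neg]
    intro h; exact hj (Fin.ext h)
  · simp

theorem mkP_coeff_ge {n : ℕ} (x : Fin n → C) {k : ℕ} (hk : n ≤ k) : (mkP x).coeff k = 0 := by
  rw [mkP, Polynomial.finsetSum_coeff]
  refine Finset.sum_eq_zero fun j _ => ?_
  rw [Polynomial.coeff_monomial, if_neg]
  have := j.2; omega

theorem mkP_natDegree {n : ℕ} (x : Fin n → C) : (mkP x).natDegree ≤ n := by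
  rw [Polynomial.natDegree_le_iff_coeff_eq_zero]
  exact fun k hk => mkP_coeff_ge x hk.le

theorem mkP_eval {n : ℕ} (x : Fin n → C) (z : C) : (mkP x).eval z = ∑ j : Fin n, z ^ (j : ℕ) * x j := by
  rw [mkP, Polynomial.eval_finsetSum]
  simp [mul_comm]

theorem mkP_P {q : ℕ} {F : Filt C q} {n h : ℕ} {x : Fin n → C} (hx : ∀ j, x j ∈ F.G h) :
    F.P h (mkP x) := fun k => by
  by_cases hk : k < n
  · rw [mkP_coeff_lt x hk]; exact hx _
  · rw [mkP_coeff_ge x (by omega)]; exact AddSubgroup.zero_mem _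

theorem mkP_eq_zero {n : ℕ} {x : Fin n → C} (h : mkP x = 0) : x = 0 := by
  funext j
  have := congrArg (fun p => Polynomial.coeff p (j : ℕ)) h
  simpa [mkP_coeff_lt x j.2] using this

end mkP

namespace LData

variable {C : Type*} [NormedField C] [CompleteSpace C] [IsUltrametricDist C] {q : ℕ}
  {F : Filt C q} {M : Type*} [Fintype M] (S : LData C q F M)

/-- height constant -/
def K2 (S : LData C q F M) : ℕ :=
  F.c0 + ((2 * Fintype.card M + 1) * (S.c * (S.e + 2)) + 3 * Fintype.card M * S.c + 1)

theorem sum_pow_le (hq : 2 ≤ q) (N : ℕ) : ∑ ν : Fin N, q ^ (ν : ℕ) ≤ q ^ N := by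
  rw [Fin.sum_univ_eq_sum_range (fun n => q ^ n)]
  induction N with
  | zero => simp
  | succ n ih => rw [sum_range_succ, pow_succ]; nlinarith [Nat.mul_le_mul_left (q ^ n) hq]

theorem interp {k N X : ℕ} (hk : 1 ≤ k) (hN : N = (2 * Fintype.card M + 1) * k)
    (hX : X = 2 * Fintype.card M * k) :
    ∃ h : M → Polynomial C, h ≠ 0 ∧ (∀ κ, F.P (S.K2 * q ^ N) (h κ)) ∧ (∀ κ, (h κ).natDegree ≤ X) ∧
      ∀ ν < N, ev (S.θ ^ q ^ ν)
        (∑ κ, (h κ : PowerSeries C) * PowerSeries.map (S.φ ^ N) (S.ψ κ)) = 0 := by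
  classical
  have hq := S.hq
  obtain ⟨μ0, -⟩ := Function.ne_iff.1 S.hρ0
  have hr : 1 ≤ Fintype.card M := Fintype.card_pos_iff.2 ⟨μ0⟩
  have hrow := fun ν : Fin N => S.rows ν N ν.2.le
  choose row h0 hmem hsum using hrow
  have hne := fun ν => Function.ne_iff.1 (h0 ν)
  choose m hm using hne
  let I := Σ ν : Fin N, {μ : M // μ ≠ m ν}
  let a : I → M × Fin X → C := fun i x =>
    ((if x.1 = i.2.1 then row i.1 (m i.1) else 0) - (if x.1 = m i.1 then row i.1 i.2.1 else 0)) *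
      (S.θ ^ q ^ (i.1 : ℕ)) ^ (x.2 : ℕ)
  let hh : I → ℕ := fun i =>
    S.c * (S.e + 2) * q ^ N + S.c * (q ^ (i.1 : ℕ) * (X + 1))
  have ha : ∀ i x, a i x ∈ F.G (hh i) := by
    intro i x
    refine F.mul (AddSubgroup.sub_mem _ ?_ ?_) (S.pow_z_mem le_rfl x.2.2.le)
    · split_ifs
      · exact hmem _ _
      · exact AddSubgroup.zero_mem _
    · split_ifs
      · exact hmem _ _
      · exact AddSubgroup.zero_mem _
  have hcardm : ∀ ν : Fin N, Fintype.card {μ : M // μ ≠ m ν} = Fintype.card M - 1 := by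
    intro ν; simp
  have hcardI : Fintype.card I = N * (Fintype.card M - 1) := by
    simp only [I, Fintype.card_sigma, hcardm]; simp
  set r := Fintype.card M with hrdef
  set C' := (2 * r + 1) * (S.c * (S.e + 2)) + 3 * r * S.c + 1 with hC'
  obtain ⟨r', hr'⟩ : ∃ r', r = r' + 1 := ⟨r - 1, by omega⟩
  obtain ⟨x, hx0, hxG, hxs⟩ := F.siegel hq a hh ha (C' * q ^ N) (by
    have h1 : ∑ i, hh i = ∑ ν : Fin N, (r - 1) * (S.c * (S.e + 2) * q ^ N +
        S.c * (q ^ (ν : ℕ) * (X + 1))) := by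
      rw [Fintype.sum_sigma]
      refine sum_congr rfl fun ν _ => ?_
      simp only [hh, sum_const, card_univ, hcardm, smul_eq_mul]
    have h2 : ∑ i, hh i ≤ (r - 1) * (N * (S.c * (S.e + 2) * q ^ N) + S.c * (q ^ N * (X + 1))) := by
      rw [h1, ← mul_sum]
      refine Nat.mul_le_mul_left _ ?_
      rw [sum_add_distrib]
      refine Nat.add_le_add (by simp) ?_
      rw [← mul_sum, ← sum_mul]
      exact Nat.mul_le_mul_left _ (Nat.mul_le_mul_right _ (sum_pow_le hq N))
    rw [hcardI, Fintype.card_prod, Fintype.card_fin, ← hrdef]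
    refine lt_of_le_of_lt (Nat.add_le_add_right h2 _) ?_
    have hQ : 0 < q ^ N := Nat.pow_pos (by omega)
    rw [hr', Nat.add_sub_cancel]
    rw [hr'] at hN hX hC'
    have h3 : X + 1 ≤ 3 * (r' + 1) * k := by rw [hX]; nlinarith
    calc r' * (N * (S.c * (S.e + 2) * q ^ N) + S.c * (q ^ N * (X + 1))) + N * r' * (C' * q ^ N)
        ≤ r' * (N * (S.c * (S.e + 2) * q ^ N) + S.c * (q ^ N * (3 * (r' + 1) * k)))
          + N * r' * (C' * q ^ N) := by gcongr
      _ = r' * (k * q ^ N * (C' - 1)) + N * r' * (C' * q ^ N) := by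
          rw [hC', Nat.add_sub_cancel, hN]; ring
      _ ≤ r' * (k * q ^ N * C') + N * r' * (C' * q ^ N) := by gcongr; omega
      _ < (r' + 2) * (k * q ^ N * C') + N * r' * (C' * q ^ N) := by
          have : 0 < k * q ^ N * C' := by
            have : 0 < C' := by omega
            positivity
          gcongr; omega
      _ = (r' + 1) * X * (C' * q ^ N) := by rw [hN, hX]; ring)
  refine ⟨fun κ => mkP fun j => x (κ, j), fun h => hx0 ?_, fun κ => mkP_P fun j => ?_,
    fun κ => mkP_natDegree _, fun ν hν => ?_⟩
  · funext κj
    exact congrFun (mkP_eq_zero (congrFun h κj.1)) κj.2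
  · refine F.mono ?_ (hxG _)
    have hQ : 1 ≤ q ^ N := Nat.pow_pos (by omega)
    rw [K2, ← hrdef, ← hC']
    nlinarith
  · set z := S.θ ^ q ^ ν with hz
    have hprop : ∀ μ, row ⟨ν, hν⟩ (m ⟨ν, hν⟩) * (mkP fun j => x (μ, j)).eval z =
        row ⟨ν, hν⟩ μ * (mkP fun j => x (m ⟨ν, hν⟩, j)).eval z := by
      intro μ
      by_cases hμ : μ = m ⟨ν, hν⟩
      · rw [hμ]
      · have := hxs ⟨⟨ν, hν⟩, ⟨μ, hμ⟩⟩
        rw [Fintype.sum_prod_type] at this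
        simp only [a, sub_mul, sum_sub_distrib] at this
        rw [Finset.sum_eq_single μ, Finset.sum_eq_single (m ⟨ν, hν⟩)] at this
        · simp only [if_true] at this
          rw [sub_eq_zero] at this
          simpa only [mkP_eval, mul_sum, mul_assoc] using this
        · intro b _ hb; simp [hb]
        · simp
        · intro b _ hb; simp [hb]
        · simp
    rw [ev_sum _ fun κ _ => (Sm.poly _ _).mul (S.sm_map hν.le κ)]
    have h4 : ∀ κ, ev z ((mkP fun j => x (κ, j) : Polynomial C) *
        PowerSeries.map (S.φ ^ N) (S.ψ κ)) = (mkP fun j => x (κ, j)).eval z *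
        ev z (PowerSeries.map (S.φ ^ N) (S.ψ κ)) := fun κ => by
      rw [ev_mul (Sm.poly _ _) (S.sm_map hν.le κ), ev_poly]
    rw [sum_congr rfl fun κ _ => h4 κ]
    refine (mul_eq_zero.1 (?_ : row ⟨ν, hν⟩ (m ⟨ν, hν⟩) * _ = 0)).resolve_left (hm _)
    rw [mul_sum]
    simp only [← mul_assoc, hprop]
    have := hsum ⟨ν, hν⟩
    rw [← mul_zero ((mkP fun j => x (m ⟨ν, hν⟩, j)).eval z), ← this, mul_sum]
    exact sum_congr rfl fun κ _ => by ring

end LData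

end Carlitz

namespace Carlitz

set_option linter.unusedSectionVars false

open PowerSeries Finset

section
variable {C : Type*} [NormedField C]

theorem mkP_mul_coeff {n : ℕ} (x : Fin n → C) (g : Polynomial C) (s : ℕ) :
    (mkP x * g).coeff s = ∑ j : Fin n, (if (j : ℕ) ≤ s then g.coeff (s - j) else 0) * x j := by
  rw [mkP, sum_mul, Polynomial.finsetSum_coeff]
  refine sum_congr rfl fun j _ => ?_
  rw [← Polynomial.C_mul_X_pow_eq_monomial, mul_assoc, Polynomial.coeff_C_mul,
    Polynomial.coeff_X_pow_mul', mul_comm]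

theorem lowest {q : ℕ} {φ : C →+* C} (hφ : ∀ x, φ x = x ^ q) {n : ℕ} (a : Fin n → Polynomial C)
    (ha : a ≠ 0) (E : PowerSeries C) (hE : E ≠ 0)
    (h : ∑ i : Fin n, (a i : PowerSeries C) * PowerSeries.map (φ ^ (i : ℕ)) E = 0) :
    ∃ j0 k0, (fun i => (a i).coeff j0) ≠ 0 ∧ coeff k0 E ≠ 0 ∧
      ∑ i : Fin n, (a i).coeff j0 * (coeff k0 E) ^ q ^ (i : ℕ) = 0 := by
  classical
  have h1 : ∃ j0, (fun i => (a i).coeff j0) ≠ 0 := by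
    obtain ⟨i, hi⟩ := Function.ne_iff.1 ha
    obtain ⟨j, hj⟩ : ∃ j, (a i).coeff j ≠ 0 := by
      by_contra! hc
      exact hi (Polynomial.ext fun j => by simpa using hc j)
    exact ⟨j, fun h0 => hj (congrFun h0 i)⟩
  have h2 : ∃ k0, coeff k0 E ≠ 0 := by
    by_contra! hc
    exact hE (PowerSeries.ext fun j => by simpa using hc j)
  refine ⟨Nat.find h1, Nat.find h2, Nat.find_spec h1, Nat.find_spec h2, ?_⟩
  have h3 := congrArg (coeff (Nat.find h1 + Nat.find h2)) h
  rw [map_sum, map_zero] at h3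
  refine Eq.trans ?_ h3
  refine sum_congr rfl fun i _ => ?_
  rw [PowerSeries.coeff_mul, Finset.sum_eq_single (Nat.find h1, Nat.find h2)]
  · simp only [Polynomial.coeff_coe, coeff_map, pow_apply_q hφ]
  · intro x hx hne
    rw [HasAntidiagonal.mem_antidiagonal] at hx
    rcases lt_or_ge x.1 (Nat.find h1) with hlt | hge
    · have := Nat.find_min h1 hlt
      rw [not_not] at this
      have h4 : (a i).coeff x.1 = 0 := congrFun this i
      rw [Polynomial.coeff_coe, h4, zero_mul]
    · have hlt : x.2 < Nat.find h2 := by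
        rcases eq_or_lt_of_le hge with h5 | h5
        · exact absurd (Prod.ext h5.symm (by omega)) hne
        · omega
      have := Nat.find_min h2 hlt
      rw [not_not] at this
      rw [coeff_map, this, map_zero, mul_zero]
  · intro hx
    rw [HasAntidiagonal.mem_antidiagonal] at hx
    exact absurd rfl hx

end

namespace LData

variable {C : Type*} [NormedField C] [CompleteSpace C] [IsUltrametricDist C] {q : ℕ}
  {F : Filt C q} {M : Type*} [Fintype M] (S : LData C q F M)

/-- the auxiliary function -/
noncomputable def E (N : ℕ) (h : M → Polynomial C) : PowerSeries C :=
  ∑ κ, (h κ : PowerSeries C) * PowerSeries.map (S.φ ^ N) (S.ψ κ)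

theorem E_ne {N : ℕ} {h : M → Polynomial C} (hh : h ≠ 0) : S.E N h ≠ 0 := by
  intro h0
  have hs : Function.Surjective (S.φ ^ N) := by
    rw [RingHom.coe_pow]; exact S.hsurj.iterate N
  choose g hg using fun κ => Polynomial.map_surjective _ hs (h κ)
  apply hh
  funext κ
  have h1 : PowerSeries.map (S.φ ^ N) (∑ κ, (g κ : PowerSeries C) * S.ψ κ) = 0 := by
    rw [← h0, E]
    simp only [map_sum, map_mul, map_coe_poly, hg]
  have h2 : ∑ κ, (g κ : PowerSeries C) * S.ψ κ = 0 := (PowerSeries.map_eq_zero _ _).1 h1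
  rw [← hg, S.hind g h2 κ, Polynomial.map_zero]; rfl

theorem E_small {k N X : ℕ} (hNX : N = X + k) {h : M → Polynomial C}
    (hP : ∀ κ, F.P (S.K2 * q ^ N) (h κ)) (hdeg : ∀ κ, (h κ).natDegree ≤ X)
    (hz : ∀ ν < N, ev (S.θ ^ q ^ ν) (S.E N h) = 0) (j : ℕ) :
    ‖coeff j (S.E N h)‖ * (q : ℝ) ^ (2 * k * q ^ N) ≤ (q : ℝ) ^ ((F.c1 * S.K2 + S.b + 1) * q ^ N) := by
  have q1 := S.q1
  set R : ℝ := ((q : ℝ) ^ 2) ^ q ^ N with hR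
  have hR1 : 1 ≤ R := one_le_pow₀ (one_le_pow₀ q1.le)
  have hB : Bd ((q : ℝ) ^ (F.c1 * (S.K2 * q ^ N)) * R ^ X * ((q : ℝ) ^ S.b) ^ q ^ N) R (S.E N h) := by
    refine Bd.sum (by positivity) (by positivity) _ fun κ _ => ?_
    exact Bd.mul (by positivity) (Bd.poly hR1 (by positivity) _ (hdeg κ)
      fun i => F.norm_le (hP κ i)) (S.bd_map N κ)
  have hinj : Function.Injective fun ν : ℕ => S.θ ^ q ^ ν := by
    intro a b hab
    have := congrArg norm hab
    simp only [S.norm_z] at this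
    exact Nat.pow_right_injective S.hq (by
      have := pow_right_injective₀ (by linarith) (ne_of_gt q1) this
      exact this)
  have h1 := schwarz hR1 (fun ν => S.θ ^ q ^ ν) hinj N hB (fun i hi => ⟨S.z_lt hi.le, hz i hi⟩) j
  have h2 : ∏ i ∈ range N, max 1 ‖S.θ ^ q ^ i‖ ≤ (q : ℝ) ^ q ^ N := by
    have : ∀ i, max 1 ‖S.θ ^ q ^ i‖ = (q : ℝ) ^ q ^ i := fun i => by
      rw [S.norm_z, max_eq_right (one_le_pow₀ q1.le)]
    simp only [this]
    rw [prod_pow_eq_pow_sum]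
    refine pow_le_pow_right₀ q1.le ?_
    rw [← Fin.sum_univ_eq_sum_range (fun n => q ^ n)]
    exact sum_pow_le S.hq N
  have hRk : (q : ℝ) ^ (2 * k * q ^ N) = R ^ k := by
    rw [hR, ← pow_mul, ← pow_mul]; congr 1; ring
  rw [hRk]
  have hRk0 : 0 < R ^ k := by positivity
  calc ‖coeff j (S.E N h)‖ * R ^ k ≤ ((q : ℝ) ^ (F.c1 * (S.K2 * q ^ N)) * R ^ X *
        ((q : ℝ) ^ S.b) ^ q ^ N / R ^ N * (q : ℝ) ^ q ^ N) * R ^ k := by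
        refine mul_le_mul_of_nonneg_right (h1.trans ?_) hRk0.le
        exact mul_le_mul_of_nonneg_left h2 (by positivity)
    _ = (q : ℝ) ^ (F.c1 * (S.K2 * q ^ N)) * ((q : ℝ) ^ S.b) ^ q ^ N * (q : ℝ) ^ q ^ N := by
        rw [hNX, pow_add R]
        have : R ≠ 0 := by positivity
        field_simp
    _ = _ := by
        rw [← pow_mul, ← pow_add, ← pow_add]; congr 1; ring

/-- heights of the twists -/
def K3 (S : LData C q F M) : ℕ → ℕ
  | 0 => S.K2
  | i + 1 => q * K3 S i + S.c

theorem K3_mono (S : LData C q F M) : Monotone S.K3 := by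
  refine monotone_nat_of_le_succ fun n => ?_
  have := S.hq
  simp only [K3]; nlinarith

/-- the twists of the auxiliary function -/
noncomputable def g (N : ℕ) (h : M → Polynomial C) : ℕ → M → Polynomial C
  | 0 => h
  | i + 1 => fun κ => ∑ μ, (g N h i μ).map S.φ * (S.Φ μ κ).map (S.φ ^ N)

theorem g_spec (N : ℕ) (h : M → Polynomial C) (i : ℕ) :
    PowerSeries.map (S.φ ^ i) (S.E N h) = S.E N (S.g N h i) := by
  induction i with
  | zero => 
    rw [pow_zero, RingHom.one_def, PowerSeries.map_id]; rfl
  | succ i ih =>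
    rw [← map_map_succ', ih]
    simp only [E, g, map_sum, map_mul, map_coe_poly, map_map_succ', S.hΦ_map, mul_sum]
    rw [sum_comm]
    refine sum_congr rfl fun κ _ => ?_
    rw [← Polynomial.coeToPowerSeries.ringHom_apply, map_sum, sum_mul]
    simp [mul_assoc]

theorem g_P {N : ℕ} {h : M → Polynomial C} (hP : ∀ κ, F.P (S.K2 * q ^ N) (h κ)) (i : ℕ) :
    ∀ κ, F.P (S.K3 i * q ^ N) (S.g N h i κ) := by
  have hq := S.hq
  induction i with
  | zero => exact hP
  | succ i ih =>
    intro κ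
    refine Filt.P.sum' _ fun μ _ => ?_
    refine (((ih μ).map' S.φ S.hφ (by omega)).mul' ((S.hΦc μ κ).map' (S.φ ^ N) (pow_apply_q S.hφ N)
      (Nat.one_le_pow _ _ (by omega)))).mono' ?_
    simp only [K3]
    apply le_of_eq; ring

theorem g_deg {N X : ℕ} {h : M → Polynomial C} (hX : ∀ κ, (h κ).natDegree ≤ X) (i : ℕ) :
    ∀ κ, (S.g N h i κ).natDegree ≤ X + i * S.e := by
  induction i with
  | zero => simpa [g] using hX
  | succ i ih =>
    intro κ
    refine Polynomial.natDegree_sum_le_of_forall_le _ _ fun μ _ => ?_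
    refine Polynomial.natDegree_mul_le.trans ?_
    have h1 := (Polynomial.natDegree_map_le (f := S.φ) (p := S.g N h i μ)).trans (ih μ)
    have h2 := (Polynomial.natDegree_map_le (f := S.φ ^ N) (p := S.Φ μ κ)).trans (S.hΦe μ κ)
    rw [add_mul, one_mul]; omega

/-- final height constant -/
def K5 (S : LData C q F M) : ℕ := F.c0 + (2 * Fintype.card M + 2) * (S.K3 (Fintype.card M) + 1)

theorem relation {N X : ℕ} {h : M → Polynomial C} (hP : ∀ κ, F.P (S.K2 * q ^ N) (h κ))
    (hX : ∀ κ, (h κ).natDegree ≤ X) :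
    ∃ a : Fin (Fintype.card M + 1) → Polynomial C, a ≠ 0 ∧ (∀ i, F.P (S.K5 * q ^ N) (a i)) ∧
      ∑ i : Fin (Fintype.card M + 1), (a i : PowerSeries C) *
        PowerSeries.map (S.φ ^ (i : ℕ)) (S.E N h) = 0 := by
  classical
  have hq := S.hq
  obtain ⟨μ0, -⟩ := Function.ne_iff.1 S.hρ0
  have hr : 1 ≤ Fintype.card M := Fintype.card_pos_iff.2 ⟨μ0⟩
  have hQ : 1 ≤ q ^ N := Nat.one_le_pow _ _ (by omega)
  set r := Fintype.card M with hrdef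
  set Z := X + r * S.e + 1 with hZ
  set Y := 2 * r * Z with hY
  set K4 := S.K3 r + 1 with hK4
  let A : M × Fin (Y + Z) → Fin (r + 1) × Fin Y → C := fun s x =>
    if (x.2 : ℕ) ≤ s.2 then (S.g N h x.1 s.1).coeff (s.2 - x.2) else 0
  obtain ⟨x, hx0, hxG, hxs⟩ := F.siegel hq A (fun _ => K4 * q ^ N) (by
    intro s x
    simp only [A]
    split_ifs
    · refine F.mono (Nat.mul_le_mul_right _ ?_) (S.g_P hP x.1 s.1 _)
      exact (S.K3_mono (Nat.le_of_lt_succ x.1.2)).trans (by omega)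
    · exact AddSubgroup.zero_mem _) ((2 * r + 2) * K4 * q ^ N) (by
    simp only [sum_const, card_univ, Fintype.card_prod, Fintype.card_fin, smul_eq_mul, ← hrdef]
    have h1 : 0 < r * Z * (K4 * q ^ N) := by positivity
    rw [hY]
    nlinarith)
  refine ⟨fun i => mkP fun j => x (i, j), fun h0 => hx0 ?_, fun i => mkP_P fun j => ?_, ?_⟩
  · funext ij
    exact congrFun (mkP_eq_zero (congrFun h0 ij.1)) ij.2
  · refine F.mono ?_ (hxG _)
    rw [K5, ← hrdef, ← hK4]
    nlinarith
  · simp only [g_spec]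
    simp only [E, mul_sum]
    rw [sum_comm]
    refine sum_eq_zero fun κ _ => ?_
    have h1 : ∑ i : Fin (r + 1), (mkP fun j => x (i, j)) * S.g N h i κ = 0 := by
      ext s
      rw [Polynomial.finsetSum_coeff, Polynomial.coeff_zero]
      by_cases hs : s < Y + Z
      · have := hxs (κ, ⟨s, hs⟩)
        rw [Fintype.sum_prod_type] at this
        simpa only [mkP_mul_coeff, A] using this
      · refine sum_eq_zero fun i _ => Polynomial.coeff_eq_zero_of_natDegree_lt ?_
        refine lt_of_le_of_lt Polynomial.natDegree_mul_le ?_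
        have h2 := mkP_natDegree fun j => x (i, j)
        have h3 := S.g_deg (N := N) hX i κ
        have h4 : (i : ℕ) * S.e ≤ r * S.e := Nat.mul_le_mul_right _ (by have := i.2; omega)
        omega
    have h2 := congrArg Polynomial.coeToPowerSeries.ringHom h1
    rw [map_sum, map_zero] at h2
    rw [← zero_mul (PowerSeries.map (S.φ ^ N) (S.ψ κ)), ← h2, sum_mul]
    simp [mul_assoc]

theorem contradiction (S : LData C q F M) : False := by
  have hq := S.hq
  have q1 := S.q1
  set k := (F.c1 * S.K2 + S.b + 1) + (F.c1 + F.c2) * S.K5 + 1 with hk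
  set N := (2 * Fintype.card M + 1) * k with hN
  set X := 2 * Fintype.card M * k with hX
  have hQ : 1 ≤ q ^ N := Nat.one_le_pow _ _ (by omega)
  obtain ⟨h, h0, hP, hdeg, hz⟩ := S.interp (by omega) hN hX
  have hE := S.E_ne (N := N) h0
  have hsm := S.E_small (k := k) (by rw [hN, hX]; ring) hP hdeg hz
  obtain ⟨a, ha0, haP, ha⟩ := S.relation hP hdeg
  obtain ⟨j0, k0, hj0, hk0, hs⟩ := lowest S.hφ a ha0 _ hE ha
  have h1 := hsm k0
  have hx : ‖coeff k0 (S.E N h)‖ * (q : ℝ) ^ ((2 * k - (F.c1 * S.K2 + S.b + 1)) * q ^ N) ≤ 1 := by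
    have hp : 0 < (q : ℝ) ^ ((F.c1 * S.K2 + S.b + 1) * q ^ N) := by positivity
    refine le_of_mul_le_mul_right ?_ hp
    rw [mul_assoc, ← pow_add, ← add_mul, Nat.sub_add_cancel (by omega), one_mul]
    exact h1
  have hle1 : ‖coeff k0 (S.E N h)‖ ≤ 1 :=
    (le_mul_of_one_le_right (norm_nonneg _) (one_le_pow₀ q1.le)).trans hx
  have h2 := liouville F hq (fun i => (a i).coeff j0) (fun i => haP i j0) hj0 hk0 hle1 hs
  have h3 : ‖coeff k0 (S.E N h)‖ * (q : ℝ) ^ ((F.c1 + F.c2) * (S.K5 * q ^ N)) <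
      ‖coeff k0 (S.E N h)‖ * (q : ℝ) ^ ((2 * k - (F.c1 * S.K2 + S.b + 1)) * q ^ N) := by
    refine mul_lt_mul_of_pos_left (pow_lt_pow_right₀ q1 ?_) (norm_pos_iff.2 hk0)
    rw [← mul_assoc]
    exact Nat.mul_lt_mul_of_pos_right (by omega) hQ
  linarith

end LData

end Carlitz

namespace Carlitz

set_option linter.unusedSectionVars false

open PowerSeries Finset

theorem prod_expand {R J : Type*} [CommRing R] [Fintype J] [DecidableEq J] {d : ℕ} (x a : J → R)
    (μ : J → Fin (d + 1)) :
    ∏ j, (x j + a j) ^ (μ j : ℕ) = ∑ κ : J → Fin (d + 1),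
      ∏ j, (x j ^ (κ j : ℕ) * a j ^ ((μ j : ℕ) - κ j) * ((μ j : ℕ).choose (κ j) : R)) := by
  classical
  have h : ∀ j, (x j + a j) ^ (μ j : ℕ) = ∑ k : Fin (d + 1),
      x j ^ (k : ℕ) * a j ^ ((μ j : ℕ) - k) * ((μ j : ℕ).choose k : R) := by
    intro j
    rw [add_pow, Fin.sum_univ_eq_sum_range
      (fun k => x j ^ k * a j ^ ((μ j : ℕ) - k) * ((μ j : ℕ).choose k : R))]
    refine Finset.sum_subset (fun k hk => ?_) fun k _ hk => ?_
    · simp only [mem_range] at hk ⊢; have := (μ j).2; omega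
    · simp only [mem_range] at hk
      rw [Nat.choose_eq_zero_of_lt (by omega)]; simp
  rw [Finset.prod_congr rfl fun j _ => h j, Finset.prod_univ_sum, Fintype.piFinset_univ]

/-- Data for the functional independence. -/
structure FData (C : Type*) [NormedField C] (q : ℕ) (J : Type*) [Fintype J] where
  hq : 2 ≤ q
  φ : C →+* C
  hφ : ∀ x, φ x = x ^ q
  hsurj : Function.Surjective φ
  θ : C
  hθ : ‖θ‖ = q
  L : J → PowerSeries C
  α : J → C
  i0 : J
  hα : α i0 = 0
  hL0 : L i0 ≠ 0
  B : ℝ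
  hB : ∀ j, Bd B ((q : ℝ) ^ 2) (L j)
  hL : ∀ j, PowerSeries.map φ (L j) =
    ((Polynomial.X - Polynomial.C (θ ^ q) : Polynomial C) : PowerSeries C) *
      (L j - PowerSeries.C (α j))
  Ω : PowerSeries C
  hΩ0 : Ω ≠ 0
  hΩB : Bd B q Ω
  hΩ : ((Polynomial.X - Polynomial.C (θ ^ q) : Polynomial C) : PowerSeries C) *
    PowerSeries.map φ Ω = Ω
  hlin : ∀ c : J → Polynomial C, (∀ j, (c j).map φ = c j) →
    ∑ j, (c j).eval θ * ev θ (L j) = 0 → ∀ j, j ≠ i0 → c j = 0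

namespace FData

variable {C : Type*} [NormedField C] {q : ℕ}
  {J : Type*} [Fintype J] [DecidableEq J] (S : FData C q J) {d : ℕ}

/-- `t - θ^q` -/
noncomputable def w : Polynomial C := Polynomial.X - Polynomial.C (S.θ ^ q)

theorem w_monic : S.w.Monic := Polynomial.monic_X_sub_C _

theorem w_ne : S.w ≠ 0 := S.w_monic.ne_zero

/-- total degree -/
def dg (μ : J → Fin (d + 1)) : ℕ := ∑ j, (μ j : ℕ)

/-- the relation -/
noncomputable def rel (P : (J → Fin (d + 1)) → Polynomial C) : PowerSeries C :=
  ∑ μ, (P μ : PowerSeries C) * ∏ j, S.L j ^ (μ j : ℕ)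

/-- the triangular matrix -/
noncomputable def Bm (μ κ : J → Fin (d + 1)) : Polynomial C :=
  ∏ j, ((-(S.w * Polynomial.C (S.α j))) ^ ((μ j : ℕ) - κ j) *
    ((μ j : ℕ).choose (κ j) : Polynomial C))

theorem Bm_self (μ : J → Fin (d + 1)) : S.Bm μ μ = 1 := by simp [Bm]

theorem Bm_le {μ κ : J → Fin (d + 1)} (h : S.Bm μ κ ≠ 0) (j : J) : (κ j : ℕ) ≤ μ j := by
  by_contra hc
  apply h
  rw [Bm, prod_eq_zero (mem_univ j)]
  rw [Nat.choose_eq_zero_of_lt (by omega)]; simp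

theorem Bm_dg {μ κ : J → Fin (d + 1)} (h : S.Bm μ κ ≠ 0) : dg κ ≤ dg μ :=
  sum_le_sum fun j _ => S.Bm_le h j

theorem Bm_dg_lt {μ κ : J → Fin (d + 1)} (h : S.Bm μ κ ≠ 0) (hne : μ ≠ κ) : dg κ < dg μ := by
  refine lt_of_le_of_ne (S.Bm_dg h) fun he => hne ?_
  have := (sum_eq_sum_iff_of_le fun j _ => S.Bm_le h j).1 he
  funext j
  exact Fin.ext (this j (mem_univ j)).symm

/-- twist of the relation -/
noncomputable def R (P : (J → Fin (d + 1)) → Polynomial C) (κ : J → Fin (d + 1)) : Polynomial C :=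
  ∑ μ, (P μ).map S.φ * S.Bm μ κ

theorem rel_twist (P : (J → Fin (d + 1)) → Polynomial C) :
    PowerSeries.map S.φ (S.rel P) = S.rel (fun κ => S.w ^ dg κ * S.R P κ) := by
  have h1 : ∀ j, PowerSeries.map S.φ (S.L j) = (S.w : PowerSeries C) * S.L j +
      ((-(S.w * Polynomial.C (S.α j)) : Polynomial C) : PowerSeries C) := by
    intro j
    rw [S.hL, ← w, Polynomial.coe_neg, Polynomial.coe_mul, Polynomial.coe_C]; ring
  simp only [rel, map_sum, map_mul, map_prod, map_pow, map_coe_poly, h1, prod_expand, R,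
    mul_sum, Polynomial.coe_mul]
  rw [sum_comm]
  refine sum_congr rfl fun κ _ => ?_
  rw [← Polynomial.coeToPowerSeries.ringHom_apply (φ := ∑ μ, _), map_sum, sum_mul]
  refine sum_congr rfl fun μ _ => ?_
  simp only [prod_mul_distrib, mul_pow, prod_pow_eq_pow_sum, Bm, map_mul, map_prod, map_pow,
    map_natCast, Polynomial.coeToPowerSeries.ringHom_apply, Polynomial.coe_pow, dg]
  ring

theorem rel_sub (P Q : (J → Fin (d + 1)) → Polynomial C) :
    S.rel (fun κ => P κ - Q κ) = S.rel P - S.rel Q := by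
  simp [rel, Polynomial.coe_sub, sub_mul, sum_sub_distrib]

theorem rel_smul (a : Polynomial C) (P : (J → Fin (d + 1)) → Polynomial C) :
    S.rel (fun κ => a * P κ) = a * S.rel P := by
  simp [rel, Polynomial.coe_mul, mul_sum, mul_assoc]

/-- nonzero relation of degree at most `D` -/
def IsRel (D : ℕ) (P : (J → Fin (d + 1)) → Polynomial C) : Prop :=
  P ≠ 0 ∧ S.rel P = 0 ∧ ∀ μ, D < dg μ → P μ = 0

theorem R_top {D : ℕ} {P : (J → Fin (d + 1)) → Polynomial C} (hP : ∀ μ, D < dg μ → P μ = 0)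
    {κ : J → Fin (d + 1)} (hκ : D ≤ dg κ) : S.R P κ = (P κ).map S.φ := by
  rw [R, Finset.sum_eq_single κ, S.Bm_self, mul_one]
  · intro μ _ hμ
    by_cases hB : S.Bm μ κ = 0
    · rw [hB, mul_zero]
    · rw [hP μ (lt_of_le_of_lt hκ (S.Bm_dg_lt hB hμ))]; simp
  · simp

theorem dvd_of_dvd_R {a : Polynomial C} {P : (J → Fin (d + 1)) → Polynomial C}
    (h : ∀ κ, a ∣ S.R P κ) (κ : J → Fin (d + 1)) : a ∣ (P κ).map S.φ := by
  classical
  obtain ⟨D, hD⟩ : ∃ D, ∀ μ : J → Fin (d + 1), dg μ ≤ D :=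
    ⟨∑ μ : J → Fin (d + 1), dg μ, fun μ => single_le_sum (f := dg) (fun _ _ => Nat.zero_le _)
      (mem_univ μ)⟩
  induction hn : D - dg κ using Nat.strong_induction_on generalizing κ with
  | _ n ih =>
    have h1 := h κ
    rw [R, ← Finset.add_sum_erase _ _ (mem_univ κ), S.Bm_self, mul_one] at h1
    refine (dvd_add_left ?_).1 h1
    refine dvd_sum fun μ hμ => ?_
    by_cases hB : S.Bm μ κ = 0
    · rw [hB, mul_zero]; exact dvd_zero _
    · have h2 := S.Bm_dg_lt hB (ne_of_mem_erase hμ)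
      have h3 := hD μ
      exact Dvd.dvd.mul_right (ih _ (by omega) μ rfl) _

theorem exists_min' {A : Type*} (p : A → Prop) (f : A → ℕ) (h : ∃ a, p a) :
    ∃ a, p a ∧ ∀ b, p b → f a ≤ f b := by
  classical
  have h' : ∃ n a, p a ∧ f a = n := by obtain ⟨a, ha⟩ := h; exact ⟨_, a, ha, rfl⟩
  obtain ⟨a, ha, hfa⟩ := Nat.find_spec h'
  exact ⟨a, ha, fun b hb => hfa ▸ Nat.find_min' h' ⟨b, hb, rfl⟩⟩

theorem natDegree_map (p : Polynomial C) : (p.map S.φ).natDegree = p.natDegree :=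
  Polynomial.natDegree_map_eq_of_injective S.φ.injective p

theorem normal_form (h : ∃ P : (J → Fin (d + 1)) → Polynomial C, P ≠ 0 ∧ S.rel P = 0) :
    ∃ (D : ℕ) (P : (J → Fin (d + 1)) → Polynomial C), S.IsRel D P ∧ (∃ μ, dg μ = D ∧ P μ ≠ 0) ∧
      ∀ κ, dg κ ≤ D → S.R P κ = S.w ^ (D - dg κ) * P κ := by
  classical
  -- minimal degree
  obtain ⟨⟨D, P0⟩, hP0, hD⟩ := exists_min' (A := ℕ × ((J → Fin (d + 1)) → Polynomial C))
    (fun x => S.IsRel x.1 x.2) (fun x => x.1) (by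
      obtain ⟨P, hP0, hP⟩ := h
      exact ⟨(∑ μ : J → Fin (d + 1), dg μ, P), hP0, hP, fun μ hμ =>
        absurd (single_le_sum (f := dg) (fun _ _ => Nat.zero_le _) (mem_univ μ)) (by simpa using hμ)⟩)
  have htop : ∀ P : (J → Fin (d + 1)) → Polynomial C, S.IsRel D P → ∃ μ, dg μ = D ∧ P μ ≠ 0 := by
    intro P hP
    by_contra! hc
    rcases Nat.eq_zero_or_pos D with h0 | h0
    · apply hP.1
      funext μ
      rcases Nat.eq_zero_or_pos (dg μ) with h1 | h1
      · exact hc μ (by omega)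
      · exact hP.2.2 μ (by omega)
    · have := hD (D - 1, P) ⟨hP.1, hP.2.1, fun μ hμ => by
        rcases eq_or_ne (dg μ) D with h1 | h1
        · exact hc μ h1
        · exact hP.2.2 μ (by simp at hμ; omega)⟩
      simp at this; omega
  let top : ((J → Fin (d + 1)) → Polynomial C) → Finset (J → Fin (d + 1)) :=
    fun P => univ.filter fun μ => dg μ = D ∧ P μ ≠ 0
  obtain ⟨P1, hP1, hcard⟩ := exists_min'
    (fun P : (J → Fin (d + 1)) → Polynomial C => S.IsRel D P) (fun P => (top P).card) ⟨P0, hP0⟩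
  obtain ⟨⟨P, μ0⟩, ⟨hP, hPc, hμ0, hPμ0⟩, hdeg⟩ := exists_min'
    (A := ((J → Fin (d + 1)) → Polynomial C) × (J → Fin (d + 1)))
    (fun x => S.IsRel D x.1 ∧ (top x.1).card = (top P1).card ∧ dg x.2 = D ∧ x.1 x.2 ≠ 0)
    (fun x => (x.1 x.2).natDegree) (by
      obtain ⟨μ, h1, h2⟩ := htop P1 hP1
      exact ⟨(P1, μ), hP1, rfl, h1, h2⟩)
  simp only at hP hPc hμ0 hPμ0 hdeg
  -- key identity
  have key : ∀ κ, dg κ ≤ D → P μ0 * S.R P κ = S.w ^ (D - dg κ) * (P μ0).map S.φ * P κ := by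
    set T : (J → Fin (d + 1)) → Polynomial C := fun κ =>
      P μ0 * (S.w ^ dg κ * S.R P κ) - S.w ^ D * (P μ0).map S.φ * P κ with hT
    have hrel : S.rel T = 0 := by
      rw [hT, rel_sub, rel_smul, rel_smul, ← rel_twist, hP.2.1]; simp
    have hTtop : ∀ κ, D ≤ dg κ → T κ = P μ0 * (S.w ^ dg κ * (P κ).map S.φ) -
        S.w ^ D * (P μ0).map S.φ * P κ := fun κ hκ => by
      rw [hT]; simp only; rw [S.R_top hP.2.2 hκ]
    have hT0 : T = 0 := by
      by_contra hne
      have hTrel : S.IsRel D T := ⟨hne, hrel, fun κ hκ => by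
        rw [hTtop κ hκ.le, hP.2.2 κ hκ]; simp⟩
      have h1 := hcard T hTrel
      rw [← hPc] at h1
      refine absurd h1 (not_le.2 (card_lt_card ?_))
      rw [ssubset_iff_of_subset]
      · refine ⟨μ0, by simp [top, hμ0, hPμ0], ?_⟩
        simp only [top, mem_filter, mem_univ, true_and, not_and, not_not]
        intro _
        rw [hTtop μ0 hμ0.ge, hμ0]; ring
      · intro κ hκ
        simp only [top, mem_filter, mem_univ, true_and] at hκ ⊢
        refine ⟨hκ.1, fun h0 => hκ.2 ?_⟩
        rw [hTtop κ hκ.1.ge, h0]; simp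
    intro κ hκ
    have h1 := congrFun hT0 κ
    rw [hT] at h1
    simp only [Pi.zero_apply] at h1
    have h2 : S.w ^ D = S.w ^ dg κ * S.w ^ (D - dg κ) := by
      rw [← pow_add, Nat.add_sub_cancel' hκ]
    rw [h2] at h1
    refine mul_left_cancel₀ (pow_ne_zero (dg κ) S.w_ne) ?_
    linear_combination h1
  -- `p^τ` is a constant multiple of `p`
  have hassoc : (P μ0).map S.φ ∣ P μ0 := by
    letI : GCDMonoid (Polynomial C) := UniqueFactorizationMonoid.toGCDMonoid (Polynomial C)
    obtain ⟨p1, p2, h1, h2, hu⟩ := extract_gcd (P μ0) ((P μ0).map S.φ)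
    set g := gcd (P μ0) ((P μ0).map S.φ) with hg
    have hg0 : g ≠ 0 := fun h0 => hPμ0 (by rw [h1, h0, zero_mul])
    have hpt0 : (P μ0).map S.φ ≠ 0 := (Polynomial.map_ne_zero_iff S.φ.injective).2 hPμ0
    have hp20 : p2 ≠ 0 := fun h0 => hpt0 (by rw [h2, h0, mul_zero])
    have hrp : IsRelPrime p2 p1 := ((gcd_isUnit_iff_isRelPrime).1 hu).symm
    have hdR : ∀ κ, p2 ∣ S.R P κ := by
      intro κ
      by_cases hκ : dg κ ≤ D
      · refine hrp.dvd_of_dvd_mul_left ⟨S.w ^ (D - dg κ) * P κ, ?_⟩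
        have h3 := key κ hκ
        refine mul_left_cancel₀ hg0 ?_
        rw [← mul_assoc, ← h1, h3, h2]; ring
      · rw [S.R_top hP.2.2 (by omega), hP.2.2 κ (by omega)]; simp
    have hdP := S.dvd_of_dvd_R hdR
    obtain ⟨s, hs⟩ := Polynomial.map_surjective _ S.hsurj p2
    have hex : ∀ κ, ∃ c, P κ = s * c := by
      intro κ
      obtain ⟨c, hc⟩ := hdP κ
      obtain ⟨c', hc'⟩ := Polynomial.map_surjective _ S.hsurj c
      refine ⟨c', Polynomial.map_injective _ S.φ.injective ?_⟩
      rw [Polynomial.map_mul, hs, hc', hc]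
    choose P' hP' using hex
    have hs0 : s ≠ 0 := fun h0 => hp20 (by rw [← hs, h0, Polynomial.map_zero])
    have hz : ∀ κ, P' κ = 0 ↔ P κ = 0 := fun κ => by rw [hP' κ]; simp [hs0]
    have hrel' : S.IsRel D P' := by
      refine ⟨fun h0 => hP.1 ?_, ?_, fun μ hμ => (hz μ).2 (hP.2.2 μ hμ)⟩
      · funext κ; exact (hz κ).1 (congrFun h0 κ)
      · have h3 : S.rel P = s * S.rel P' := by
          rw [← rel_smul]; congr 1; funext κ; exact hP' κ
        rw [hP.2.1] at h3
        refine (mul_eq_zero.1 h3.symm).resolve_left ?_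
        exact_mod_cast hs0
    have htop' : top P' = top P := by
      simp only [top]; congr 1; funext κ; rw [Ne, hz κ]
    have h3 := hdeg (P', μ0) ⟨hrel', by simp only; rw [htop', hPc], hμ0, fun h0 => hPμ0 ((hz _).1 h0)⟩
    simp only at h3
    rw [hP' μ0, Polynomial.natDegree_mul hs0 fun h0 => hPμ0 ((hz _).1 h0)] at h3
    have h4 : s.natDegree = 0 := by omega
    have h5 : IsUnit p2 := by
      rw [Polynomial.isUnit_iff_degree_eq_zero, Polynomial.degree_eq_natDegree hp20, ← hs,
        S.natDegree_map, h4]; rfl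
    rw [h2, h1]
    obtain ⟨v, hv⟩ := h5
    rw [← hv, Units.mul_right_dvd]
    exact dvd_mul_right _ _
  obtain ⟨c, hc⟩ := hassoc
  have hpt0 : (P μ0).map S.φ ≠ 0 := (Polynomial.map_ne_zero_iff S.φ.injective).2 hPμ0
  have hc0 : c ≠ 0 := fun h0 => hPμ0 (by rw [hc, h0, mul_zero])
  have hcd : c.natDegree = 0 := by
    have := congrArg Polynomial.natDegree hc
    rw [Polynomial.natDegree_mul hpt0 hc0, S.natDegree_map] at this; omega
  obtain ⟨u, rfl⟩ : ∃ u, c = Polynomial.C u := ⟨_, Polynomial.eq_C_of_natDegree_eq_zero hcd⟩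
  have hlc : (P μ0).leadingCoeff = S.φ (P μ0).leadingCoeff * u := by
    have := congrArg Polynomial.leadingCoeff hc
    rw [Polynomial.leadingCoeff_mul, Polynomial.leadingCoeff_C,
      Polynomial.leadingCoeff_map_of_injective S.φ.injective] at this
    exact this
  set a := ((P μ0).leadingCoeff)⁻¹ with ha
  have hl0 : (P μ0).leadingCoeff ≠ 0 := Polynomial.leadingCoeff_ne_zero.2 hPμ0
  have ha0 : a ≠ 0 := inv_ne_zero hl0
  have hCa : (Polynomial.C a : Polynomial C) ≠ 0 := Polynomial.C_ne_zero.2 ha0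
  have hua : S.φ a = a * u := by
    rw [ha, map_inv₀]
    have : S.φ (P μ0).leadingCoeff ≠ 0 := (_root_.map_ne_zero _).2 hl0
    field_simp
    linear_combination hlc
  refine ⟨D, fun κ => Polynomial.C a * P κ, ⟨fun h0 => hP.1 ?_, ?_, fun μ hμ => ?_⟩,
    ⟨μ0, hμ0, mul_ne_zero hCa hPμ0⟩, fun κ hκ => ?_⟩
  · funext κ
    exact (mul_eq_zero.1 (congrFun h0 κ)).resolve_left hCa
  · rw [rel_smul, hP.2.1, mul_zero]
  · simp only; rw [hP.2.2 μ hμ, mul_zero]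
  · have h1 : S.R (fun κ => Polynomial.C a * P κ) κ = Polynomial.C (S.φ a) * S.R P κ := by
      simp only [R, Polynomial.map_mul, Polynomial.map_C, mul_sum, mul_assoc]
    have h2 := key κ hκ
    have h3 : Polynomial.C u * S.R P κ = S.w ^ (D - dg κ) * P κ := by
      refine mul_left_cancel₀ hpt0 ?_
      calc _ = P μ0 * S.R P κ := by rw [← mul_assoc, ← hc]
        _ = _ := by rw [h2]; ring
    rw [h1, hua, Polynomial.C_mul, mul_assoc, h3]; ring

end FData

end Carlitz

namespace Carlitz

set_option linter.unusedSectionVars false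

open PowerSeries Finset

section charp

variable {R : Type*} [CommRing R] (p : ℕ) [hp : Fact p.Prime] [CharP R p] (s : ℕ)

theorem coeff_pow_char (f : Polynomial R) (k : ℕ) :
    (f ^ p ^ s).coeff k = if p ^ s ∣ k then (f.coeff (k / p ^ s)) ^ p ^ s else 0 := by
  have hpos : 0 < p ^ s := pow_pos hp.out.pos _
  haveI : ExpChar R p := ExpChar.prime hp.out
  rw [← Polynomial.map_iterateFrobenius_expand p f s, Polynomial.coeff_map,
    Polynomial.coeff_expand hpos, apply_ite (iterateFrobenius R p s), map_zero,
    iterateFrobenius_def]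

theorem coeff_pow_char' (f : PowerSeries R) (k : ℕ) :
    coeff k (f ^ p ^ s) = if p ^ s ∣ k then (coeff (k / p ^ s) f) ^ p ^ s else 0 := by
  rw [← coeff_coe_trunc_of_lt (Nat.lt_succ_self k), ← trunc_trunc_pow,
    coeff_coe_trunc_of_lt (Nat.lt_succ_self k), ← Polynomial.coe_pow, Polynomial.coeff_coe,
    coeff_pow_char, coeff_trunc,
    if_pos (Nat.lt_succ_of_le (Nat.div_le_self k (p ^ s)))]

theorem choose_cast_zero {m k : ℕ} (h : ¬ p ^ s ∣ k) : ((p ^ s * m).choose k : R) = 0 := by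
  rw [← Polynomial.coeff_one_add_X_pow R, mul_comm, pow_mul, coeff_pow_char, if_neg h]

theorem choose_cast_mul (m k : ℕ) : ((p ^ s * m).choose (p ^ s * k) : R) = (m.choose k : R) := by
  have hpos : 0 < p ^ s := pow_pos hp.out.pos _
  haveI : ExpChar R p := ExpChar.prime hp.out
  rw [← Polynomial.coeff_one_add_X_pow R, mul_comm (p ^ s) m, pow_mul, coeff_pow_char,
    if_pos (dvd_mul_right _ _), Nat.mul_div_cancel_left _ hpos, Polynomial.coeff_one_add_X_pow R,
    ← iterateFrobenius_def, map_natCast]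

end charp

section lam

variable {C : Type*} [NormedField C]

/-- Cartier operator -/
noncomputable def lam (σ : C →+* C) (r j : ℕ) (f : PowerSeries C) : PowerSeries C :=
  PowerSeries.mk fun k => σ (coeff (r * k + j) f)

theorem lam_add (σ : C →+* C) (r j : ℕ) (f g : PowerSeries C) :
    lam σ r j (f + g) = lam σ r j f + lam σ r j g := by
  ext k; simp [lam]

theorem lam_sum (σ : C →+* C) (r j : ℕ) {ι : Type*} (s : Finset ι) (f : ι → PowerSeries C) :
    lam σ r j (∑ i ∈ s, f i) = ∑ i ∈ s, lam σ r j (f i) := by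
  ext k; simp [lam, map_sum]

theorem lam_mul_pow (p : ℕ) [hp : Fact p.Prime] [CharP C p] (s : ℕ) (σ : C →+* C)
    (hσ : ∀ x, σ (x ^ p ^ s) = x) {j : ℕ} (hj : j < p ^ s) (f g : PowerSeries C) :
    lam σ (p ^ s) j (f * g ^ p ^ s) = lam σ (p ^ s) j f * g := by
  have hpos : 0 < p ^ s := pow_pos hp.out.pos _
  ext k
  simp only [lam, coeff_mk, coeff_mul, map_sum, map_mul, coeff_pow_char']
  symm
  refine sum_of_injOn (fun x => (p ^ s * x.1 + j, p ^ s * x.2)) ?_ ?_ ?_ ?_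
  · rintro ⟨a, b⟩ _ ⟨a', b'⟩ _ h
    simp only [Prod.mk.injEq, add_left_inj] at h
    rw [Prod.mk.injEq]
    exact ⟨Nat.eq_of_mul_eq_mul_left hpos h.1, Nat.eq_of_mul_eq_mul_left hpos h.2⟩
  · rintro ⟨a, b⟩ h
    simp only [mem_coe, HasAntidiagonal.mem_antidiagonal] at h ⊢
    rw [← h]; ring
  · rintro ⟨a, b⟩ h1 h2
    rw [if_neg, map_zero, mul_zero]
    rintro ⟨b', rfl⟩
    apply h2
    rw [HasAntidiagonal.mem_antidiagonal] at h1
    have hb : b' ≤ k := by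
      by_contra! hc
      have : p ^ s * (k + 1) ≤ p ^ s * b' := Nat.mul_le_mul_left _ hc
      rw [mul_add] at this
      simp only at h1
      omega
    refine ⟨(k - b', b'), ?_, ?_⟩
    · simp only [mem_coe, HasAntidiagonal.mem_antidiagonal]; omega
    · simp only [Prod.mk.injEq, and_true]
      have : p ^ s * (k - b') + p ^ s * b' = p ^ s * k := by rw [← mul_add]; congr 1; omega
      simp only at h1
      omega
  · rintro ⟨a, b⟩ h
    simp only
    rw [if_pos (dvd_mul_right _ _), Nat.mul_div_cancel_left _ hpos, hσ]

theorem exists_poly_of_coeff (f : PowerSeries C) (N : ℕ) (h : ∀ k, N ≤ k → coeff k f = 0) :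
    ∃ g : Polynomial C, (g : PowerSeries C) = f := by
  refine ⟨trunc N f, ?_⟩
  ext k
  rw [Polynomial.coeff_coe, coeff_trunc]
  split_ifs with hk
  · rfl
  · exact (h k (not_lt.1 hk)).symm

theorem lam_poly (σ : C →+* C) {r : ℕ} (hr : 0 < r) (j : ℕ) (f : Polynomial C) :
    ∃ g : Polynomial C, (g : PowerSeries C) = lam σ r j (f : PowerSeries C) := by
  refine exists_poly_of_coeff _ (f.natDegree + 1) fun k hk => ?_
  rw [lam, coeff_mk, Polynomial.coeff_coe, Polynomial.coeff_eq_zero_of_natDegree_lt, map_zero]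
  have := Nat.le_mul_of_pos_left k hr
  omega

theorem map_lam (σ φ : C →+* C) (h : ∀ x, φ (σ x) = σ (φ x)) (r j : ℕ) (f : PowerSeries C) :
    PowerSeries.map φ (lam σ r j f) = lam σ r j (PowerSeries.map φ f) := by
  ext k; simp [lam, h]

theorem invariant_poly {q : ℕ} (hq : 2 ≤ q) (φ : C →+* C) (hφ : ∀ x, φ x = x ^ q) {B : ℝ}
    {f : PowerSeries C} (hf : PowerSeries.map φ f = f) (hB : Bd B q f) :
    ∃ g : Polynomial C, (g : PowerSeries C) = f ∧ g.map φ = g := by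
  have hq1 : (1 : ℝ) < q := by exact_mod_cast (by omega : 1 < q)
  obtain ⟨N, hN⟩ := pow_unbounded_of_one_lt B hq1
  obtain ⟨g, hg⟩ := exists_poly_of_coeff f N fun k hk => by
    by_contra hne
    have h1 : coeff k f ^ q = coeff k f := by
      rw [← hφ, ← PowerSeries.coeff_map, hf]
    have h2 : (coeff k f) ^ (q - 1) = 1 := by
      refine mul_right_cancel₀ hne ?_
      rw [← pow_succ, one_mul, Nat.sub_add_cancel (by omega), h1]
    have h3 : ‖coeff k f‖ = 1 := by
      have := congrArg norm h2
      rw [norm_pow, norm_one] at this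
      exact (pow_eq_one_iff_of_nonneg (norm_nonneg _) (by omega)).1 this
    have h4 := hB k
    rw [h3, one_mul] at h4
    have h5 : (q : ℝ) ^ N ≤ (q : ℝ) ^ k := pow_le_pow_right₀ hq1.le hk
    linarith
  refine ⟨g, hg, ?_⟩
  rw [← hg, map_coe_poly] at hf
  exact_mod_cast hf

end lam

end Carlitz

namespace Carlitz

set_option linter.unusedSectionVars false

open PowerSeries Finset

namespace FData

variable {C : Type*} [NormedField C] {q : ℕ}
  {J : Type*} [Fintype J] [DecidableEq J] (S : FData C q J) {d : ℕ}

theorem eq_zero_of_twist {n : ℕ} (hn : 0 < n) {b : Polynomial C}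
    (h : b.map S.φ = S.w ^ n * b) : b = 0 := by
  by_contra hb
  have h1 := congrArg Polynomial.natDegree h
  rw [S.natDegree_map, Polynomial.natDegree_mul (pow_ne_zero _ S.w_ne) hb,
    Polynomial.natDegree_pow] at h1
  have : S.w.natDegree = 1 := Polynomial.natDegree_X_sub_C _
  rw [this] at h1; omega

variable (p : ℕ) [hp : Fact p.Prime] [CharP C p]

/-- nonvanishing entries, top row -/
theorem Bm_ne_prop {s : ℕ} {μ κ : J → Fin (d + 1)} (hμ : ∀ i, i ≠ S.i0 → p ^ s ∣ (μ i : ℕ))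
    (h : S.Bm μ κ ≠ 0) {j : J} (hj : (μ j : ℕ) ≠ κ j) :
    j ≠ S.i0 ∧ (κ j : ℕ) + p ^ s ≤ μ j := by
  have hle := S.Bm_le h j
  have hfac : (-(S.w * Polynomial.C (S.α j))) ^ ((μ j : ℕ) - κ j) *
    ((μ j : ℕ).choose (κ j) : Polynomial C) ≠ 0 := fun h0 => h (prod_eq_zero (mem_univ j) h0)
  have hne : j ≠ S.i0 := by
    rintro rfl
    apply hfac
    rw [S.hα, Polynomial.C_0, mul_zero, neg_zero, zero_pow (by omega), zero_mul]
  refine ⟨hne, ?_⟩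
  obtain ⟨m, hm⟩ := hμ j hne
  have hdvd : p ^ s ∣ (κ j : ℕ) := by
    by_contra hc
    apply hfac
    rw [hm, choose_cast_zero p s hc, mul_zero]
  have := Nat.le_of_dvd (by omega) ((Nat.dvd_sub (hμ j hne) hdvd))
  omega

theorem vanish {D s : ℕ} {P : (J → Fin (d + 1)) → Polynomial C} (hP : ∀ μ, D < dg μ → P μ = 0)
    (hR : ∀ κ, dg κ ≤ D → S.R P κ = S.w ^ (D - dg κ) * P κ)
    (hs : ∀ μ, dg μ = D → P μ ≠ 0 → ∀ i, i ≠ S.i0 → p ^ s ∣ (μ i : ℕ))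
    (κ : J → Fin (d + 1)) (h1 : dg κ < D) (h2 : D < dg κ + p ^ s) : P κ = 0 := by
  induction hn : D - dg κ using Nat.strong_induction_on generalizing κ with
  | _ n ih =>
    have h3 := hR κ h1.le
    rw [R, ← Finset.add_sum_erase _ _ (mem_univ κ), S.Bm_self, mul_one, sum_eq_zero, add_zero] at h3
    · exact S.eq_zero_of_twist (by omega) h3
    · intro μ hμ
      by_cases hB : S.Bm μ κ = 0
      · rw [hB, mul_zero]
      have h4 := S.Bm_dg_lt hB (ne_of_mem_erase hμ)
      by_cases hPμ : P μ = 0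
      · rw [hPμ]; simp
      rcases lt_trichotomy (dg μ) D with h5 | h5 | h5
      · exact absurd (ih _ (by omega) μ h5 (by omega) rfl) hPμ
      · exfalso
        obtain ⟨j, hj⟩ : ∃ j, (μ j : ℕ) ≠ κ j := by
          by_contra! hc
          exact ne_of_mem_erase hμ (funext fun j => Fin.ext (hc j))
        have h6 := (S.Bm_ne_prop p (hs μ h5 hPμ) hB hj).2
        have h7 : dg κ + p ^ s ≤ dg μ := by
          unfold dg
          rw [← add_sum_erase univ (fun j => (κ j : ℕ)) (mem_univ j),
            ← add_sum_erase univ (fun j => (μ j : ℕ)) (mem_univ j)]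
          have := sum_le_sum (s := univ.erase j) fun i _ => S.Bm_le hB i
          omega
        omega
      · exact absurd (hP μ h5) hPμ

/-- neighbours of `κ` -/
def Nb (r : ℕ) (κ : J → Fin (d + 1)) (i : J) (μ : J → Fin (d + 1)) : Prop :=
  i ≠ S.i0 ∧ (μ i : ℕ) = κ i + r ∧ ∀ j, j ≠ i → μ j = κ j

theorem Nb.dg {r : ℕ} {κ μ : J → Fin (d + 1)} {i : J} (h : S.Nb r κ i μ) :
    dg μ = dg κ + r := by
  unfold FData.dg
  rw [← add_sum_erase univ (fun j => (μ j : ℕ)) (mem_univ i),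
    ← add_sum_erase univ (fun j => (κ j : ℕ)) (mem_univ i), h.2.1,
    sum_congr rfl fun j hj => by rw [h.2.2 j (ne_of_mem_erase hj)]]
  ring

theorem Nb.unique {r : ℕ} (hr : 0 < r) {κ μ : J → Fin (d + 1)} {i i' : J} (h : S.Nb r κ i μ)
    (h' : S.Nb r κ i' μ) : i = i' := by
  by_contra hc
  have := h'.2.2 i hc
  have h2 := h.2.1
  rw [this] at h2; omega

theorem Nb.Bm {s : ℕ} {κ μ : J → Fin (d + 1)} {i : J} (h : S.Nb (p ^ s) κ i μ) :
    S.Bm μ κ = -(S.w ^ p ^ s * Polynomial.C (S.α i ^ p ^ s)) *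
      ((μ i : ℕ).choose (κ i) : Polynomial C) := by
  rw [FData.Bm, Finset.prod_eq_single i]
  · rw [h.2.1, Nat.add_sub_cancel_left, Polynomial.C_pow, ← mul_pow]
    congr 1
    have := sub_pow_char_pow (R := Polynomial C) (p := p) 0 (S.w * Polynomial.C (S.α i)) s
    rwa [zero_sub, zero_pow (pow_pos hp.out.pos _).ne', zero_sub] at this
  · intro j _ hj
    rw [h.2.2 j hj]; simp
  · simp

open Classical in
/-- coefficients -/
noncomputable def cf (r : ℕ) (κ : J → Fin (d + 1)) (P : (J → Fin (d + 1)) → Polynomial C) (i : J) :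
    Polynomial C :=
  ∑ μ, if S.Nb r κ i μ then P μ * ((μ i : ℕ).choose (κ i) : Polynomial C) else 0

theorem main_row {D s : ℕ} {P : (J → Fin (d + 1)) → Polynomial C} (hP : ∀ μ, D < dg μ → P μ = 0)
    (hR : ∀ κ, dg κ ≤ D → S.R P κ = S.w ^ (D - dg κ) * P κ)
    (hs : ∀ μ, dg μ = D → P μ ≠ 0 → ∀ i, i ≠ S.i0 → p ^ s ∣ (μ i : ℕ))
    (κ : J → Fin (d + 1)) (h1 : dg κ + p ^ s = D) :
    (P κ).map S.φ = S.w ^ p ^ s * (P κ + ∑ i, S.cf (p ^ s) κ P i * Polynomial.C (S.α i ^ p ^ s)) ∧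
    ∀ i, (S.cf (p ^ s) κ P i).map S.φ = S.cf (p ^ s) κ P i := by
  classical
  have hpos : 0 < p ^ s := pow_pos hp.out.pos _
  have hfix : ∀ μ, dg μ = D → (P μ).map S.φ = P μ := by
    intro μ hμ
    rw [← S.R_top hP hμ.ge, hR μ hμ.le, hμ]; simp
  constructor
  · have h3 := hR κ (by omega)
    rw [R, ← Finset.add_sum_erase _ _ (mem_univ κ), S.Bm_self, mul_one, ← h1,
      Nat.add_sub_cancel_left] at h3
    have h4 : ∀ μ ∈ univ.erase κ, (P μ).map S.φ * S.Bm μ κ = ∑ i, if S.Nb (p ^ s) κ i μ then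
        -(S.w ^ p ^ s * Polynomial.C (S.α i ^ p ^ s)) *
          (P μ * ((μ i : ℕ).choose (κ i) : Polynomial C)) else 0 := by
      intro μ hμ
      by_cases hN : ∃ i, S.Nb (p ^ s) κ i μ
      · obtain ⟨i, hi⟩ := hN
        rw [Finset.sum_eq_single i, if_pos hi, Nb.Bm S p hi, hfix μ (by rw [Nb.dg S hi, h1])]
        · ring
        · intro j _ hj
          exact if_neg fun h => hj (Nb.unique S hpos h hi)
        · simp
      · rw [sum_eq_zero fun i _ => if_neg fun h => hN ⟨i, h⟩]
        by_cases hB : S.Bm μ κ = 0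
        · rw [hB, mul_zero]
        by_cases hPμ : P μ = 0
        · rw [hPμ]; simp
        have h4 := S.Bm_dg_lt hB (ne_of_mem_erase hμ)
        exfalso
        rcases lt_trichotomy (dg μ) D with h5 | h5 | h5
        · exact hPμ (S.vanish p hP hR hs μ h5 (by omega))
        · obtain ⟨j, hj⟩ : ∃ j, (μ j : ℕ) ≠ κ j := by
            by_contra! hc
            exact ne_of_mem_erase hμ (funext fun j => Fin.ext (hc j))
          obtain ⟨h6, h7⟩ := S.Bm_ne_prop p (hs μ h5 hPμ) hB hj
          have h8 : dg κ + p ^ s = dg μ := by omega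
          unfold dg at h8
          rw [← add_sum_erase univ (fun j => (κ j : ℕ)) (mem_univ j),
            ← add_sum_erase univ (fun j => (μ j : ℕ)) (mem_univ j)] at h8
          have h9 := sum_le_sum (s := univ.erase j) fun i _ => S.Bm_le hB i
          have h10 : ∑ i ∈ univ.erase j, (κ i : ℕ) = ∑ i ∈ univ.erase j, (μ i : ℕ) := by omega
          have h11 := (sum_eq_sum_iff_of_le (s := univ.erase j) fun i _ => S.Bm_le hB i).1 h10
          exact hN ⟨j, h6, by omega, fun i hi => Fin.ext (h11 i (mem_erase.2 ⟨hi, mem_univ _⟩)).symm⟩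
        · exact hPμ (hP μ h5)
    rw [sum_congr rfl h4, sum_comm] at h3
    have h5 : ∀ i, ∑ μ ∈ univ.erase κ, (if S.Nb (p ^ s) κ i μ then
        -(S.w ^ p ^ s * Polynomial.C (S.α i ^ p ^ s)) *
          (P μ * ((μ i : ℕ).choose (κ i) : Polynomial C)) else 0) =
        -(S.w ^ p ^ s) * (S.cf (p ^ s) κ P i * Polynomial.C (S.α i ^ p ^ s)) := by
      intro i
      rw [cf, ← add_sum_erase _ _ (mem_univ κ), if_neg, zero_add, sum_mul, mul_sum]
      · refine sum_congr rfl fun μ _ => ?_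
        split_ifs
        · ring
        · simp
      · intro h
        have := h.2.1
        omega
    rw [sum_congr rfl fun i _ => h5 i, ← mul_sum] at h3
    linear_combination h3
  · intro i
    rw [cf, Polynomial.map_sum]
    refine sum_congr rfl fun μ _ => ?_
    split_ifs with h
    · rw [Polynomial.map_mul, hfix μ (by rw [Nb.dg S h, h1]), Polynomial.map_natCast]
    · simp

end FData

end Carlitz

namespace Carlitz

set_option linter.unusedSectionVars false

open PowerSeries Finset

namespace FData

variable {C : Type*} [NormedField C] [IsUltrametricDist C] [CompleteSpace C] [IsAlgClosed C] {q : ℕ}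
  {J : Type*} [Fintype J] [DecidableEq J] (S : FData C q J) {d : ℕ}

theorem hLw (j : J) : PowerSeries.map S.φ (S.L j) =
    (S.w : PowerSeries C) * (S.L j - PowerSeries.C (S.α j)) := S.hL j

theorem hΩw : (S.w : PowerSeries C) * PowerSeries.map S.φ S.Ω = S.Ω := S.hΩ

theorem linear_step (c : J → Polynomial C) (hc : ∀ i, (c i).map S.φ = c i) (b : Polynomial C)
    (h : ∑ i, (c i : PowerSeries C) * S.L i + b = 0) : ∀ i, i ≠ S.i0 → c i = 0 := by
  have hw : PowerSeries.map S.φ (∑ i, (c i : PowerSeries C) * S.L i + b) = 0 := by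
    rw [h, map_zero]
  have h1 : b.map S.φ = S.w * (b + ∑ i, c i * Polynomial.C (S.α i)) := by
    have h2 : ((b.map S.φ : Polynomial C) : PowerSeries C) =
        (S.w * (b + ∑ i, c i * Polynomial.C (S.α i)) : Polynomial C) := by
      simp only [map_add, map_sum, map_mul, map_coe_poly, S.hLw, hc] at hw
      have h3 : ((∑ i, c i * Polynomial.C (S.α i) : Polynomial C) : PowerSeries C) =
          ∑ i, (c i : PowerSeries C) * PowerSeries.C (S.α i) := by
        rw [← Polynomial.coeToPowerSeries.ringHom_apply, map_sum]
        simp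
      have h4 : ∑ i, (c i : PowerSeries C) * ((S.w : PowerSeries C) * (S.L i - PowerSeries.C (S.α i))) =
          S.w * (∑ i, (c i : PowerSeries C) * S.L i) -
          S.w * ∑ i, (c i : PowerSeries C) * PowerSeries.C (S.α i) := by
        rw [mul_sum, mul_sum, ← sum_sub_distrib]
        exact sum_congr rfl fun i _ => by ring
      rw [h4] at hw
      rw [Polynomial.coe_mul, Polynomial.coe_add, h3]
      linear_combination hw - (S.w : PowerSeries C) * h
    exact_mod_cast h2
  have h2 : b.eval S.θ = 0 := by
    have h3 := congrArg (Polynomial.eval (S.φ S.θ)) h1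
    rw [Polynomial.eval_map_apply, Polynomial.eval_mul] at h3
    have h4 : S.w.eval (S.φ S.θ) = 0 := by simp [w, S.hφ]
    rw [h4, zero_mul] at h3
    exact (_root_.map_eq_zero _).1 h3
  refine S.hlin c hc ?_
  have hq : ‖S.θ‖ < (q : ℝ) ^ 2 := by
    have : (2 : ℝ) ≤ q := by exact_mod_cast S.hq
    rw [S.hθ]; nlinarith
  have hs : ∀ i, Sm S.θ (S.L i) := fun i => (S.hB i).sm hq
  have h3 := congrArg (ev S.θ) h
  rw [ev_add (Sm.sum _ fun i _ => (Sm.poly _ _).mul (hs i)) (Sm.poly _ _),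
    ev_sum _ fun i _ => (Sm.poly _ _).mul (hs i), ev_poly, h2, ev_zero, add_zero] at h3
  rw [← h3]
  exact sum_congr rfl fun i _ => by rw [ev_mul (Sm.poly _ _) (hs i), ev_poly]

theorem final_step (p : ℕ) [hp : Fact p.Prime] [CharP C p] (s : ℕ) (b : Polynomial C) (c : J → Polynomial C)
    (hc : ∀ i, (c i).map S.φ = c i) (hc0 : c S.i0 = 0)
    (hb : b.map S.φ = S.w ^ p ^ s * (b + ∑ i, c i * Polynomial.C (S.α i ^ p ^ s))) (i : J) :
    c i = 0 := by
  by_contra hne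
  have hi0 : i ≠ S.i0 := by rintro rfl; exact hne hc0
  have hpos : 0 < p ^ s := pow_pos hp.out.pos _
  have hq1 : (1 : ℝ) ≤ q := by exact_mod_cast (by have := S.hq; omega : 1 ≤ q)
  have hq0 : (0 : ℝ) ≤ q := by linarith
  haveI : ExpChar C p := ExpChar.prime hp.out
  haveI : CharP (PowerSeries C) p :=
    charP_of_injective_ringHom (PowerSeries.C_injective (R := C)) p
  set r := p ^ s with hr
  -- G
  set G : PowerSeries C := b + ∑ i, (c i : PowerSeries C) * S.L i ^ r with hG
  have hGt : PowerSeries.map S.φ G = (S.w : PowerSeries C) ^ r * G := by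
    have h3 : ((∑ i, c i * Polynomial.C (S.α i ^ r) : Polynomial C) : PowerSeries C) =
        ∑ i, (c i : PowerSeries C) * PowerSeries.C (S.α i) ^ r := by
      rw [← Polynomial.coeToPowerSeries.ringHom_apply, map_sum]
      simp
    simp only [hG, map_add, map_sum, map_mul, map_coe_poly, map_pow (PowerSeries.map S.φ), S.hLw, hc, hb]
    rw [Polynomial.coe_mul, Polynomial.coe_add, h3, Polynomial.coe_pow]
    have h4 : ∀ i, (c i : PowerSeries C) * ((S.w : PowerSeries C) * (S.L i - PowerSeries.C (S.α i))) ^ r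
        = (S.w : PowerSeries C) ^ r * ((c i : PowerSeries C) * S.L i ^ r) -
          (S.w : PowerSeries C) ^ r * ((c i : PowerSeries C) * PowerSeries.C (S.α i) ^ r) := by
      intro i
      rw [mul_pow, hr, sub_pow_char_pow (p := p)]; ring
    rw [sum_congr rfl fun i _ => h4 i, sum_sub_distrib, ← mul_sum, ← mul_sum]
    ring
  have hLB : ∀ i, Bd S.B q (S.L i) := fun i => (S.hB i).antitone hq0 (by nlinarith)
  have hB0 : 0 ≤ S.B := S.hΩB.nonneg
  obtain ⟨BG, hBG⟩ : ∃ B, Bd B q G := by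
    obtain ⟨B1, h1⟩ := Bd.exists_poly hq1 b
    have : ∀ i, ∃ B', Bd B' q ((c i : PowerSeries C) * S.L i ^ r) := fun i => by
      obtain ⟨B2, h2⟩ := Bd.exists_poly hq1 (c i)
      exact ⟨_, h2.mul hq0 ((hLB i).pow hq0 r)⟩
    choose B2 h2 using this
    have h3 : ∀ i, B2 i ≤ ∑ i, B2 i := fun i =>
      single_le_sum (f := B2) (fun j _ => (h2 j).nonneg) (mem_univ i)
    refine ⟨max B1 (∑ i, B2 i), (h1.mono (le_max_left _ _)).add hq0 (Bd.sum hq0 ?_ _ fun i _ =>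
      (h2 i).mono ((h3 i).trans (le_max_right _ _)))⟩
    exact h1.nonneg.trans (le_max_left _ _)
  have hΩ' := S.hΩw
  obtain ⟨a0, ha0, ha0f⟩ := invariant_poly S.hq S.φ S.hφ (f := S.Ω * S.L S.i0) (by
    rw [map_mul, S.hLw, S.hα, map_zero, sub_zero]
    linear_combination S.L S.i0 * hΩ') (S.hΩB.mul hq0 (hLB _))
  obtain ⟨a1, ha1, ha1f⟩ := invariant_poly S.hq S.φ S.hφ (f := S.Ω ^ r * G) (by
    rw [map_mul, hGt, map_pow]
    have hΩr := congrArg (fun x => x ^ r) hΩ'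
    simp only [mul_pow] at hΩr
    linear_combination G * hΩr) ((S.hΩB.pow hq0 r).mul hq0 hBG)
  have ha0ne : a0 ≠ 0 := by
    rintro rfl
    rw [Polynomial.coe_zero] at ha0
    exact mul_ne_zero S.hΩ0 S.hL0 ha0.symm
  have hrel : (a0 : PowerSeries C) ^ r * G = a1 * S.L S.i0 ^ r := by
    rw [ha0, ha1, mul_pow]; ring
  -- Cartier operator
  let σ : C →+* C := ((iterateFrobeniusEquiv C p s).symm : C →+* C)
  have hσ : ∀ x, σ (x ^ p ^ s) = x := fun x => by
    rw [← iterateFrobenius_def, ← iterateFrobeniusEquiv_apply]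
    exact RingEquiv.symm_apply_apply _ _
  have hσφ : ∀ x, S.φ (σ x) = σ (S.φ x) := fun x => by rw [S.hφ, S.hφ, map_pow]
  obtain ⟨k, hk⟩ : ∃ k, (c i).coeff k ≠ 0 := by
    by_contra! h; exact hne (Polynomial.ext fun k => by simp [h k])
  have hj : k % r < r := Nat.mod_lt _ hpos
  set j := k % r with hjk
  choose c' hc' using fun i => lam_poly σ hpos j (c i)
  obtain ⟨b', hb'⟩ := lam_poly σ hpos j b
  obtain ⟨a', ha'⟩ := lam_poly σ hpos j a1
  have hfix : ∀ f g : Polynomial C, (g : PowerSeries C) = lam σ r j (f : PowerSeries C) →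
      f.map S.φ = f → g.map S.φ = g := by
    intro f g h1 h2
    have : ((g.map S.φ : Polynomial C) : PowerSeries C) = g := by
      rw [← map_coe_poly, h1, map_lam _ _ hσφ, map_coe_poly, h2]
    exact_mod_cast this
  have hci : c' i ≠ 0 := by
    intro h0
    have h1 := hc' i
    rw [h0, Polynomial.coe_zero] at h1
    have h2 := congrArg (coeff (k / r)) h1
    rw [lam, coeff_mk, Polynomial.coeff_coe, hjk, Nat.div_add_mod, map_zero] at h2
    exact hk ((_root_.map_eq_zero σ).1 h2.symm)
  have hrel2 : (a0 : PowerSeries C) * (b' + ∑ i, (c' i : PowerSeries C) * S.L i) =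
      a' * S.L S.i0 := by
    have h1 := congrArg (lam σ r j) hrel
    rw [hr, lam_mul_pow p s σ hσ hj, ← hr, ← ha', mul_comm, ] at h1
    rw [hr, lam_mul_pow p s σ hσ hj, ← hr, hG, lam_add, lam_sum, ← hb'] at h1
    rw [← h1, mul_comm]
    congr 2
    refine sum_congr rfl fun i _ => ?_
    rw [hr, lam_mul_pow p s σ hσ hj, ← hr, hc']
  have h5 := S.linear_step (fun i => a0 * c' i - if i = S.i0 then a' else 0) (fun i => by
    rw [Polynomial.map_sub, Polynomial.map_mul, ha0f, hfix _ _ (hc' i) (hc i)]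
    split_ifs
    · rw [hfix _ _ ha' ha1f]
    · simp) (a0 * b') (by
    have : ∀ i, ((a0 * c' i - if i = S.i0 then a' else 0 : Polynomial C) : PowerSeries C) * S.L i =
        a0 * ((c' i : PowerSeries C) * S.L i) - if i = S.i0 then (a' : PowerSeries C) * S.L i else 0 := by
      intro i
      split_ifs
      · rw [Polynomial.coe_sub, Polynomial.coe_mul]; ring
      · rw [sub_zero, Polynomial.coe_mul]; ring
    rw [sum_congr rfl fun i _ => this i, sum_sub_distrib, ← mul_sum, sum_ite_eq' univ S.i0,
      if_pos (mem_univ _), Polynomial.coe_mul]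
    linear_combination hrel2) i hi0
  simp only [if_neg hi0, sub_zero] at h5
  exact (mul_ne_zero ha0ne hci) h5

theorem indep (p : ℕ) [hp : Fact p.Prime] [CharP C p] (P : (J → Fin (d + 1)) → Polynomial C) (h : S.rel P = 0) : P = 0 := by
  classical
  by_contra hne
  obtain ⟨D, P, ⟨hP0, hrel, hP⟩, ⟨μ0, hμ0, hPμ0⟩, hR⟩ := S.normal_form ⟨P, hne, h⟩
  by_cases hex : ∃ x : (J → Fin (d + 1)) × J, dg x.1 = D ∧ P x.1 ≠ 0 ∧ x.2 ≠ S.i0 ∧ (x.1 x.2 : ℕ) ≠ 0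
  · obtain ⟨⟨μ, i⟩, ⟨hμ, hPμ, hi, hμi⟩, hmin⟩ := exists_min' _
      (fun x => padicValNat p (x.1 x.2 : ℕ)) hex
    simp only at hμ hPμ hi hμi hmin
    set s := padicValNat p (μ i : ℕ) with hs
    have hdiv : ∀ ν, dg ν = D → P ν ≠ 0 → ∀ i, i ≠ S.i0 → p ^ s ∣ (ν i : ℕ) := by
      intro ν h1 h2 i' h3
      by_cases h4 : (ν i' : ℕ) = 0
      · rw [h4]; exact dvd_zero _
      · exact (pow_dvd_pow p (hmin (ν, i') ⟨h1, h2, h3, h4⟩)).trans pow_padicValNat_dvd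
    obtain ⟨m, hm⟩ := hdiv μ hμ hPμ i hi
    have hpos : 0 < p ^ s := pow_pos hp.out.pos _
    have hm0 : 0 < m := by
      rcases Nat.eq_zero_or_pos m with h0 | h0
      · rw [h0, mul_zero] at hm; exact absurd hm hμi
      · exact h0
    have hpm : ¬ p ∣ m := by
      rintro ⟨m', rfl⟩
      refine pow_succ_padicValNat_not_dvd (p := p) hμi ?_
      rw [← hs, hm, pow_succ]
      exact ⟨m', by ring⟩
    have hle : p ^ s ≤ (μ i : ℕ) := by rw [hm]; exact Nat.le_mul_of_pos_right _ hm0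
    let κ : J → Fin (d + 1) := Function.update μ i
      ⟨(μ i : ℕ) - p ^ s, by have := (μ i).2; omega⟩
    have hκi : (κ i : ℕ) = μ i - p ^ s := by simp [κ]
    have hκj : ∀ j, j ≠ i → μ j = κ j := fun j hj => by simp [κ, hj]
    have hNb : S.Nb (p ^ s) κ i μ := ⟨hi, by omega, hκj⟩
    have hκ : dg κ + p ^ s = D := by rw [← hμ, Nb.dg S hNb]
    obtain ⟨h1, h2⟩ := S.main_row p hP hR hdiv κ hκ
    have h3 := S.final_step p s (P κ) _ h2 (by
      rw [cf]; exact sum_eq_zero fun μ _ => if_neg fun h => h.1 rfl) h1 i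
    rw [cf, Finset.sum_eq_single μ, if_pos hNb] at h3
    · refine mul_ne_zero hPμ ?_ h3
      have h4 : (κ i : ℕ) = p ^ s * (m - 1) := by
        rw [hκi, hm, Nat.mul_sub, mul_one]
      rw [h4, hm, choose_cast_mul]
      obtain ⟨m', rfl⟩ : ∃ m', m = m' + 1 := ⟨m - 1, by omega⟩
      rw [Nat.add_sub_cancel, Nat.choose_succ_self_right]
      intro h5
      exact hpm ((CharP.cast_eq_zero_iff (Polynomial C) p _).1 h5)
    · intro ν _ hν
      rw [if_neg]
      intro h5
      apply hν
      funext j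
      by_cases hj : j = i
      · subst hj
        exact Fin.ext (by rw [h5.2.1, hNb.2.1])
      · rw [h5.2.2 j hj, hκj j hj]
    · simp
  · push Not at hex
    have hdiv : ∀ ν, dg ν = D → P ν ≠ 0 → ∀ i, i ≠ S.i0 → p ^ (D + 1) ∣ (ν i : ℕ) := by
      intro ν h1 h2 i' h3
      rw [hex (ν, i') h1 h2 h3]; exact dvd_zero _
    have hbig : D < p ^ (D + 1) :=
      (Nat.lt_succ_self D).trans (Nat.lt_pow_self hp.out.one_lt)
    have h1 : S.rel P = P μ0 * ∏ j, S.L j ^ (μ0 j : ℕ) := by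
      rw [rel]
      refine Finset.sum_eq_single μ0 (fun ν _ hν => ?_) (by simp)
      suffices P ν = 0 by rw [this]; simp
      rcases lt_trichotomy (dg ν) D with h5 | h5 | h5
      · exact S.vanish p hP hR hdiv ν h5 (by omega)
      · by_contra hPν
        apply hν
        have h6 : ∀ μ : J → Fin (d + 1), dg μ = D → P μ ≠ 0 → (μ S.i0 : ℕ) = D := by
          intro μ ha hb
          rw [← ha, dg]
          symm
          exact Finset.sum_eq_single S.i0 (fun j _ hj => hex (μ, j) ha hb hj) (by simp)
        funext j
        by_cases hj : j = S.i0
        · subst hj; exact Fin.ext (by rw [h6 ν h5 hPν, h6 μ0 hμ0 hPμ0])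
        · exact Fin.ext (by rw [hex (ν, j) h5 hPν hj, hex (μ0, j) hμ0 hPμ0 hj])
      · exact hP ν h5
    rw [hrel] at h1
    have h2 : (P μ0 : PowerSeries C) ≠ 0 := by exact_mod_cast hPμ0
    refine mul_ne_zero h2 ?_ h1.symm
    refine Finset.prod_ne_zero_iff.2 fun j _ => ?_
    by_cases hj : j = S.i0
    · subst hj; exact pow_ne_zero _ S.hL0
    · rw [hex (μ0, j) hμ0 hPμ0 hj]; simp

end FData

end Carlitz

namespace Carlitz

set_option linter.unusedSectionVars false

open PowerSeries Finset

theorem exists_small_root {C : Type*} [NormedField C] [IsAlgClosed C] {q : ℕ} (hq : 2 ≤ q)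
    (a c : C) : ∃ x : C, x ^ q + a * x = c ∧ ‖x‖ ^ q ≤ ‖c‖ := by
  set P : Polynomial C := Polynomial.X ^ q + (Polynomial.C a * Polynomial.X + Polynomial.C (-c))
    with hP
  have hdeg : (Polynomial.C a * Polynomial.X + Polynomial.C (-c)).degree < (q : WithBot ℕ) :=
    lt_of_le_of_lt Polynomial.degree_linear_le (by exact_mod_cast (by omega : 1 < q))
  have hm : P.Monic := Polynomial.monic_X_pow_add hdeg
  have hnd : P.natDegree = q := by
    refine Polynomial.natDegree_eq_of_degree_eq_some ?_
    rw [hP, Polynomial.degree_add_eq_left_of_degree_lt] <;> rw [Polynomial.degree_X_pow]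
    exact hdeg
  have hs : P.Splits := IsAlgClosed.splits P
  have hcard : P.roots.card = q := by rw [← hs.natDegree_eq_card_roots, hnd]
  have h0 := hs.coeff_zero_eq_prod_roots_of_monic hm
  have hc0 : P.coeff 0 = -c := by
    simp [hP, Polynomial.coeff_X_pow]; omega
  rw [hc0] at h0
  have hn : ‖c‖ = (P.roots.map norm).prod := by
    have := congrArg norm h0
    rw [norm_neg, norm_mul, norm_pow, norm_neg, norm_one, one_pow, one_mul] at this
    rw [this]
    exact map_multiset_prod (normHom : C →*₀ ℝ) _
  by_contra! hc
  have hr : ∀ x ∈ P.roots, ‖c‖ < ‖x‖ ^ q := by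
    intro x hx
    apply hc x
    have h1 := (Polynomial.mem_roots'.1 hx).2
    rw [Polynomial.IsRoot, hP] at h1
    simp only [Polynomial.eval_add, Polynomial.eval_pow, Polynomial.eval_X, Polynomial.eval_mul,
      Polynomial.eval_C] at h1
    linear_combination h1
  have key : ∀ s : Multiset C, (∀ x ∈ s, ‖c‖ < ‖x‖ ^ q) →
      ‖c‖ ^ s.card ≤ (s.map norm).prod ^ q ∧ (s ≠ 0 → ‖c‖ ^ s.card < (s.map norm).prod ^ q) := by
    intro s
    induction s using Multiset.induction with
    | empty => simp
    | cons x s ih =>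
      intro h
      have h1 := (ih fun y hy => h y (Multiset.mem_cons_of_mem hy)).1
      have h2 := h x (Multiset.mem_cons_self x s)
      have h3 : ‖c‖ ^ (x ::ₘ s).card < ((x ::ₘ s).map norm).prod ^ q := by
        rw [Multiset.card_cons, Multiset.map_cons, Multiset.prod_cons, mul_pow, pow_succ, mul_comm]
        have h4 : 0 < (s.map norm).prod ^ q := by
          refine pow_pos (Multiset.prod_pos fun y hy => ?_) q
          obtain ⟨z, hz, rfl⟩ := Multiset.mem_map.1 hy
          refine norm_pos_iff.2 fun h5 => ?_
          have := h z (Multiset.mem_cons_of_mem hz)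
          rw [h5, norm_zero, zero_pow (by omega)] at this
          exact absurd this (not_lt.2 (norm_nonneg _))
        calc ‖c‖ * ‖c‖ ^ s.card ≤ ‖c‖ * (s.map norm).prod ^ q :=
              mul_le_mul_of_nonneg_left h1 (norm_nonneg _)
          _ < _ := mul_lt_mul_of_pos_right h2 h4
      exact ⟨h3.le, fun _ => h3⟩
  have hne : P.roots ≠ 0 := by
    intro h; rw [h, Multiset.card_zero] at hcard; omega
  have := (key P.roots hr).2 hne
  rw [hcard, ← hn] at this
  exact lt_irrefl _ this

/-- Carlitz context. -/
structure Ctx (C : Type*) [NormedField C] (q : ℕ) where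
  hq : 2 ≤ q
  φ : C →+* C
  hφ : ∀ x, φ x = x ^ q
  hsurj : Function.Surjective φ
  θ : C
  hθ : ‖θ‖ = q

namespace Ctx

variable {C : Type*} [NormedField C] [IsUltrametricDist C] [CompleteSpace C] [IsAlgClosed C]
  {q : ℕ} (S : Ctx C q)

theorem q0 (S : Ctx C q) : (0 : ℝ) < q := by exact_mod_cast (by have := S.hq; omega : 0 < q)
theorem q2 (S : Ctx C q) : (2 : ℝ) ≤ q := by exact_mod_cast S.hq

theorem θ0 : S.θ ≠ 0 := norm_pos_iff.1 (by rw [S.hθ]; exact S.q0)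

/-- `t - θ^q` -/
noncomputable def w : Polynomial C := Polynomial.X - Polynomial.C (S.θ ^ q)

theorem w_mul_coeff_zero (f : PowerSeries C) :
    coeff 0 ((S.w : PowerSeries C) * f) = -(S.θ ^ q * coeff 0 f) := by
  simp [w, sub_mul, mul_assoc]

theorem coe_lin (c : C) : ((Polynomial.X - Polynomial.C c : Polynomial C) : PowerSeries C) =
    PowerSeries.X - PowerSeries.C c := by
  rw [Polynomial.coe_sub, Polynomial.coe_X, Polynomial.coe_C]

theorem lin_coeff_zero (c : C) (f : PowerSeries C) :
    coeff 0 ((PowerSeries.X - PowerSeries.C c) * f) = -(c * coeff 0 f) := by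
  rw [sub_mul, map_sub, PowerSeries.coeff_C_mul, PowerSeries.coeff_zero_X_mul, zero_sub]

theorem lin_coeff_succ (c : C) (f : PowerSeries C) (n : ℕ) :
    coeff (n + 1) ((PowerSeries.X - PowerSeries.C c) * f) =
      coeff n f - c * coeff (n + 1) f := by
  rw [sub_mul, map_sub, PowerSeries.coeff_C_mul, PowerSeries.coeff_succ_X_mul]

/-- from `τ f = (t-θ) f + α` to `L` -/
theorem mkL {f : PowerSeries C} {α : C}
    (h : PowerSeries.map S.φ f = (PowerSeries.X - PowerSeries.C S.θ) * f + PowerSeries.C α) :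
    PowerSeries.map S.φ (PowerSeries.C α - PowerSeries.map S.φ f) =
      ((Polynomial.X - Polynomial.C (S.θ ^ q) : Polynomial C) : PowerSeries C) *
      ((PowerSeries.C α - PowerSeries.map S.φ f) - PowerSeries.C α) := by
  have h1 : PowerSeries.map S.φ (PowerSeries.map S.φ f) =
      (PowerSeries.X - PowerSeries.C (S.θ ^ q)) * PowerSeries.map S.φ f + PowerSeries.C (α ^ q) := by
    conv_lhs => rw [h]
    rw [map_add, map_mul, map_sub, PowerSeries.map_X, PowerSeries.map_C, PowerSeries.map_C,
      S.hφ, S.hφ]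
  rw [map_sub, h1, coe_lin, PowerSeries.map_C, S.hφ]
  ring

theorem bd_mkL {f : PowerSeries C} {α : C} {B : ℝ} (hB : ∀ n, ‖coeff n f‖ * (q : ℝ) ^ n ≤ B) :
    ∃ B', Bd B' ((q : ℝ) ^ 2) (PowerSeries.C α - PowerSeries.map S.φ f) := by
  have hq1 : (1 : ℝ) ≤ q := by have := S.q2; linarith
  have h1 : Bd (B ^ q) ((q : ℝ) ^ q) (PowerSeries.map S.φ f) := Bd.map (f := f) S.hφ S.q0.le hB
  have h2 : Bd (B ^ q) ((q : ℝ) ^ 2) (PowerSeries.map S.φ f) :=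
    h1.antitone (by positivity) (pow_le_pow_right₀ hq1 S.hq)
  obtain ⟨B1, h3⟩ := Bd.exists_poly (R := (q : ℝ) ^ 2) (one_le_pow₀ hq1) (Polynomial.C α)
  rw [Polynomial.coe_C] at h3
  refine ⟨max B1 (B ^ q), ?_⟩
  rw [sub_eq_add_neg]
  exact (h3.mono (le_max_left _ _)).add (by positivity) (h2.neg.mono (le_max_right _ _))

/-- existence of the fundamental period function -/
theorem exists_L0 : ∃ L : PowerSeries C, L ≠ 0 ∧ (∃ B, Bd B ((q : ℝ) ^ 2) L) ∧
    PowerSeries.map S.φ L =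
    ((Polynomial.X - Polynomial.C (S.θ ^ q) : Polynomial C) : PowerSeries C) *
      (L - PowerSeries.C 0) := by
  have hq := S.hq
  obtain ⟨x0, hx0⟩ := IsAlgClosed.exists_pow_nat_eq (-S.θ) (by omega : 0 < q - 1)
  have hx0' : x0 ^ q = -S.θ * x0 := by rw [← hx0, ← pow_succ, Nat.sub_add_cancel (by omega)]
  have hx0n : x0 ≠ 0 := by
    rintro rfl
    rw [zero_pow (by omega)] at hx0
    exact S.θ0 (neg_eq_zero.1 hx0.symm)
  choose g hg1 hg2 using fun c => exists_small_root S.hq S.θ c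
  have hg3 : ∀ c, ‖g c‖ * q ≤ ‖c‖ := by
    intro c
    have : S.θ * g c = c - g c ^ q := by linear_combination hg1 c
    have h2 := congrArg norm this
    rw [norm_mul, S.hθ, mul_comm] at h2
    rw [h2]
    refine (nsub_le_max _ _).trans (max_le le_rfl ?_)
    rw [norm_pow]; exact hg2 c
  let f : ℕ → C := fun n => Nat.rec x0 (fun _ c => g c) n
  have hf : ∀ n, ‖f n‖ * (q : ℝ) ^ n ≤ ‖x0‖ := by
    intro n
    induction n with
    | zero => simp [f]
    | succ n ih =>
      refine le_trans ?_ ih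
      have := hg3 (f n)
      calc ‖f (n + 1)‖ * (q : ℝ) ^ (n + 1) = (‖g (f n)‖ * q) * (q : ℝ) ^ n := by
            simp only [f]; ring
        _ ≤ _ := mul_le_mul_of_nonneg_right this (by have := S.q0; positivity)
  set F : PowerSeries C := PowerSeries.mk f with hF
  have hrel : PowerSeries.map S.φ F = (PowerSeries.X - PowerSeries.C S.θ) * F + PowerSeries.C 0 := by
    rw [map_zero, add_zero]
    ext n
    rcases n with _ | n
    · rw [lin_coeff_zero, PowerSeries.coeff_map, hF, coeff_mk, S.hφ]
      change x0 ^ q = -(S.θ * x0)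
      rw [hx0']; ring
    · rw [lin_coeff_succ, PowerSeries.coeff_map, hF, coeff_mk, coeff_mk, S.hφ]
      change g (f n) ^ q = f n - S.θ * g (f n)
      linear_combination hg1 (f n)
  refine ⟨_, ?_, S.bd_mkL (f := F) (α := 0) (by intro n; rw [hF, coeff_mk]; exact hf n), S.mkL hrel⟩
  rw [map_zero, zero_sub, neg_ne_zero]
  intro h
  have h2 := congrArg (coeff 0) h
  rw [PowerSeries.coeff_map, hF, coeff_mk, map_zero, _root_.map_eq_zero] at h2
  exact hx0n h2

theorem exists_Ω : ∃ Ω : PowerSeries C, Ω ≠ 0 ∧ (∃ B, Bd B q Ω) ∧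
    ((Polynomial.X - Polynomial.C (S.θ ^ q) : Polynomial C) : PowerSeries C) *
    PowerSeries.map S.φ Ω = Ω := by
  have hq := S.hq
  obtain ⟨x0, hx0⟩ := IsAlgClosed.exists_pow_nat_eq (-(S.θ ^ q)⁻¹) (by omega : 0 < q - 1)
  have hθq : S.θ ^ q ≠ 0 := pow_ne_zero _ S.θ0
  have hx0' : x0 ^ q = -(S.θ ^ q)⁻¹ * x0 := by
    rw [← hx0, ← pow_succ, Nat.sub_add_cancel (by omega)]
  have hx0n : x0 ≠ 0 := by
    rintro rfl
    rw [zero_pow (by omega)] at hx0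
    exact hθq (inv_eq_zero.1 (neg_eq_zero.1 hx0.symm))
  choose g hg1 hg2 using fun c => exists_small_root S.hq (S.θ ^ q)⁻¹ ((c / S.θ) ^ q)
  have hg3 : ∀ c, ‖g c‖ * q ≤ ‖c‖ := by
    intro c
    have h1 := hg2 c
    rw [norm_pow] at h1
    have h2 := (pow_le_pow_iff_left₀ (norm_nonneg _) (norm_nonneg _) (by omega)).1 h1
    rwa [norm_div, S.hθ, le_div_iff₀ S.q0] at h2
  let f : ℕ → C := fun n => Nat.rec x0 (fun _ c => g c) n
  have hf : ∀ n, ‖f n‖ * (q : ℝ) ^ n ≤ ‖x0‖ := by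
    intro n
    induction n with
    | zero => simp [f]
    | succ n ih =>
      refine le_trans ?_ ih
      have := hg3 (f n)
      calc ‖f (n + 1)‖ * (q : ℝ) ^ (n + 1) = (‖g (f n)‖ * q) * (q : ℝ) ^ n := by
            simp only [f]; ring
        _ ≤ _ := mul_le_mul_of_nonneg_right this (by have := S.q0; positivity)
  refine ⟨PowerSeries.mk f, ?_, ⟨‖x0‖, fun n => by rw [coeff_mk]; exact hf n⟩, ?_⟩
  · intro h
    have h2 := congrArg (coeff 0) h
    rw [coeff_mk, map_zero] at h2
    exact hx0n h2
  · rw [coe_lin]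
    ext n
    rcases n with _ | n
    · rw [lin_coeff_zero, PowerSeries.coeff_map, coeff_mk, S.hφ]
      change -(S.θ ^ q * x0 ^ q) = x0
      rw [hx0']; field_simp
    · rw [lin_coeff_succ, PowerSeries.coeff_map, PowerSeries.coeff_map, coeff_mk, coeff_mk, S.hφ, S.hφ]
      change f n ^ q - S.θ ^ q * g (f n) ^ q = g (f n)
      have h1 := hg1 (f n)
      rw [div_pow] at h1
      field_simp at h1
      linear_combination -h1

end Ctx

end Carlitz

namespace Carlitz

set_option linter.unusedSectionVars false

open PowerSeries Finset Filter Topology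

/-- abstract Carlitz factorials -/
noncomputable def cD {C : Type*} [Field C] (θ : C) (q : ℕ) : ℕ → C
  | 0 => 1
  | i + 1 => (θ ^ q ^ (i + 1) - θ) * (cD θ q i) ^ q

namespace Ctx

variable {C : Type*} [NormedField C] [IsUltrametricDist C] [CompleteSpace C] [IsAlgClosed C]
  {q : ℕ} (S : Ctx C q)

/-- the exponential -/
noncomputable def ex (z : C) : C := ∑' i : ℕ, z ^ q ^ i / cD S.θ q i

theorem norm_br (i : ℕ) : ‖S.θ ^ q ^ (i + 1) - S.θ‖ = (q : ℝ) ^ q ^ (i + 1) := by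
  have hq1 : (1 : ℝ) < q := by have := S.q2; linarith
  have h1 : ‖S.θ ^ q ^ (i + 1)‖ = (q : ℝ) ^ q ^ (i + 1) := by rw [norm_pow, S.hθ]
  have h2 : ‖S.θ‖ < ‖S.θ ^ q ^ (i + 1)‖ := by
    rw [h1, S.hθ]
    conv_lhs => rw [← pow_one (q : ℝ)]
    exact pow_lt_pow_right₀ hq1 (Nat.one_lt_pow (by omega) (by have := S.hq; omega))
  rw [← h1, sub_eq_add_neg, IsUltrametricDist.norm_add_eq_max_of_norm_ne_norm]
  · rw [norm_neg, max_eq_left h2.le]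
  · rw [norm_neg]; exact h2.ne'

theorem norm_cD (i : ℕ) : ‖cD S.θ q i‖ = (q : ℝ) ^ (i * q ^ i) := by
  induction i with
  | zero => simp [cD]
  | succ i ih =>
    rw [cD, norm_mul, norm_pow, ih, S.norm_br, ← pow_mul, ← pow_add]
    congr 1; ring

theorem cD_ne (i : ℕ) : cD S.θ q i ≠ 0 := by
  rw [← norm_pos_iff, S.norm_cD]; have := S.q0; positivity

theorem norm_term (z : C) (i : ℕ) :
    ‖z ^ q ^ i / cD S.θ q i‖ = (‖z‖ / (q : ℝ) ^ i) ^ q ^ i := by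
  rw [norm_div, norm_pow, S.norm_cD, div_pow, ← pow_mul]

theorem summable_term (z : C) : Summable fun i : ℕ => z ^ q ^ i / cD S.θ q i := by
  have hq1 : (1 : ℝ) < q := by have := S.q2; linarith
  obtain ⟨N, hN⟩ := pow_unbounded_of_one_lt (2 * ‖z‖) hq1
  refine Summable.of_norm_bounded_eventually_nat (g := fun i => (1 / 2 : ℝ) ^ i)
    (summable_geometric_of_lt_one (by norm_num) (by norm_num)) ?_
  filter_upwards [eventually_ge_atTop N] with i hi
  rw [S.norm_term]
  have h1 : (q : ℝ) ^ N ≤ (q : ℝ) ^ i := pow_le_pow_right₀ hq1.le hi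
  have h0 : (0 : ℝ) < (q : ℝ) ^ i := by have := S.q0; positivity
  have h2 : ‖z‖ / (q : ℝ) ^ i ≤ 1 / 2 := by
    rw [div_le_div_iff₀ h0 (by norm_num)]; linarith
  calc (‖z‖ / (q : ℝ) ^ i) ^ q ^ i ≤ (1 / 2 : ℝ) ^ q ^ i := pow_le_pow_left₀ (by positivity) h2 _
    _ ≤ (1 / 2 : ℝ) ^ i := pow_le_pow_of_le_one (by norm_num) (by norm_num)
        (Nat.lt_pow_self (by have := S.hq; omega)).le

theorem ex_θ (z : C) : S.ex (S.θ * z) = S.θ * S.ex z + S.ex z ^ q := by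
  have hs := S.summable_term z
  have hs' := S.summable_term (S.θ * z)
  have h1 : S.ex (S.θ * z) - S.θ * S.ex z =
      ∑' i : ℕ, (S.θ ^ q ^ i - S.θ) * (z ^ q ^ i / cD S.θ q i) := by
    rw [ex, ex, ← tsum_mul_left, ← hs'.tsum_sub (hs.mul_left _)]
    congr 1; funext i
    rw [mul_pow]; ring
  have hcont : Continuous S.φ := by
    have : (S.φ : C → C) = fun x => x ^ q := funext S.hφ
    rw [this]; fun_prop
  have h2 : S.ex z ^ q = ∑' i : ℕ, S.φ (z ^ q ^ i / cD S.θ q i) := by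
    rw [← S.hφ, ex]
    exact hs.map_tsum S.φ hcont
  have h3 : ∀ i : ℕ, (S.θ ^ q ^ (i + 1) - S.θ) * (z ^ q ^ (i + 1) / cD S.θ q (i + 1)) =
      S.φ (z ^ q ^ i / cD S.θ q i) := by
    intro i
    have hb : S.θ ^ q ^ (i + 1) - S.θ ≠ 0 := by
      rw [← norm_pos_iff, S.norm_br]; have := S.q0; positivity
    rw [S.hφ, div_pow, ← pow_mul, ← pow_succ, cD]
    have := S.cD_ne i
    field_simp
  have hs2 : Summable fun i : ℕ => (S.θ ^ q ^ i - S.θ) * (z ^ q ^ i / cD S.θ q i) := by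
    refine (hs'.sub (hs.mul_left S.θ)).congr fun i => ?_
    rw [mul_pow]; ring
  rw [hs2.tsum_eq_zero_add, pow_zero, pow_one, sub_self, zero_mul, zero_add,
    tsum_congr h3, ← h2] at h1
  linear_combination h1

theorem ex_sub {z : C} (hz : ‖z‖ ≤ 1) : ‖S.ex z - z‖ ≤ ‖z‖ ^ 2 := by
  have hs := S.summable_term z
  have h1 : S.ex z - z = ∑' i : ℕ, z ^ q ^ (i + 1) / cD S.θ q (i + 1) := by
    rw [ex, hs.tsum_eq_zero_add]; simp [cD]
  rw [h1]
  refine (IsUltrametricDist.norm_tsum_le _).trans (ciSup_le fun i => ?_)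
  rw [S.norm_term]
  have hq1 : (1 : ℝ) ≤ q := by have := S.q2; linarith
  have h2 : ‖z‖ / (q : ℝ) ^ (i + 1) ≤ ‖z‖ := div_le_self (norm_nonneg _) (one_le_pow₀ hq1)
  calc _ ≤ ‖z‖ ^ q ^ (i + 1) := pow_le_pow_left₀ (by positivity) h2 _
    _ ≤ ‖z‖ ^ 2 := pow_le_pow_of_le_one (norm_nonneg _) hz
        (S.hq.trans (Nat.le_self_pow (by omega) q))

theorem ex_le {z : C} (hz : ‖z‖ ≤ 1) : ‖S.ex z‖ ≤ ‖z‖ := by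
  have h := IsUltrametricDist.norm_add_le_max (S.ex z - z) z
  rw [sub_add_cancel] at h
  refine h.trans (max_le ((S.ex_sub hz).trans ?_) le_rfl)
  have := norm_nonneg z
  nlinarith

theorem exists_L (l : C) : ∃ L : PowerSeries C, (∃ B, Bd B ((q : ℝ) ^ 2) L) ∧
    (PowerSeries.map S.φ L =
    ((Polynomial.X - Polynomial.C (S.θ ^ q) : Polynomial C) : PowerSeries C) *
      (L - PowerSeries.C (S.ex l))) ∧ ev S.θ L = l := by
  have hq0 := S.q0
  have hq1 : (1 : ℝ) < q := by have := S.q2; linarith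
  set f : ℕ → C := fun n => S.ex (l / S.θ ^ (n + 1)) with hf
  have hf1 : ∀ n, f n = S.θ * f (n + 1) + f (n + 1) ^ q := fun n => by
    rw [hf]; simp only
    rw [← S.ex_θ]; congr 1
    have := S.θ0
    field_simp
    ring
  have hf0 : S.ex l = S.θ * f 0 + f 0 ^ q := by
    rw [hf]; simp only
    rw [← S.ex_θ]; congr 1
    have := S.θ0
    field_simp
    simp
  obtain ⟨N, hN⟩ := pow_unbounded_of_one_lt ‖l‖ hq1
  have hny : ∀ n, ‖l / S.θ ^ (n + 1)‖ = ‖l‖ / (q : ℝ) ^ (n + 1) := fun n => by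
    rw [norm_div, norm_pow, S.hθ]
  have hsm : ∀ n, N ≤ n → ‖l / S.θ ^ (n + 1)‖ ≤ 1 := fun n hn => by
    rw [hny, div_le_one (by positivity)]
    exact hN.le.trans (pow_le_pow_right₀ hq1.le (by omega))
  set F : PowerSeries C := PowerSeries.mk f with hF
  have hrel : PowerSeries.map S.φ F = (PowerSeries.X - PowerSeries.C S.θ) * F +
      PowerSeries.C (S.ex l) := by
    ext n
    rcases n with _ | n
    · rw [map_add, lin_coeff_zero, PowerSeries.coeff_map, hF, coeff_mk, S.hφ, hf0]
      simp
    · rw [map_add, lin_coeff_succ, PowerSeries.coeff_map, hF, coeff_mk, coeff_mk, S.hφ, hf1 n,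
        PowerSeries.coeff_C, if_neg (by omega)]
      ring
  have hB : ∃ B, ∀ n, ‖coeff n F‖ * (q : ℝ) ^ n ≤ B := by
    refine ⟨max ‖l‖ (∑ n ∈ range N, ‖f n‖ * (q : ℝ) ^ n), fun n => ?_⟩
    rw [hF, coeff_mk]
    rcases lt_or_ge n N with h | h
    · refine le_trans ?_ (le_max_right _ _)
      exact single_le_sum (f := fun n => ‖f n‖ * (q : ℝ) ^ n) (fun i _ => by positivity)
        (mem_range.2 h)
    · refine le_trans ?_ (le_max_left _ _)
      have h1 := S.ex_le (hsm n h)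
      rw [hny] at h1
      calc ‖f n‖ * (q : ℝ) ^ n ≤ ‖l‖ / (q : ℝ) ^ (n + 1) * (q : ℝ) ^ n :=
            mul_le_mul_of_nonneg_right h1 (by positivity)
        _ = ‖l‖ / q := by rw [pow_succ]; field_simp
        _ ≤ ‖l‖ := div_le_self (norm_nonneg _) hq1.le
  obtain ⟨B, hB⟩ := hB
  obtain ⟨B', hB'⟩ := S.bd_mkL (α := S.ex l) hB
  refine ⟨_, ⟨B', hB'⟩, S.mkL hrel, ?_⟩
  set L := PowerSeries.C (S.ex l) - PowerSeries.map S.φ F with hL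
  have hlt : ‖S.θ‖ < (q : ℝ) ^ 2 := by rw [S.hθ]; nlinarith [S.q2]
  have hsum : Summable fun k => coeff k L * S.θ ^ k := Summable.of_norm (hB'.sm hlt)
  have hpart : ∀ M, ∑ k ∈ range (M + 1), coeff k L * S.θ ^ k = S.θ ^ (M + 1) * f M := by
    intro M
    have hc : ∀ n, coeff (n + 1) L = S.θ * f (n + 1) - f n := fun n => by
      rw [hL, map_sub, PowerSeries.coeff_map, hF, coeff_mk, S.hφ, PowerSeries.coeff_C,
        if_neg (by omega), hf1 n]
      ring
    induction M with
    | zero =>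
      rw [zero_add, sum_range_one, hL, map_sub, PowerSeries.coeff_map, hF, coeff_mk, S.hφ, hf0]
      simp
    | succ M ih =>
      rw [sum_range_succ, ih, hc]; ring
  have hlim1 := (hsum.hasSum.tendsto_sum_nat).comp (tendsto_add_atTop_nat 1)
  refine tendsto_nhds_unique hlim1 ?_
  rw [tendsto_iff_norm_sub_tendsto_zero]
  have hlim : Tendsto (fun M : ℕ => ‖l‖ ^ 2 * (1 / (q : ℝ)) ^ (M + 1)) atTop (𝓝 0) := by
    have := ((tendsto_pow_atTop_nhds_zero_of_lt_one (r := 1 / (q : ℝ)) (by positivity)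
      (by rw [div_lt_one hq0]; exact hq1)).comp (tendsto_add_atTop_nat 1)).const_mul (‖l‖ ^ 2)
    simpa using this
  refine squeeze_zero' (Eventually.of_forall fun _ => norm_nonneg _) ?_ hlim
  filter_upwards [eventually_ge_atTop N] with M hM
  simp only [Function.comp]
  rw [hpart]
  have hθM : S.θ ^ (M + 1) ≠ 0 := pow_ne_zero _ S.θ0
  have h1 : S.θ ^ (M + 1) * f M - l = S.θ ^ (M + 1) * (S.ex (l / S.θ ^ (M + 1)) - l / S.θ ^ (M + 1)) := by
    rw [mul_sub, mul_div_cancel₀ _ hθM]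
  rw [h1, norm_mul, norm_pow, S.hθ]
  calc _ ≤ (q : ℝ) ^ (M + 1) * ‖l / S.θ ^ (M + 1)‖ ^ 2 :=
        mul_le_mul_of_nonneg_left (S.ex_sub (hsm M hM)) (by positivity)
    _ = _ := by
      rw [hny, one_div, inv_pow]; field_simp

end Ctx

end Carlitz

namespace Carlitz

set_option linter.unusedSectionVars false

open Finset

section

variable {Fq : Type*} [Field Fq] [Fintype Fq] {C : Type*} [NormedField C] [IsUltrametricDist C]
  [Algebra (Polynomial Fq) C] {ι : Type*} [Fintype ι]

/-- Combinations of `b` with coefficients of degree `< n`. -/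
noncomputable def Gh (Fq : Type*) [Field Fq] {C : Type*} [NormedField C]
    [Algebra (Polynomial Fq) C] {ι : Type*} [Fintype ι] (b : ι → C) (n : ℕ) : AddSubgroup C :=
  (AddSubgroup.pi Set.univ fun _ : ι => (Polynomial.degreeLT Fq n).toAddSubgroup).map
    (Fintype.linearCombination (Polynomial Fq) b).toAddMonoidHom

theorem mem_Gh {b : ι → C} {n : ℕ} {x : C} :
    x ∈ Gh Fq b n ↔ ∃ f : ι → Polynomial Fq, (∀ i, f i ∈ Polynomial.degreeLT Fq n) ∧
      ∑ i, f i • b i = x := by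
  simp [Gh, AddSubgroup.mem_pi, Fintype.linearCombination_apply]

theorem Gh_mono (b : ι → C) : Monotone (Gh Fq b) := by
  intro m n h x hx
  rw [mem_Gh] at hx ⊢
  obtain ⟨f, hf, rfl⟩ := hx
  exact ⟨f, fun i => Polynomial.degreeLT_mono h (hf i), rfl⟩

theorem card_degreeLT (n : ℕ) :
    Nat.card (Polynomial.degreeLT Fq n) = Fintype.card Fq ^ n := by
  rw [Nat.card_congr (Polynomial.degreeLTEquiv Fq n).toEquiv]
  simp

theorem Gh_card {b : ι → C} (hb : LinearIndependent (Polynomial Fq) b) (n : ℕ) :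
    Nat.card (Gh Fq b n) = Fintype.card Fq ^ (Fintype.card ι * n) := by
  let g : (ι → Polynomial.degreeLT Fq n) → Gh Fq b n := fun f =>
    ⟨∑ i, (f i : Polynomial Fq) • b i, mem_Gh.2 ⟨fun i => f i, fun i => (f i).2, rfl⟩⟩
  have hg : Function.Bijective g := by
    constructor
    · intro f f' h
      have h1 := congrArg Subtype.val h
      have h2 : ∑ i, ((f i : Polynomial Fq) - f' i) • b i = 0 := by
        simp only [sub_smul, Finset.sum_sub_distrib]
        exact sub_eq_zero.2 h1
      funext i
      exact Subtype.ext (sub_eq_zero.1 (Fintype.linearIndependent_iff.1 hb _ h2 i))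
    · rintro ⟨x, hx⟩
      obtain ⟨f, hf, rfl⟩ := mem_Gh.1 hx
      exact ⟨fun i => ⟨f i, hf i⟩, rfl⟩
  rw [← Nat.card_congr (Equiv.ofBijective g hg), Nat.card_fun, card_degreeLT, ← pow_mul, mul_comm]
  simp

theorem deg_lt_mul {f g s : Polynomial Fq} {a b c0 : ℕ} (hf : f ∈ Polynomial.degreeLT Fq (a - c0))
    (hg : g ∈ Polynomial.degreeLT Fq (b - c0)) (hs : s.natDegree ≤ c0) :
    f * g * s ∈ Polynomial.degreeLT Fq (a + b - c0) := by
  rw [Polynomial.mem_degreeLT] at *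
  by_cases h0 : f * g * s = 0
  · rw [h0, Polynomial.degree_zero]; exact WithBot.bot_lt_coe _
  have hs0 : s ≠ 0 := right_ne_zero_of_mul h0
  have hfg := left_ne_zero_of_mul h0
  have hf0 := left_ne_zero_of_mul hfg
  have hg0 := right_ne_zero_of_mul hfg
  rw [← Polynomial.natDegree_lt_iff_degree_lt hf0] at hf
  rw [← Polynomial.natDegree_lt_iff_degree_lt hg0] at hg
  rw [← Polynomial.natDegree_lt_iff_degree_lt h0, Polynomial.natDegree_mul hfg hs0,
    Polynomial.natDegree_mul hf0 hg0]
  omega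

theorem Gh_mul {b : ι → C} {c0 : ℕ} {s : ι → ι → ι → Polynomial Fq}
    (hs : ∀ i j k, (s i j k).natDegree ≤ c0) (hbb : ∀ i j, b i * b j = ∑ k, s i j k • b k)
    {m n : ℕ} {x y : C} (hx : x ∈ Gh Fq b (m - c0)) (hy : y ∈ Gh Fq b (n - c0)) :
    x * y ∈ Gh Fq b (m + n - c0) := by
  obtain ⟨f, hf, rfl⟩ := mem_Gh.1 hx
  obtain ⟨g, hg, rfl⟩ := mem_Gh.1 hy
  rw [mem_Gh]
  refine ⟨fun k => ∑ i, ∑ j, f i * g j * s i j k, fun k => ?_, ?_⟩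
  · exact Submodule.sum_mem _ fun i _ => Submodule.sum_mem _ fun j _ =>
      deg_lt_mul (hf i) (hg j) (hs i j k)
  · rw [Finset.sum_mul_sum]
    simp only [Finset.sum_smul]
    rw [Finset.sum_comm]
    refine Finset.sum_congr rfl fun i _ => ?_
    rw [Finset.sum_comm]
    refine Finset.sum_congr rfl fun j _ => ?_
    rw [smul_mul_smul_comm, hbb, Finset.smul_sum]
    refine Finset.sum_congr rfl fun k _ => ?_
    rw [smul_smul]

theorem Gh_norm (hN : ∀ a : Polynomial Fq, a ≠ 0 →
    ‖algebraMap (Polynomial Fq) C a‖ = (Fintype.card Fq : ℝ) ^ a.natDegree)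
    {b : ι → C} {B : ℕ} (hB : ∀ i, ‖b i‖ ≤ (Fintype.card Fq : ℝ) ^ B) {n h : ℕ} (hn : n ≤ h)
    {x : C} (hx : x ∈ Gh Fq b n) : ‖x‖ ≤ (Fintype.card Fq : ℝ) ^ ((1 + B) * h) := by
  have hq : (1 : ℝ) ≤ Fintype.card Fq := by exact_mod_cast Fintype.card_pos
  obtain ⟨f, hf, rfl⟩ := mem_Gh.1 hx
  refine IsUltrametricDist.norm_sum_le_of_forall_le_of_nonneg (by positivity) fun i _ => ?_
  by_cases h0 : f i = 0
  · rw [h0, zero_smul, norm_zero]; positivity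
  have h1 := hf i
  rw [Polynomial.mem_degreeLT, ← Polynomial.natDegree_lt_iff_degree_lt h0] at h1
  rw [Algebra.smul_def, norm_mul, hN _ h0]
  calc _ ≤ (Fintype.card Fq : ℝ) ^ (f i).natDegree * (Fintype.card Fq : ℝ) ^ B := by
        gcongr; exact hB i
    _ = (Fintype.card Fq : ℝ) ^ ((f i).natDegree + B) := (pow_add _ _ _).symm
    _ ≤ _ := pow_le_pow_right₀ hq (by nlinarith)

theorem smul_one_mem_Gh {b : ι → C} {c0 : ℕ} {e : ι → Polynomial Fq}
    (he : ∀ i, (e i).natDegree ≤ c0) (h1 : ∑ i, e i • b i = 1) {a : Polynomial Fq} {n : ℕ}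
    (ha : a ∈ Polynomial.degreeLT Fq n) : algebraMap _ C a ∈ Gh Fq b (n + c0) := by
  rw [mem_Gh]
  refine ⟨fun i => a * e i, fun i => ?_, ?_⟩
  · show a * e i ∈ _
    by_cases h0 : a * e i = 0
    · rw [h0]; exact Submodule.zero_mem _
    have ha0 := left_ne_zero_of_mul h0
    have he0 := right_ne_zero_of_mul h0
    rw [Polynomial.mem_degreeLT, ← Polynomial.natDegree_lt_iff_degree_lt ha0] at ha
    rw [Polynomial.mem_degreeLT, ← Polynomial.natDegree_lt_iff_degree_lt h0,
      Polynomial.natDegree_mul ha0 he0]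
    have := he i
    omega
  · simp only [mul_smul, ← Finset.smul_sum, h1]
    rw [Algebra.smul_def, mul_one]

/-- Pigeonhole: every nonzero element divides a nonzero scalar. -/
theorem exists_mult [Nonempty ι] {b : ι → C} (hb : LinearIndependent (Polynomial Fq) b) {c0 : ℕ}
    {s : ι → ι → ι → Polynomial Fq}
    (hs : ∀ i j k, (s i j k).natDegree ≤ c0) (hbb : ∀ i j, b i * b j = ∑ k, s i j k • b k)
    {e : ι → Polynomial Fq} (he : ∀ i, (e i).natDegree ≤ c0) (h1 : ∑ i, e i • b i = 1)
    {h : ℕ} (hh : 1 ≤ h) {x : C} (hx : x ∈ Gh Fq b (h - c0)) (hx0 : x ≠ 0) :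
    ∃ y ∈ Gh Fq b (Fintype.card ι * (h + c0)), ∃ a : Polynomial Fq, a ≠ 0 ∧
      x * y = algebraMap _ C a := by
  classical
  set D := Fintype.card ι with hD
  have hDpos : 1 ≤ D := Fintype.card_pos
  set H := D * (h + c0) with hH
  have hq : 2 ≤ Fintype.card Fq := Fintype.one_lt_card
  have f1 : ∀ n, Finite (Gh Fq b n) := fun n => Nat.finite_of_card_ne_zero (by
    rw [Gh_card hb]; positivity)
  have f2 : ∀ n, Finite (Polynomial.degreeLT Fq n) := fun n => Nat.finite_of_card_ne_zero (by
    rw [card_degreeLT]; positivity)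
  let T := h + H
  have key : ∀ z : Gh Fq b H × Polynomial.degreeLT Fq T,
      x * z.1 - algebraMap _ C (z.2 : Polynomial Fq) ∈ Gh Fq b (T + c0) := by
    intro z
    refine AddSubgroup.sub_mem _ ?_ (smul_one_mem_Gh he h1 z.2.2)
    have hz : (z.1 : C) ∈ Gh Fq b (H + c0 - c0) := by rw [Nat.add_sub_cancel]; exact z.1.2
    have := Gh_mul (m := h) (n := H + c0) hs hbb hx hz
    exact Gh_mono b (by simp only [T]; omega) this
  let g : Gh Fq b H × Polynomial.degreeLT Fq T → Gh Fq b (T + c0) := fun z => ⟨_, key z⟩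
  have hcard : Nat.card (Gh Fq b (T + c0)) < Nat.card (Gh Fq b H × Polynomial.degreeLT Fq T) := by
    rw [Nat.card_prod, Gh_card hb, Gh_card hb, card_degreeLT, ← pow_add]
    refine Nat.pow_lt_pow_right (by omega) ?_
    have : D * (T + c0) = D * H + H := by simp only [T, hH]; ring
    rw [← hD, this]
    simp only [T]; omega
  have hni : ¬ Function.Injective g := fun hg => by
    have := Nat.card_le_card_of_injective g hg
    omega
  simp only [Function.Injective] at hni
  push Not at hni
  obtain ⟨z, w, hzw, hne⟩ := hni
  have h4 : x * ((z.1 : C) - w.1) = algebraMap _ C ((z.2 : Polynomial Fq) - w.2) := by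
    have := congrArg Subtype.val hzw
    simp only [g] at this
    rw [map_sub, mul_sub]
    linear_combination this
  refine ⟨(z.1 : C) - w.1, AddSubgroup.sub_mem _ z.1.2 w.1.2, _, ?_, h4⟩
  intro h0
  rw [h0, map_zero] at h4
  have h5 : (z.1 : C) = w.1 := sub_eq_zero.1 ((mul_eq_zero.1 h4).resolve_left hx0)
  exact hne (Prod.ext (Subtype.ext h5) (Subtype.ext (sub_eq_zero.1 h0)))

theorem exists_filt_aux [Nonempty ι] (hN : ∀ a : Polynomial Fq, a ≠ 0 →
    ‖algebraMap (Polynomial Fq) C a‖ = (Fintype.card Fq : ℝ) ^ a.natDegree)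
    {b : ι → C} (hb : LinearIndependent (Polynomial Fq) b)
    {s : ι → ι → ι → Polynomial Fq} (hbb : ∀ i j, b i * b j = ∑ k, s i j k • b k)
    {e : ι → Polynomial Fq} (h1 : ∑ i, e i • b i = 1) :
    ∃ F : Filt C (Fintype.card Fq), ∀ f : ι → Polynomial Fq, ∃ c, ∑ i, f i • b i ∈ F.G c := by
  classical
  have hq : (1 : ℝ) < Fintype.card Fq := by exact_mod_cast Fintype.one_lt_card
  let c0 := (∑ i, ∑ j, ∑ k, (s i j k).natDegree) + ∑ i, (e i).natDegree
  have he : ∀ i, (e i).natDegree ≤ c0 := fun i =>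
    (Finset.single_le_sum (f := fun i => (e i).natDegree) (fun _ _ => Nat.zero_le _)
      (Finset.mem_univ i)).trans (Nat.le_add_left _ _)
  have hs : ∀ i j k, (s i j k).natDegree ≤ c0 := fun i j k =>
    (((Finset.single_le_sum (f := fun k => (s i j k).natDegree) (fun _ _ => Nat.zero_le _)
      (Finset.mem_univ k)).trans
    (Finset.single_le_sum (f := fun j => ∑ k, (s i j k).natDegree) (fun _ _ => Nat.zero_le _)
      (Finset.mem_univ j))).trans
    (Finset.single_le_sum (f := fun i => ∑ j, ∑ k, (s i j k).natDegree)
      (fun _ _ => Nat.zero_le _) (Finset.mem_univ i))).trans (Nat.le_add_right _ _)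
  obtain ⟨B, hB⟩ : ∃ B : ℕ, ∀ i, ‖b i‖ ≤ (Fintype.card Fq : ℝ) ^ B := by
    obtain ⟨B, hB⟩ := pow_unbounded_of_one_lt (∑ i, ‖b i‖) hq
    exact ⟨B, fun i => (Finset.single_le_sum (f := fun i => ‖b i‖) (fun _ _ => norm_nonneg _)
      (Finset.mem_univ i)).trans hB.le⟩
  set D := Fintype.card ι with hD
  refine ⟨{ G := fun h => Gh Fq b (h - c0)
            mono := fun m n h => Gh_mono b (by omega)
            mul := fun hx hy => Gh_mul hs hbb hx hy
            D := D
            hD := Fintype.card_pos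
            c0 := c0
            card := fun h => Gh_card hb _
            c1 := 1 + B
            norm_le := fun {h x} hx => Gh_norm hN hB (Nat.sub_le _ _) hx
            c2 := (1 + B) * (D * (1 + c0))
            le_norm := ?_ }, ?_⟩
  · intro h x hx hx0
    rcases Nat.eq_zero_or_pos h with rfl | hh
    · exfalso
      obtain ⟨f, hf, rfl⟩ := mem_Gh.1 hx
      apply hx0
      refine Finset.sum_eq_zero fun i _ => ?_
      have := hf i
      rw [Polynomial.mem_degreeLT, Nat.zero_sub, Nat.cast_zero] at this
      rw [Polynomial.degree_eq_bot.1 (Nat.WithBot.lt_zero_iff.1 this), zero_smul]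
    obtain ⟨y, hy, a, ha, hxy⟩ := exists_mult hb hs hbb he h1 hh hx hx0
    have hy1 := Gh_norm hN hB (h := D * (1 + c0) * h) (by
      rw [← hD, mul_assoc]; gcongr; nlinarith) hy
    have h2 : 1 ≤ ‖x * y‖ := by
      rw [hxy, hN _ ha]; exact one_le_pow₀ hq.le
    rw [norm_mul] at h2
    refine h2.trans ?_
    rw [mul_assoc (1 + B)]
    gcongr
  · intro f
    refine ⟨c0 + (∑ i, (f i).natDegree + 1), ?_⟩
    simp only [Nat.add_sub_cancel_left]
    refine mem_Gh.2 ⟨f, fun i => ?_, rfl⟩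
    rw [Polynomial.mem_degreeLT]
    by_cases h0 : f i = 0
    · rw [h0, Polynomial.degree_zero]; exact WithBot.bot_lt_coe _
    rw [← Polynomial.natDegree_lt_iff_degree_lt h0]
    have := Finset.single_le_sum (f := fun i => (f i).natDegree) (fun _ _ => Nat.zero_le _)
      (Finset.mem_univ i)
    omega

theorem exists_filt (hN : ∀ a : Polynomial Fq, a ≠ 0 →
    ‖algebraMap (Polynomial Fq) C a‖ = (Fintype.card Fq : ℝ) ^ a.natDegree)
    {s : Set C} (hs : s.Finite) (hint : ∀ x ∈ s, IsIntegral (Polynomial Fq) x) :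
    ∃ F : Filt C (Fintype.card Fq), ∃ O : Subalgebra (Polynomial Fq) C,
      s ⊆ O ∧ ∀ x ∈ O, ∃ c, x ∈ F.G c := by
  classical
  have hinj : Function.Injective (algebraMap (Polynomial Fq) C) := by
    refine (injective_iff_map_eq_zero _).2 fun a ha => ?_
    by_contra h0
    have := hN a h0
    rw [ha, norm_zero] at this
    have hq : (0 : ℝ) < Fintype.card Fq := by exact_mod_cast Fintype.card_pos
    exact absurd this (by positivity)
  let O := Algebra.adjoin (Polynomial Fq) s
  have hfg := fg_adjoin_of_finite hs hint
  have : Module.Finite (Polynomial Fq) O := Module.Finite.iff_fg.2 hfg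
  have : FaithfulSMul (Polynomial Fq) C := (faithfulSMul_iff_algebraMap_injective _ _).2 hinj
  have : Module.IsTorsionFree (Polynomial Fq) C := inferInstance
  have : Module.IsTorsionFree (Polynomial Fq) O := inferInstance
  have : Module.Free (Polynomial Fq) O := inferInstance
  let bO := Module.Free.chooseBasis (Polynomial Fq) O
  have hne : Nonempty (Module.Free.ChooseBasisIndex (Polynomial Fq) O) := bO.index_nonempty
  have hrep : ∀ x : O, ∑ i, bO.repr x i • (bO i : C) = x := fun x => by
    have h3 := congrArg (Subalgebra.val O) (bO.sum_repr x)
    rw [map_sum] at h3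
    simp only [map_smul] at h3
    exact h3
  obtain ⟨F, hF⟩ := exists_filt_aux (b := fun i => (bO i : C)) hN
    (bO.linearIndependent.map' O.val.toLinearMap
      (LinearMap.ker_eq_bot.2 Subtype.val_injective))
    (s := fun i j k => bO.repr (bO i * bO j) k) (fun i j => (hrep (bO i * bO j)).symm)
    (e := fun i => bO.repr 1 i) (hrep 1)
  refine ⟨F, O, Algebra.subset_adjoin, fun x hx => ?_⟩
  obtain ⟨c, hc⟩ := hF (fun i => bO.repr ⟨x, hx⟩ i)
  rw [hrep] at hc
  exact ⟨c, hc⟩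

end

end Carlitz

namespace Carlitz

set_option linter.unusedSectionVars false

open Finset

section

variable {Fq : Type*} [Field Fq] [Fintype Fq] {C : Type*} [NormedField C] [IsUltrametricDist C]
  [CompleteSpace C] [IsAlgClosed C] [Algebra (Polynomial Fq) C] {J : Type*} [Fintype J]
  [DecidableEq J]

theorem exists_unif {ι : Type*} [Fintype ι] {Q : ι → ℕ → Prop}
    (hm : ∀ i m n, m ≤ n → Q i m → Q i n) (h : ∀ i, ∃ c, Q i c) : ∃ c, ∀ i, Q i c := by
  choose f hf using h
  exact ⟨univ.sup f, fun i => hm i _ _ (Finset.le_sup (Finset.mem_univ i)) (hf i)⟩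

theorem exists_P {q : ℕ} {F : Filt C q} {O : Subalgebra (Polynomial Fq) C}
    (hF : ∀ x ∈ O, ∃ c, x ∈ F.G c) {p : Polynomial C}
    (hp : p ∈ Polynomial.lifts O.toSubsemiring.subtype) : ∃ c, F.P c p := by
  have h1 : ∀ k, p.coeff k ∈ O := fun k => by
    rw [Polynomial.lifts_iff_coeff_lifts] at hp
    obtain ⟨y, hy⟩ := hp k
    rw [← hy]; exact y.2
  obtain ⟨c, hc⟩ := exists_unif (ι := Fin (p.natDegree + 1)) (Q := fun k c => p.coeff k ∈ F.G c)
    (fun k m n h hx => F.mono h hx) (fun k => hF _ (h1 k))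
  refine ⟨c, fun k => ?_⟩
  by_cases hk : k < p.natDegree + 1
  · exact hc ⟨k, hk⟩
  · rw [Polynomial.coeff_eq_zero_of_natDegree_lt (by omega)]; exact AddSubgroup.zero_mem _

theorem C_mem_lifts {O : Subalgebra (Polynomial Fq) C} {x : C} (hx : x ∈ O) :
    Polynomial.C x ∈ Polynomial.lifts O.toSubsemiring.subtype :=
  Polynomial.C_mem_lifts O.toSubsemiring.subtype (⟨x, hx⟩ : O.toSubsemiring)

theorem ac {q : ℕ} (hqq : Fintype.card Fq = q) (p : ℕ) [Fact p.Prime] [CharP C p] (hN : ∀ a : Polynomial Fq, a ≠ 0 →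
    ‖algebraMap (Polynomial Fq) C a‖ = (Fintype.card Fq : ℝ) ^ a.natDegree)
    (S : FData C q J) (hθ : S.θ = algebraMap (Polynomial Fq) C Polynomial.X)
    {c : C} (hc0 : c ≠ 0) (hc : IsIntegral (Polynomial Fq) c)
    (hcα : ∀ j, IsIntegral (Polynomial Fq) (c * S.α j)) {d : ℕ}
    (ρ : (J → Fin (d + 1)) → Polynomial Fq)
    (hρ : ∑ μ, algebraMap (Polynomial Fq) C (ρ μ) * ∏ j, (c * ev S.θ (S.L j)) ^ (μ j : ℕ) = 0) :
    ρ = 0 := by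
  by_contra hρ0
  have hq := S.hq
  have hq1 : (1 : ℝ) < q := by exact_mod_cast hq
  have hfilt := exists_filt hN (s := insert c (Set.range fun j => c * S.α j))
    ((Set.finite_range _).insert c) (by
      rintro x (rfl | ⟨j, rfl⟩)
      · exact hc
      · exact hcα j)
  rw [hqq] at hfilt hN
  obtain ⟨F, O, hO, hF⟩ := hfilt
  have hcO : c ∈ O := hO (Set.mem_insert _ _)
  have hαO : ∀ j, c * S.α j ∈ O := fun j => hO (Set.mem_insert_of_mem _ ⟨j, rfl⟩)
  have hθO : S.θ ∈ O := by rw [hθ]; exact O.algebraMap_mem _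
  let v : Polynomial C := Polynomial.C (c ^ (q - 1)) * (Polynomial.X - Polynomial.C (S.θ ^ q))
  have hvl : v ∈ Polynomial.lifts O.toSubsemiring.subtype := by
    refine mul_mem (C_mem_lifts (pow_mem hcO _)) ?_
    rw [sub_eq_add_neg, ← Polynomial.C_neg]
    exact add_mem (Polynomial.X_mem_lifts _) (C_mem_lifts (neg_mem (pow_mem hθO _)))
  let L' : J → PowerSeries C := fun j => PowerSeries.C c * S.L j
  have hL' : ∀ j, PowerSeries.map S.φ (L' j) =
      (v : PowerSeries C) * (L' j - PowerSeries.C (c * S.α j)) := by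
    intro j
    simp only [L', v, map_mul, S.hL, PowerSeries.map_C, S.hφ, Polynomial.coe_mul, Polynomial.coe_C]
    have : c ^ q = c ^ (q - 1) * c := by rw [← pow_succ, Nat.sub_add_cancel (by omega)]
    rw [this, map_mul]
    ring
  have hLB : ∀ j, ∃ B, Bd B ((q : ℝ) ^ 2) (L' j) := fun j => by
    obtain ⟨B1, hB1⟩ := Bd.exists_poly (R := (q : ℝ) ^ 2) (one_le_pow₀ hq1.le) (Polynomial.C c)
    rw [Polynomial.coe_C] at hB1
    exact ⟨_, hB1.mul (by positivity) (S.hB j)⟩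
  choose B' hB' using hLB
  have hsm : ∀ j, Sm S.θ (S.L j) := fun j => (S.hB j).sm (by
    rw [S.hθ]; exact lt_self_pow₀ hq1 (by norm_num))
  have hevL : ∀ j, ev S.θ (L' j) = c * ev S.θ (S.L j) := fun j => by
    simp only [L']
    rw [← Polynomial.coe_C, ev_mul (Sm.poly _ _) (hsm j), ev_poly, Polynomial.eval_C]
  have hsm' : ∀ j, Sm S.θ (L' j) := fun j => (hB' j).sm (by
    rw [S.hθ]; exact lt_self_pow₀ hq1 (by norm_num))
  let E := Fintype.card J * d
  have hE : ∀ μ : J → Fin (d + 1), ∑ j, (μ j : ℕ) ≤ E := fun μ => by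
    refine (Finset.sum_le_card_nsmul _ _ d fun j _ => by have := (μ j).2; omega).trans ?_
    simp [E]
  let ψ : (J → Fin (d + 1)) → PowerSeries C := fun μ => ∏ j, L' j ^ (μ j : ℕ)
  let Φ : (J → Fin (d + 1)) → (J → Fin (d + 1)) → Polynomial C := fun μ κ =>
    ∏ j, (v ^ (κ j : ℕ) * (v * Polynomial.C (-(c * S.α j))) ^ ((μ j : ℕ) - κ j) *
      ((μ j : ℕ).choose (κ j) : Polynomial C))
  let Ψ : (J → Fin (d + 1)) → (J → Fin (d + 1)) → Polynomial C := fun μ κ =>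
    v ^ (E - ∑ j, (μ j : ℕ)) * ∏ j, ((v * Polynomial.C (c * S.α j)) ^ ((μ j : ℕ) - κ j) *
      ((μ j : ℕ).choose (κ j) : Polynomial C))
  have hψB : ∀ μ, ∃ b : ℕ, Bd ((q : ℝ) ^ b) ((q : ℝ) ^ 2) (ψ μ) := fun μ => by
    have h1 := Bd.prod (R := (q : ℝ) ^ 2) (by positivity) univ
      (f := fun j => L' j ^ (μ j : ℕ)) (fun j _ => (hB' j).pow (by positivity) (μ j))
    obtain ⟨b, hb⟩ := pow_unbounded_of_one_lt (∏ j, B' j ^ (μ j : ℕ)) hq1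
    exact ⟨b, h1.mono hb.le⟩
  obtain ⟨b, hb⟩ := exists_unif (ι := J → Fin (d + 1))
    (Q := fun μ b => Bd ((q : ℝ) ^ b) ((q : ℝ) ^ 2) (ψ μ)) (fun μ m n h hx => Bd.mono hx (pow_le_pow_right₀ hq1.le h)) hψB
  have hΦl : ∀ μ κ, Φ μ κ ∈ Polynomial.lifts O.toSubsemiring.subtype := fun μ κ =>
    prod_mem fun j _ => mul_mem (mul_mem (pow_mem hvl _) (pow_mem (mul_mem hvl
      (C_mem_lifts (neg_mem (hαO j)))) _)) (natCast_mem _ _)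
  have hΨl : ∀ μ κ, Ψ μ κ ∈ Polynomial.lifts O.toSubsemiring.subtype := fun μ κ =>
    mul_mem (pow_mem hvl _) (prod_mem fun j _ => mul_mem (pow_mem (mul_mem hvl
      (C_mem_lifts (hαO j))) _) (natCast_mem _ _))
  obtain ⟨k1, hk1⟩ := exists_unif (ι := (J → Fin (d + 1)) × (J → Fin (d + 1)))
    (Q := fun i c => F.P c (Φ i.1 i.2))
    (fun i m n h hx => Filt.P.mono' hx h) (fun i => exists_P hF (hΦl i.1 i.2))
  obtain ⟨k2, hk2⟩ := exists_unif (ι := (J → Fin (d + 1)) × (J → Fin (d + 1)))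
    (Q := fun i c => F.P c (Ψ i.1 i.2))
    (fun i m n h hx => Filt.P.mono' hx h) (fun i => exists_P hF (hΨl i.1 i.2))
  obtain ⟨k3, hk3⟩ := hF 1 (one_mem _)
  obtain ⟨k4, hk4⟩ := hF _ hθO
  obtain ⟨k5, hk5⟩ := exists_unif (ι := J → Fin (d + 1))
    (Q := fun i c => algebraMap (Polynomial Fq) C (ρ i) ∈ F.G c)
    (fun i m n h hx => F.mono h hx) (fun i => hF _ (O.algebraMap_mem (ρ i)))
  obtain ⟨e1, he1⟩ := exists_unif (ι := (J → Fin (d + 1)) × (J → Fin (d + 1)))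
    (Q := fun i e => (Φ i.1 i.2).natDegree ≤ e)
    (fun i m n h hx => hx.trans h) (fun i => ⟨_, le_rfl⟩)
  obtain ⟨e2, he2⟩ := exists_unif (ι := (J → Fin (d + 1)) × (J → Fin (d + 1)))
    (Q := fun i e => (Ψ i.1 i.2).natDegree ≤ e)
    (fun i m n h hx => hx.trans h) (fun i => ⟨_, le_rfl⟩)
  have hprodcoe : ∀ (f : J → Polynomial C),
      ((∏ j, f j : Polynomial C) : PowerSeries C) = ∏ j, (f j : PowerSeries C) := fun f => by
    rw [← Polynomial.coeToPowerSeries.ringHom_apply, map_prod]; rfl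
  have hnat : ∀ n : ℕ, ((n : Polynomial C) : PowerSeries C) = n := fun n => by
    rw [← Polynomial.coeToPowerSeries.ringHom_apply, map_natCast]
  have hinj : Function.Injective (algebraMap (Polynomial Fq) C) := by
    refine (injective_iff_map_eq_zero _).2 fun a ha => ?_
    by_contra h0
    have := hN a h0
    rw [ha, norm_zero] at this
    exact absurd this (by positivity)
  refine LData.contradiction (q := q) (F := F) (M := J → Fin (d + 1))
    { hq := hq, φ := S.φ, hφ := S.hφ, hsurj := S.hsurj, θ := S.θ, hθ := S.hθ
      ψ := ψ, b := b, hψ := hb, Φ := Φ, Ψ := Ψ, u := v ^ E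
      c := k1 + k2 + k3 + k4 + k5, e := e1 + e2
      ρ := fun μ => algebraMap _ C (ρ μ)
      hΦ := ?_, hΨ := ?_, hu := ?_, hind := ?_
      hΦc := fun μ κ => Filt.P.mono' (hk1 (μ, κ)) (by omega)
      hΨc := fun μ κ => Filt.P.mono' (hk2 (μ, κ)) (by omega)
      hΦe := fun μ κ => (he1 (μ, κ)).trans (by omega)
      hΨe := fun μ κ => (he2 (μ, κ)).trans (by omega)
      h1c := F.mono (by omega) hk3
      hθc := F.mono (by omega) hk4
      hρc := fun μ => F.mono (by omega) (hk5 μ)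
      hρ0 := ?_, hρ := ?_ }
  · intro μ
    simp only [ψ, Φ, map_prod, map_pow, hL']
    have : ∀ j, (v : PowerSeries C) * (L' j - PowerSeries.C (c * S.α j)) =
        v * L' j + v * PowerSeries.C (-(c * S.α j)) := fun j => by rw [map_neg]; ring
    simp only [this, prod_expand]
    refine sum_congr rfl fun κ _ => ?_
    rw [hprodcoe, ← prod_mul_distrib]
    refine prod_congr rfl fun j _ => ?_
    simp only [Polynomial.coe_mul, Polynomial.coe_pow, Polynomial.coe_C, hnat]
    ring
  · intro μ
    have h1 : (v : PowerSeries C) ^ E * ψ μ = (v : PowerSeries C) ^ (E - ∑ j, (μ j : ℕ)) *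
        ∏ j, (PowerSeries.map S.φ (L' j) + v * PowerSeries.C (c * S.α j)) ^ (μ j : ℕ) := by
      have : ∀ j, PowerSeries.map S.φ (L' j) + v * PowerSeries.C (c * S.α j) = v * L' j :=
        fun j => by rw [hL']; ring
      simp only [this, mul_pow, prod_mul_distrib, prod_pow_eq_pow_sum, ψ]
      rw [← mul_assoc, ← pow_add, Nat.sub_add_cancel (hE μ)]
    rw [Polynomial.coe_pow, h1, prod_expand, mul_sum]
    refine sum_congr rfl fun κ _ => ?_
    simp only [Ψ, ψ, Polynomial.coe_mul, hprodcoe, map_prod, mul_assoc, Polynomial.coe_pow]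
    rw [← prod_mul_distrib]
    congr 1
    refine prod_congr rfl fun j _ => ?_
    simp only [Polynomial.coe_C, hnat, map_pow]
    ring
  · intro ν i hνi
    have h1 : S.θ ^ q ^ ν ≠ S.θ ^ q ^ (i + 1) := by
      intro h
      have h2 := congrArg norm h
      rw [norm_pow, norm_pow, S.hθ] at h2
      have h3 := pow_right_injective₀ (by positivity) hq1.ne' h2
      have h4 := Nat.pow_right_injective hq h3
      omega
    simp only [v, Polynomial.map_pow, Polynomial.map_mul, Polynomial.map_sub, Polynomial.map_C,
      Polynomial.map_X, Polynomial.eval_pow, Polynomial.eval_mul, Polynomial.eval_sub,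
      Polynomial.eval_C, Polynomial.eval_X, pow_apply_q S.hφ]
    refine pow_ne_zero _ (mul_ne_zero (pow_ne_zero _ (pow_ne_zero _ hc0)) (sub_ne_zero.2 ?_))
    rw [← pow_mul, ← pow_succ']
    exact h1
  · intro g hg μ
    have h1 : S.rel (fun μ : J → Fin (d + 1) => g μ * Polynomial.C (c ^ ∑ j, (μ j : ℕ))) = 0 := by
      rw [← hg, FData.rel]
      refine sum_congr rfl fun μ _ => ?_
      simp only [ψ, L', mul_pow, prod_mul_distrib, prod_pow_eq_pow_sum, Polynomial.coe_mul,
        Polynomial.coe_pow, Polynomial.coe_C, map_pow, mul_assoc]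
    have h2 := congrFun (S.indep p _ h1) μ
    exact (mul_eq_zero.1 h2).resolve_right (Polynomial.C_ne_zero.2 (pow_ne_zero _ hc0))
  · intro h
    apply hρ0
    funext μ
    exact hinj (by rw [congrFun h μ]; simp)
  · rw [← hρ]
    refine sum_congr rfl fun μ _ => ?_
    simp only [ψ]
    rw [(ev_prod univ fun j _ => (hsm' j).pow _).2]
    simp only [ev_pow (hsm' _), hevL]

end

end Carlitz

namespace Carlitz

set_option linter.unusedSectionVars false

open Finset

/-- A linearly independent family in the span of an algebraically independent one. -/
theorem algIndep_of_linear {K C I J : Type*} [Field K] [Field C] [Algebra K C] [Fintype I]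
    [Fintype J] {y : J → C} (hy : AlgebraicIndependent K y) {l : I → C}
    (hl : LinearIndependent K l) (hs : ∀ i, l i ∈ Submodule.span K (Set.range y)) :
    AlgebraicIndependent K l := by
  classical
  have h1 : ∀ i, ∃ f : J → K, ∑ j, f j • y j = l i := fun i =>
    (Submodule.mem_span_range_iff_exists_fun K).1 (hs i)
  choose M hM using h1
  let T : (I → K) →ₗ[K] (J → K) := Fintype.linearCombination K M
  have hT : Function.Injective T := by
    rw [injective_iff_map_eq_zero]
    intro v hv
    have h2 : ∑ i, v i • l i = 0 := by
      have h3 : ∀ j, ∑ i, v i * M i j = 0 := fun j => by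
        have := congrFun hv j
        simpa [T, Fintype.linearCombination_apply] using this
      simp only [← hM, smul_sum, smul_smul]
      rw [sum_comm]
      simp only [← sum_smul, h3, zero_smul, sum_const_zero]
    exact funext (Fintype.linearIndependent_iff.1 hl v h2)
  obtain ⟨R, hR⟩ := LinearMap.exists_leftInverse_of_injective T (LinearMap.ker_eq_bot.2 hT)
  have hRM : ∀ i k, ∑ j, M i j * R (Pi.single j 1) k = (if i = k then 1 else 0) := fun i k => by
    have h2 := congrFun (LinearMap.congr_fun hR (Pi.single i 1)) k
    have h3 : T (Pi.single i 1) = M i := by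
      simp [T, Fintype.linearCombination_apply_single]
    rw [LinearMap.comp_apply, h3, LinearMap.id_apply] at h2
    have h4 : M i = ∑ j, M i j • (Pi.single j (1 : K) : J → K) := by
      funext j; simp [Finset.sum_apply, Pi.single_apply]
    rw [h4, map_sum] at h2
    simp only [map_smul, Finset.sum_apply, Pi.smul_apply, smul_eq_mul, Pi.single_apply] at h2
    rw [h2]
    simp [eq_comm]
  rw [algebraicIndependent_iff]
  intro P hP
  let P' : MvPolynomial J K :=
    MvPolynomial.aeval (fun i => ∑ j, M i j • (MvPolynomial.X j : MvPolynomial J K)) P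
  have h5 : MvPolynomial.aeval y P' = 0 := by
    rw [← hP]
    simp only [P']
    rw [← AlgHom.comp_apply, MvPolynomial.comp_aeval]
    congr 2
    funext i
    simp [hM]
  have h6 : P' = 0 := (algebraicIndependent_iff.1 hy) _ h5
  have h7 : MvPolynomial.aeval
      (fun j => ∑ k, R (Pi.single j 1) k • (MvPolynomial.X k : MvPolynomial I K)) P' = P := by
    simp only [P']
    rw [← AlgHom.comp_apply, MvPolynomial.comp_aeval]
    conv_rhs => rw [← MvPolynomial.aeval_X_left_apply P]
    congr 2
    funext i
    simp only [map_sum, map_smul, MvPolynomial.aeval_X, smul_sum, smul_smul]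
    rw [sum_comm]
    simp only [← sum_smul, hRM]
    simp
  rw [← h7, h6, map_zero]

/-- Clearing denominators. -/
theorem algIndep_of_box {A K C J : Type*} [CommRing A] [IsDomain A] [Field K] [Field C]
    [Algebra A K] [IsFractionRing A K] [Algebra K C] [Algebra A C] [IsScalarTower A K C]
    [Fintype J] [DecidableEq J] {x : J → C}
    (h : ∀ (d : ℕ) (ρ : (J → Fin (d + 1)) → A),
      ∑ μ, algebraMap A C (ρ μ) * ∏ j, x j ^ (μ j : ℕ) = 0 → ρ = 0) :
    AlgebraicIndependent K x := by
  classical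
  rw [algebraicIndependent_iff]
  intro P hP
  set d := P.totalDegree with hd
  let r : (J → Fin (d + 1)) → (J →₀ ℕ) := fun μ => Finsupp.equivFunOnFinite.symm fun j => (μ j : ℕ)
  have hr : ∀ μ j, r μ j = (μ j : ℕ) := fun μ j => rfl
  have hrinj : Function.Injective r := fun μ ν hμν => by
    funext j
    exact Fin.ext (by rw [← hr, ← hr, hμν])
  have hsupp : ∀ m ∈ P.support, ∃ μ, r μ = m := fun m hm => by
    have h1 : ∀ j, m j ≤ d := fun j => by
      refine le_trans ?_ (MvPolynomial.le_totalDegree hm)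
      rw [Finsupp.sum_fintype _ _ (fun _ => rfl)]
      exact Finset.single_le_sum (f := fun j => m j) (fun _ _ => Nat.zero_le _) (mem_univ j)
    refine ⟨fun j => ⟨m j, Nat.lt_succ_of_le (h1 j)⟩, ?_⟩
    ext j; rfl
  obtain ⟨⟨b, hb⟩, hbi⟩ := IsLocalization.exist_integer_multiples_of_finite (nonZeroDivisors A)
    (fun μ => P.coeff (r μ))
  choose ρ hρ using hbi
  have hb0 : b ≠ 0 := nonZeroDivisors.ne_zero hb
  have hbK : algebraMap A K b ≠ 0 := fun h0 => hb0 (IsFractionRing.injective A K (by rw [h0, map_zero]))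
  have h2 : ∑ μ, algebraMap A C (ρ μ) * ∏ j, x j ^ (μ j : ℕ) = 0 := by
    have h3 : ∀ μ, algebraMap A C (ρ μ) =
        algebraMap A C b * algebraMap K C (P.coeff (r μ)) := fun μ => by
      rw [IsScalarTower.algebraMap_apply A K C, hρ, Algebra.smul_def, map_mul,
        ← IsScalarTower.algebraMap_apply A K C]
    simp only [h3, mul_assoc, ← mul_sum]
    convert mul_zero _
    simp only [← hr]
    rw [← hP, MvPolynomial.aeval_def, MvPolynomial.eval₂_eq', ← Finset.sum_image (f := fun m =>
      algebraMap K C (P.coeff m) * ∏ j, x j ^ m j) (g := r) (fun _ _ _ _ hh => hrinj hh)]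
    symm
    refine Finset.sum_subset (fun m hm => ?_) fun m _ hm => ?_
    · obtain ⟨μ, hμ⟩ := hsupp m hm
      exact Finset.mem_image.2 ⟨μ, mem_univ _, hμ⟩
    · rw [MvPolynomial.notMem_support_iff.1 hm]; simp
  have h4 := h d ρ h2
  ext m
  rw [MvPolynomial.coeff_zero]
  by_contra hm
  obtain ⟨μ, rfl⟩ := hsupp m (MvPolynomial.mem_support_iff.2 hm)
  have h5 := hρ μ
  rw [h4, Pi.zero_apply, map_zero, Algebra.smul_def] at h5
  exact hm ((mul_eq_zero.1 h5.symm).resolve_left hbK)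

/-- Elements fixed by the `q`-power map. -/
theorem fixed_mem {Fq C : Type*} [Field Fq] [Fintype Fq] [Field C] (f : Fq →+* C) {x : C}
    (hx : x ^ Fintype.card Fq = x) : ∃ a, f a = x := by
  classical
  have hne : (Polynomial.X ^ Fintype.card Fq - Polynomial.X : Polynomial C) ≠ 0 :=
    FiniteField.X_pow_card_sub_X_ne_zero C Fintype.one_lt_card
  have hsub : (Finset.univ.image f) ⊆
      (Polynomial.X ^ Fintype.card Fq - Polynomial.X : Polynomial C).roots.toFinset := by
    intro y hy
    obtain ⟨a, -, rfl⟩ := Finset.mem_image.1 hy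
    rw [Multiset.mem_toFinset, Polynomial.mem_roots hne]
    simp [Polynomial.IsRoot, ← map_pow, FiniteField.pow_card]
  have hcard : (Polynomial.X ^ Fintype.card Fq - Polynomial.X : Polynomial C).roots.toFinset.card ≤
      (Finset.univ.image f).card := by
    rw [Finset.card_image_of_injective _ f.injective, Finset.card_univ]
    refine (Multiset.toFinset_card_le _).trans ((Polynomial.card_roots' _).trans ?_)
    rw [FiniteField.X_pow_card_sub_X_natDegree_eq C Fintype.one_lt_card]
  have heq := Finset.eq_of_subset_of_card_le hsub hcard
  have : x ∈ Finset.univ.image f := by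
    rw [heq, Multiset.mem_toFinset, Polynomial.mem_roots hne]
    simp [Polynomial.IsRoot, hx]
  obtain ⟨a, -, ha⟩ := Finset.mem_image.1 this
  exact ⟨a, ha⟩

theorem fixed_poly {Fq C : Type*} [Field Fq] [Fintype Fq] [Field C] (f : Fq →+* C) (φ : C →+* C)
    (hφ : ∀ x, φ x = x ^ Fintype.card Fq) {P : Polynomial C} (hP : P.map φ = P) :
    ∃ a : Polynomial Fq, a.map f = P := by
  have h1 : P ∈ Polynomial.lifts f := by
    rw [Polynomial.lifts_iff_coeff_lifts]
    intro k
    obtain ⟨a, ha⟩ := fixed_mem f (x := P.coeff k) (by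
      rw [← hφ, ← Polynomial.coeff_map, hP])
    exact ⟨a, ha⟩
  exact (Polynomial.mem_lifts _).1 h1

end Carlitz

namespace Carlitz

set_option linter.unusedSectionVars false

open Finset

section

variable {Fq : Type*} [Field Fq] [Fintype Fq] {C : Type*} [NormedField C] [IsUltrametricDist C]
  [CompleteSpace C] [IsAlgClosed C] [Algebra (RatFunc Fq) C] [Algebra (Polynomial Fq) C]
  [IsScalarTower (Polynomial Fq) (RatFunc Fq) C]

theorem core (p : ℕ) [Fact p.Prime] [CharP C p] (hN : ∀ a : Polynomial Fq, a ≠ 0 →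
    ‖algebraMap (Polynomial Fq) C a‖ = (Fintype.card Fq : ℝ) ^ a.natDegree)
    (S : Ctx C (Fintype.card Fq)) (hθ : S.θ = algebraMap (Polynomial Fq) C Polynomial.X)
    {L0 : PowerSeries C} (hL0 : L0 ≠ 0) (hL0B : ∃ B, Bd B ((Fintype.card Fq : ℝ) ^ 2) L0)
    (hL0e : PowerSeries.map S.φ L0 =
      ((Polynomial.X - Polynomial.C (S.θ ^ Fintype.card Fq) : Polynomial C) : PowerSeries C) *
      (L0 - PowerSeries.C 0))
    {J : Type*} [Fintype J] [DecidableEq J] (i0 : J) (x : J → C) (hx0 : x i0 = ev S.θ L0)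
    (halg : ∀ j, j ≠ i0 → IsAlgebraic (RatFunc Fq) (S.ex (x j)))
    (hlin : ∀ c : J → Polynomial Fq, ∑ j, algebraMap _ C (c j) * x j = 0 →
      ∀ j, j ≠ i0 → c j = 0) :
    ∃ a : Polynomial Fq, a ≠ 0 ∧
      AlgebraicIndependent (RatFunc Fq) (fun j => algebraMap _ C a * x j) := by
  classical
  have hinj : Function.Injective (algebraMap (Polynomial Fq) C) := by
    refine (injective_iff_map_eq_zero _).2 fun a ha => ?_
    by_contra h0
    have := hN a h0
    rw [ha, norm_zero] at this
    have hq : (0 : ℝ) < Fintype.card Fq := by exact_mod_cast Fintype.card_pos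
    exact absurd this (by positivity)
  obtain ⟨Ω, hΩ0, ⟨BΩ, hΩB⟩, hΩ⟩ := S.exists_Ω
  have hex : ∀ j, ∃ (L : PowerSeries C) (α : C), (∃ B, Bd B ((Fintype.card Fq : ℝ) ^ 2) L) ∧
      PowerSeries.map S.φ L =
      ((Polynomial.X - Polynomial.C (S.θ ^ Fintype.card Fq) : Polynomial C) : PowerSeries C) *
        (L - PowerSeries.C α) ∧ ev S.θ L = x j ∧ IsAlgebraic (RatFunc Fq) α ∧
        (j = i0 → α = 0 ∧ L = L0) := by
    intro j
    by_cases hj : j = i0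
    · subst hj
      exact ⟨L0, 0, hL0B, hL0e, hx0.symm, isAlgebraic_zero, fun _ => ⟨rfl, rfl⟩⟩
    · obtain ⟨L, h1, h2, h3⟩ := S.exists_L (x j)
      exact ⟨L, _, h1, h2, h3, halg j hj, fun h => absurd h hj⟩
  choose L α hB hL hev hα h0 using hex
  choose B hB using hB
  have hint : ∀ j, ∃ y : Polynomial Fq, y ≠ 0 ∧ IsIntegral (Polynomial Fq) (y • α j) := fun j =>
    ((IsFractionRing.isAlgebraic_iff (Polynomial Fq) (RatFunc Fq) C).2
      (hα j)).exists_integral_multiple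
  choose y hy0 hy using hint
  let S' : FData C (Fintype.card Fq) J :=
    { hq := S.hq, φ := S.φ, hφ := S.hφ, hsurj := S.hsurj, θ := S.θ, hθ := S.hθ
      L := L, α := α, i0 := i0, hα := (h0 i0 rfl).1
      hL0 := by rw [(h0 i0 rfl).2]; exact hL0
      B := max BΩ (∑ j, B j)
      hB := fun j => (hB j).mono ((Finset.single_le_sum (f := B) (fun k _ => (hB k).nonneg)
        (mem_univ j)).trans (le_max_right _ _))
      hL := hL, Ω := Ω, hΩ0 := hΩ0, hΩB := hΩB.mono (le_max_left _ _), hΩ := hΩ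
      hlin := by
        intro c hc hsum j hj
        choose a ha using fun j =>
          fixed_poly ((algebraMap (Polynomial Fq) C).comp Polynomial.C) S.φ S.hφ (hc j)
        have h1 : ∀ j, (c j).eval S.θ = algebraMap _ C (a j) := fun j => by
          rw [← ha j, Polynomial.eval_map, hθ, ← Polynomial.hom_eval₂, Polynomial.eval₂_C_X]
        simp only [h1, hev] at hsum
        rw [← ha j, hlin a hsum j hj, Polynomial.map_zero] }
  have hc0 : (∏ j, y j) ≠ 0 := Finset.prod_ne_zero_iff.2 fun j _ => hy0 j
  refine ⟨∏ j, y j, hc0, algIndep_of_box (A := Polynomial Fq) fun d ρ hρ => ?_⟩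
  refine ac rfl p hN S' hθ (c := algebraMap _ C (∏ j, y j))
    (fun h => hc0 (hinj (by rw [h, map_zero]))) isIntegral_algebraMap (fun j => ?_) ρ ?_
  · show IsIntegral _ (algebraMap _ C (∏ j, y j) * α j)
    rw [← Finset.mul_prod_erase univ y (mem_univ j), map_mul, mul_right_comm,
      ← Algebra.smul_def]
    exact (hy j).mul isIntegral_algebraMap
  · rw [← hρ]
    refine sum_congr rfl fun μ _ => ?_
    congr 1
    refine prod_congr rfl fun j _ => ?_
    show (_ * ev S.θ (L j)) ^ _ = _
    rw [hev]

theorem main_aux (p : ℕ) [Fact p.Prime] [CharP C p] (hN : ∀ a : Polynomial Fq, a ≠ 0 →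
    ‖algebraMap (Polynomial Fq) C a‖ = (Fintype.card Fq : ℝ) ^ a.natDegree)
    (S : Ctx C (Fintype.card Fq)) (hθ : S.θ = algebraMap (Polynomial Fq) C Polynomial.X)
    {I : Type*} [Fintype I] (l : I → C)
    (halg : ∀ i, IsAlgebraic (RatFunc Fq) (S.ex (l i)))
    (hl : LinearIndependent (RatFunc Fq) l) : AlgebraicIndependent (RatFunc Fq) l := by
  classical
  obtain ⟨L0, hL0, hL0B, hL0e⟩ := S.exists_L0
  have hl0 : ev S.θ L0 ≠ 0 := by
    intro h0
    obtain ⟨a, -, ha⟩ := core p hN S hθ hL0 hL0B hL0e (J := Unit) () (fun _ => ev S.θ L0) rfl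
      (fun j hj => absurd rfl hj) (fun c _ j hj => absurd rfl hj)
    exact ha.ne_zero () (by rw [h0, mul_zero])
  obtain ⟨b, hbt, hsb, hspan, hbi⟩ := exists_linearIndepOn_extension (K := RatFunc Fq) (v := id)
    (s := {ev S.θ L0}) (t := insert (ev S.θ L0) (Set.range l))
    (LinearIndepOn.singleton hl0) (by simp)
  have hbfin : b.Finite := ((Set.finite_range l).insert _).subset hbt
  have : Fintype b := hbfin.fintype
  have hbi' : LinearIndependent (RatFunc Fq) (fun j : b => (j : C)) := hbi
  obtain ⟨a, ha0, ha⟩ := core p hN S hθ hL0 hL0B hL0e (J := b) ⟨ev S.θ L0, hsb rfl⟩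
    (fun j => (j : C)) rfl
    (fun j hj => by
      rcases hbt j.2 with h | ⟨i, hi⟩
      · exact absurd (Subtype.ext h) hj
      · rw [← hi]; exact halg i)
    (fun c hc j _ => by
      have h1 := Fintype.linearIndependent_iff.1 hbi' (fun j => algebraMap _ (RatFunc Fq) (c j))
        (by
          rw [← hc]
          refine sum_congr rfl fun j _ => ?_
          rw [Algebra.smul_def, ← IsScalarTower.algebraMap_apply]) j
      exact IsFractionRing.injective (Polynomial Fq) (RatFunc Fq) (by rw [h1, map_zero]))
  refine algIndep_of_linear ha hl fun i => ?_
  have h1 : l i ∈ Submodule.span (RatFunc Fq) b := by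
    have := hspan ⟨l i, Set.mem_insert_of_mem _ ⟨i, rfl⟩, rfl⟩
    simpa using this
  refine (Submodule.span_le.2 ?_) h1
  intro z hz
  have h2 : algebraMap (Polynomial Fq) (RatFunc Fq) a ≠ 0 := fun h =>
    ha0 (IsFractionRing.injective (Polynomial Fq) (RatFunc Fq) (by rw [h, map_zero]))
  have h3 : z = (algebraMap (Polynomial Fq) (RatFunc Fq) a)⁻¹ • (algebraMap _ C a * z) := by
    rw [IsScalarTower.algebraMap_apply (Polynomial Fq) (RatFunc Fq) C, ← Algebra.smul_def,
      smul_smul, inv_mul_cancel₀ h2, one_smul]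
  rw [h3]
  exact Submodule.smul_mem _ _ (Submodule.subset_span ⟨⟨z, hz⟩, rfl⟩)

end

end Carlitz

/-- **Papanikolas' theorem on Carlitz logarithms.**  Let `q` be a prime power,
`K = 𝔽_q(θ)` with `|a| = q^{deg_θ a}`, and `C` the completion of an algebraic
closure of `K_∞ = 𝔽_q((1/θ))` — modelled as a complete, algebraically closed
normed field extension of `K` whose norm restricts on `K` to
`|a| = q^{intDegree a}`.  If `ℓ_1, …, ℓ_m ∈ C` satisfy `e_Car(ℓ_i) ∈ K^alg`
for each `i` and are linearly independent over `K`, then they are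
algebraically independent over `K`. -/
theorem stmt_17 (Fq : Type*) [Field Fq] [Fintype Fq]
    (C : Type*) [NormedField C] [CompleteSpace C] [IsAlgClosed C]
    [Algebra (RatFunc Fq) C]
    (hnorm : ∀ r : RatFunc Fq, r ≠ 0 →
      ‖algebraMap (RatFunc Fq) C r‖ = (Fintype.card Fq : ℝ) ^ r.intDegree)
    (m : ℕ) (ℓ : Fin m → C)
    (halg : ∀ i, IsAlgebraic (RatFunc Fq) (carlitzExp Fq C (ℓ i)))
    (hlin : LinearIndependent (RatFunc Fq) ℓ) :
    AlgebraicIndependent (RatFunc Fq) ℓ := by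
  classical
  have hq : 2 ≤ Fintype.card Fq := Fintype.one_lt_card
  have hnn : ∀ n : ℕ, ‖(n : C)‖ ≤ 1 := fun n => by
    by_cases h0 : (n : RatFunc Fq) = 0
    · have : (n : C) = 0 := by rw [← map_natCast (algebraMap (RatFunc Fq) C), h0, map_zero]
      rw [this, norm_zero]; exact zero_le_one
    · rw [← map_natCast (algebraMap (RatFunc Fq) C), hnorm _ h0]
      have h1 : (n : RatFunc Fq) = algebraMap (Polynomial Fq) (RatFunc Fq) (n : Polynomial Fq) := by
        rw [map_natCast]
      rw [h1, RatFunc.intDegree_polynomial, Polynomial.natDegree_natCast]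
      simp
  have : IsUltrametricDist C := IsUltrametricDist.isUltrametricDist_of_forall_norm_natCast_le_one hnn
  letI : Algebra (Polynomial Fq) C :=
    ((algebraMap (RatFunc Fq) C).comp (algebraMap (Polynomial Fq) (RatFunc Fq))).toAlgebra
  have : IsScalarTower (Polynomial Fq) (RatFunc Fq) C := IsScalarTower.of_algebraMap_eq fun _ => rfl
  have hN : ∀ a : Polynomial Fq, a ≠ 0 →
      ‖algebraMap (Polynomial Fq) C a‖ = (Fintype.card Fq : ℝ) ^ a.natDegree := fun a ha => by
    rw [IsScalarTower.algebraMap_apply (Polynomial Fq) (RatFunc Fq) C, hnorm _ (fun h =>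
      ha (IsFractionRing.injective (Polynomial Fq) (RatFunc Fq) (by rw [h, map_zero]))),
      RatFunc.intDegree_polynomial, zpow_natCast]
  obtain ⟨p, hp⟩ := CharP.exists Fq
  obtain ⟨n, hprime, hcard⟩ := FiniteField.card Fq p
  have : Fact p.Prime := ⟨hprime⟩
  have : CharP C p := charP_of_injective_ringHom
    ((algebraMap (Polynomial Fq) C).comp Polynomial.C).injective p
  let φ : C →+* C := iterateFrobenius C p n
  have hφ : ∀ x, φ x = x ^ Fintype.card Fq := fun x => by
    rw [hcard]; exact iterateFrobenius_def p n x
  let S : Carlitz.Ctx C (Fintype.card Fq) :=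
    { hq := hq
      φ := φ
      hφ := hφ
      hsurj := fun x => by
        obtain ⟨z, hz⟩ := IsAlgClosed.exists_pow_nat_eq x (n := Fintype.card Fq) (by omega)
        exact ⟨z, by rw [hφ, hz]⟩
      θ := algebraMap (Polynomial Fq) C Polynomial.X
      hθ := by rw [hN _ Polynomial.X_ne_zero, Polynomial.natDegree_X, pow_one] }
  have hθ : algebraMap (RatFunc Fq) C RatFunc.X = S.θ := by
    show _ = algebraMap (RatFunc Fq) C (algebraMap (Polynomial Fq) (RatFunc Fq) Polynomial.X)
    rw [RatFunc.algebraMap_X]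
  have hD : ∀ i, carlitzD Fq C i = Carlitz.cD S.θ (Fintype.card Fq) i := fun i => by
    induction i with
    | zero => rfl
    | succ i ih => rw [carlitzD, Carlitz.cD, ih, hθ]
  have hE : ∀ z, carlitzExp Fq C z = S.ex z := fun z => by
    simp only [carlitzExp, Carlitz.Ctx.ex, hD]
  exact Carlitz.main_aux p hN S rfl ℓ (fun i => by rw [← hE]; exact halg i) hlin
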